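/- Let p be the crossover probability of a binary symmetric channel with 0.046 ≤ p < 1/2, and let R₁ = R̄(δ₁). Then for every rate R with R₁ ≤ R ≤ R_crit, the channel reliability equals the random coding exponent: E(R,p) = E₀(R,p) = D(ρ‖p) + R_crit − R. -/

import Mathlib

open Real Filter

/-- Binary entropy function (base-2 logarithms). -/
noncomputable def H (x : ℝ) : ℝ := -(x * logb 2 x) - (1 - x) * logb 2 (1 - x)

/-- Inverse of the binary entropy function, taking values in `[0,1/2]`. -/
noncomputable def Hinv (y : ℝ) : ℝ := sInf {x | x ∈ Set.Icc (0:ℝ) (1/2) ∧ H x = y}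

/-- `A(ω) = ω log₂(2√(p(1−p)))`. -/
noncomputable def Afun (p ω : ℝ) : ℝ := ω * logb 2 (2 * Real.sqrt (p * (1 - p)))

/-- `B(ω,λ) = −ω − (1−ω)h(p) + max_{η ∈ [λp/2, min(λ/4, p(1−ω))]}
[λh(2η/λ) + (ω−λ/2)h((ω−2η)/(2ω−λ)) + (1−ω−λ/2)h((p(1−ω)−η)/(1−ω−λ/2))]`. -/
noncomputable def Bfun (p ω l : ℝ) : ℝ :=
  -ω - (1 - ω) * H p +
    sSup ((fun η => l * H (2 * η / l) + (ω - l / 2) * H ((ω - 2 * η) / (2 * ω - l)) +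
        (1 - ω - l / 2) * H ((p * (1 - ω) - η) / (1 - ω - l / 2))) ''
      Set.Icc (l * p / 2) (min (l / 4) (p * (1 - ω))))

/-- BSC output distribution: `P_x(Y) = Σ_{y∈Y} p^{d(x,y)}(1−p)^{n−d(x,y)}`. -/
noncomputable def Px {n : ℕ} (p : ℝ) (x : Fin n → ZMod 2) (Y : Finset (Fin n → ZMod 2)) : ℝ :=
  ∑ y ∈ Y, p ^ hammingDist x y * (1 - p) ^ (n - hammingDist x y)

/-- Average maximum-likelihood decoding error probability of a code on the BSC
(ties counted as errors). -/
noncomputable def Pe {n : ℕ} (p : ℝ) (C : Finset (Fin n → ZMod 2)) : ℝ :=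
  (C.card : ℝ)⁻¹ * ∑ x ∈ C, Px p x
    (Finset.univ.filter fun y => ∃ c ∈ C, c ≠ x ∧ hammingDist c y ≤ hammingDist x y)

/-- Reliability function of the BSC:
`E(R,p) = limsup (1/n) log₂ max{1/P_e(C,p) : C ⊆ 𝔽₂ⁿ, |C| ≥ 2^{Rn}}`. -/
noncomputable def relE (p R : ℝ) : ℝ :=
  limsup (fun n : ℕ =>
    (n : ℝ)⁻¹ * logb 2 (sSup ((fun C : Finset (Fin n → ZMod 2) => 1 / Pe p C) ''
      {C | (2 : ℝ) ^ (R * n) ≤ C.card}))) atTop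

/-- `G(α,τ) = 2(α(1−α)−τ(1−τ))/(1+2√(τ(1−τ)))`. -/
noncomputable def Gfun (α τ : ℝ) : ℝ :=
  2 * (α * (1 - α) - τ * (1 - τ)) / (1 + 2 * Real.sqrt (τ * (1 - τ)))

/-- The linear-programming bound `δ̄(R) = min_{0≤α≤1/2} G(α,τ)` on the relative distance,
where `τ` satisfies `h(τ) = h(α) − 1 + R`. -/
noncomputable def dbar (R : ℝ) : ℝ :=
  sInf ((fun α => Gfun α (Hinv (H α - 1 + R))) '' Set.Icc 0 (1/2))

/-- `τ_ν(ξ) = (1/2)(1 − √(1 − 4(√(ν(1−ν) − ξ(1−ξ)) − ξ)²))`. -/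
noncomputable def taunu (ν ξ : ℝ) : ℝ :=
  (1/2) * (1 - Real.sqrt (1 - 4 * (Real.sqrt (ν * (1 - ν) - ξ * (1 - ξ)) - ξ)^2))

/-- `R̄(δ) = 1 + min_{(1/2)(1−√(1−2δ)) ≤ α ≤ 1/2} (h(τ_α(δ/2)) − h(α))`, the inverse of
the linear-programming bound. -/
noncomputable def Rbar (δ : ℝ) : ℝ :=
  1 + sInf ((fun α => H (taunu α (δ/2)) - H α) ''
    Set.Icc ((1/2) * (1 - Real.sqrt (1 - 2*δ))) (1/2))

/-- Binary information divergence `D(x‖y)` (base-2 logarithms). -/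
noncomputable def Dkl (x y : ℝ) : ℝ :=
  x * logb 2 (x / y) + (1 - x) * logb 2 ((1 - x) / (1 - y))

theorem three_mul_sinh_le {x : ℝ} (hx : 0 ≤ x) : 3 * sinh x ≤ x * (2 + cosh x) := by
  have key (f f' : ℝ → ℝ) (hf : ∀ x, HasDerivAt f (f' x) x) (h0 : f 0 = 0)
      (h : ∀ x, 0 ≤ x → 0 ≤ f' x) : ∀ x, 0 ≤ x → 0 ≤ f x := by
    intro x hx
    have hm : MonotoneOn f (Set.Ici 0) := by
      apply monotoneOn_of_deriv_nonneg (convex_Ici 0)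
      · exact fun y _ => (hf y).continuousAt.continuousWithinAt
      · exact fun y _ => (hf y).differentiableAt.differentiableWithinAt
      · intro y hy
        rw [(hf y).deriv]
        rw [interior_Ici] at hy
        exact h y (le_of_lt hy)
    have := hm (Set.mem_Ici.2 le_rfl) (Set.mem_Ici.2 hx) hx
    rwa [h0] at this
  have h1 := key (fun x => x * cosh x - sinh x) (fun x => x * sinh x)
    (fun x => by
      refine (((hasDerivAt_id x).mul (hasDerivAt_cosh x)).sub (hasDerivAt_sinh x)).congr_deriv ?_
      simp) (by simp)
    (fun x hx => mul_nonneg hx (sinh_nonneg_iff.2 hx))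
  have h2 := key (fun x => 2 * x + x * cosh x - 3 * sinh x) (fun x => 2 - 2 * cosh x + x * sinh x)
    (fun x => by
      refine ((((hasDerivAt_id x).const_mul 2).add ((hasDerivAt_id x).mul (hasDerivAt_cosh x))).sub
        ((hasDerivAt_sinh x).const_mul 3)).congr_deriv ?_
      simp; ring) (by simp)
    (key (fun x => 2 - 2 * cosh x + x * sinh x) (fun x => x * cosh x - sinh x) (fun x => by
      refine (((((hasDerivAt_cosh x).const_mul 2).const_sub 2)).add
        ((hasDerivAt_id x).mul (hasDerivAt_sinh x))).congr_deriv ?_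
      simp; ring) (by simp) h1)
  have := h2 x hx
  linarith

/-- Lower bound for `arcosh`. -/
theorem le_arcosh {c : ℝ} (hc : 1 ≤ c) : 3 * √(c ^ 2 - 1) / (2 + c) ≤ arcosh c := by
  have := three_mul_sinh_le (arcosh_nonneg hc)
  rw [sinh_arcosh hc, cosh_arcosh hc] at this
  rw [div_le_iff₀ (by linarith)]
  exact this

/-- Taylor bound for the logarithm. -/
theorem abs_log_sub_taylor_le {y : ℝ} (n : ℕ) (hy : |1 - y| < 1) :
    |(∑ i ∈ Finset.range n, (1 - y) ^ (i + 1) / ((i : ℝ) + 1)) + log y| ≤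
      |1 - y| ^ (n + 1) / (1 - |1 - y|) := by
  have := abs_log_sub_add_sum_range_le hy n
  rwa [sub_sub_cancel] at this

/-- `(1 + c)` times the exponent (natural logarithms) of the number of competing pairs, as
a function of `c = 1 / (2 √(p (1 - p)))`. -/
noncomputable def pairExp (c : ℝ) : ℝ :=
  (5 / 2) * (1 + c) * log (1 + c) - (1 / 2) * (1 + c) * log 2
    - (√c - 1) * ((√c - 1) * log (√c - 1)) - (√c + 1) ^ 2 * log (√c + 1)
    - 2 * c * log c + (c - 1 / 2) * log (2 * c - 1) - (1 / 2) * (arcosh c * √(c ^ 2 - 1))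

theorem hasDerivAt_sqrt_sq_sub_one {c : ℝ} (hc : 1 < c) :
    HasDerivAt (fun c : ℝ => √(c ^ 2 - 1)) (c / √(c ^ 2 - 1)) c := by
  have h : 0 < c ^ 2 - 1 := by nlinarith
  refine (((hasDerivAt_pow 2 c).sub_const 1).sqrt h.ne').congr_deriv ?_
  simp; field_simp

theorem hasDerivAt_pairExp {c : ℝ} (hc : 1 < c) :
    HasDerivAt pairExp ((5 / 2) * log (1 + c) - (1 / 2) * log 2 - log (√c - 1) - log (√c + 1)
      - (log (√c + 1) - log (√c - 1)) / √c - 2 * log c + log (2 * c - 1)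
      - (1 / 2) * (c * arcosh c / √(c ^ 2 - 1))) c := by
  have hb : 1 < √c := by rw [lt_sqrt] <;> linarith
  have h2 : 0 < c ^ 2 - 1 := by nlinarith
  have hs : 0 < √(c ^ 2 - 1) := sqrt_pos.2 h2
  have hsq := (hasDerivAt_id c).sqrt (by simp; linarith)
  have h1 := ((hasDerivAt_id c).const_add 1).log (by simp; linarith)
  have hm := (hsq.sub_const 1).log (by simp; linarith)
  have hp := (hsq.add_const 1).log (by simp; linarith)
  have hl := (hasDerivAt_id c).log (by simp; linarith)
  have h2c := (((hasDerivAt_id c).const_mul 2).sub_const 1).log (by simp; linarith)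
  have := ((((((((hasDerivAt_id c).const_add 1).const_mul (5/2)).mul h1).sub
    ((((hasDerivAt_id c).const_add 1).const_mul (1/2)).mul_const (log 2))).sub
    ((hsq.sub_const 1).mul ((hsq.sub_const 1).mul hm))).sub
    (((hsq.add_const 1).pow 2).mul hp)).sub (((hasDerivAt_id c).const_mul 2).mul hl)).add
    (((hasDerivAt_id c).sub_const (1/2)).mul h2c) |>.sub
    (((hasDerivAt_arcosh (Set.mem_Ioi.2 hc)).mul (hasDerivAt_sqrt_sq_sub_one hc)).const_mul (1/2))
  refine this.congr_deriv ?_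
  simp only [id, Pi.pow_apply, Pi.mul_apply]
  have e1 : √c - 1 ≠ 0 := by linarith
  have e2 : √c + 1 ≠ 0 := by linarith
  have e3 : 1 + c ≠ 0 := by linarith
  have e4 : 2 * c - 1 ≠ 0 := by linarith
  have e5 : c ≠ 0 := by linarith
  have e6 : √c ≠ 0 := by linarith
  field_simp
  have : c = √c ^ 2 := (sq_sqrt (by linarith)).symm
  ring_nf

theorem hasDerivAt_deriv_pairExp {c : ℝ} (hc : 1 < c) :
    HasDerivAt (fun c => (5 / 2) * log (1 + c) - (1 / 2) * log 2 - log (√c - 1) - log (√c + 1)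
      - (log (√c + 1) - log (√c - 1)) / √c - 2 * log c + log (2 * c - 1)
      - (1 / 2) * (c * arcosh c / √(c ^ 2 - 1)))
      (5 / (2 * (1 + c)) - 3 / c + (log (√c + 1) - log (√c - 1)) / (2 * c * √c) + 2 / (2 * c - 1)
        - (1 / 2) * ((c - arcosh c / √(c ^ 2 - 1)) / (c ^ 2 - 1))) c := by
  have hb : 1 < √c := by rw [lt_sqrt] <;> linarith
  have h2 : 0 < c ^ 2 - 1 := by nlinarith
  have hs : 0 < √(c ^ 2 - 1) := sqrt_pos.2 h2
  have hsq := (hasDerivAt_id c).sqrt (by simp; linarith)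
  have h1 := ((hasDerivAt_id c).const_add 1).log (by simp; linarith)
  have hm := (hsq.sub_const 1).log (by simp; linarith)
  have hp := (hsq.add_const 1).log (by simp; linarith)
  have hl := (hasDerivAt_id c).log (by simp; linarith)
  have h2c := (((hasDerivAt_id c).const_mul 2).sub_const 1).log (by simp; linarith)
  have := ((((((h1.const_mul (5/2)).sub_const ((1/2) * log 2)).sub hm).sub hp).sub
    ((hp.sub hm).div hsq (by simp; linarith))).sub (hl.const_mul 2)).add h2c |>.sub
    ((((hasDerivAt_id c).mul (hasDerivAt_arcosh (Set.mem_Ioi.2 hc))).div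
      (hasDerivAt_sqrt_sq_sub_one hc) hs.ne').const_mul (1/2))
  refine this.congr_deriv ?_
  simp only [id]
  have e1 : √c - 1 ≠ 0 := by linarith
  have e2 : √c + 1 ≠ 0 := by linarith
  have e3 : 1 + c ≠ 0 := by linarith
  have e4 : 2 * c - 1 ≠ 0 := by linarith
  have e5 : c ≠ 0 := by linarith
  have e6 : √c ≠ 0 := by linarith
  have e7 := h2.ne'
  set s := √(c ^ 2 - 1) with hs'
  have hs2 : s ^ 2 = c ^ 2 - 1 := sq_sqrt h2.le
  set b := √c with hb'
  have hb2 : c = b ^ 2 := (sq_sqrt (by linarith)).symm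
  rw [← hs2]
  have hs3 : s ^ 2 = b ^ 4 - 1 := by rw [hs2, hb2]; ring
  clear_value s b
  subst hb2
  field_simp
  simp only [Pi.sub_apply, Pi.mul_apply, id, ← hb']
  linear_combination (-(b ^ 3 * (1 + b ^ 2) * (b - 1) * (b + 1) * (2 * b ^ 2 - 1)
    * arcosh (b ^ 2))) * hs3

theorem log_add_one_sub_log_sub_one_ge {b : ℝ} (hb : 1 < b) :
    2 / b + 2 / (3 * b ^ 3) ≤ log (b + 1) - log (b - 1) := by
  have h0 : 0 < b⁻¹ := by positivity
  have h1 : b⁻¹ < 1 := inv_lt_one_of_one_lt₀ hb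
  have hs := hasSum_log_sub_log_of_abs_lt_one (x := b⁻¹) (by rwa [abs_of_pos h0])
  have := sum_le_hasSum (Finset.range 2) (fun i _ => by positivity) hs
  have e : log (1 + b⁻¹) - log (1 - b⁻¹) = log (b + 1) - log (b - 1) := by
    rw [← log_div (by linarith) (by linarith), ← log_div (by linarith) (by linarith)]
    congr 1
    have : b - 1 ≠ 0 := by linarith
    field_simp
  rw [e] at this
  refine le_trans (le_of_eq ?_) this
  simp [Finset.sum_range_succ]
  field_simp
  ring

theorem pairExp_second_deriv_nonneg {c : ℝ} (hc : 1 < c) (hc' : c ≤ 2.387025) :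
    0 ≤ 5 / (2 * (1 + c)) - 3 / c + (log (√c + 1) - log (√c - 1)) / (2 * c * √c)
      + 2 / (2 * c - 1) - (1 / 2) * ((c - arcosh c / √(c ^ 2 - 1)) / (c ^ 2 - 1)) := by
  have hb : 1 < √c := by rw [lt_sqrt] <;> linarith
  have h2 : 0 < c ^ 2 - 1 := by nlinarith
  have hs : 0 < √(c ^ 2 - 1) := sqrt_pos.2 h2
  have hc0 : 0 < c := by linarith
  have e1 : (1 / c ^ 2) * (1 + 1 / (3 * c)) ≤
      (log (√c + 1) - log (√c - 1)) / (2 * c * √c) := by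
    rw [le_div_iff₀ (by positivity)]
    refine le_trans (le_of_eq ?_) (log_add_one_sub_log_sub_one_ge hb)
    have hb2 : c = √c ^ 2 := (sq_sqrt hc0.le).symm
    generalize √c = b at *
    subst hb2
    field_simp
  have e2 : (1 / 2) * ((c - arcosh c / √(c ^ 2 - 1)) / (c ^ 2 - 1)) ≤
      (c + 3) / (2 * (c + 1) * (c + 2)) := by
    have : 3 / (2 + c) ≤ arcosh c / √(c ^ 2 - 1) := by
      rw [le_div_iff₀ hs]
      refine le_trans (le_of_eq ?_) (le_arcosh hc.le)
      ring
    calc (1 / 2) * ((c - arcosh c / √(c ^ 2 - 1)) / (c ^ 2 - 1))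
        ≤ (1 / 2) * ((c - 3 / (2 + c)) / (c ^ 2 - 1)) := by gcongr
      _ = _ := by
        have : c ^ 2 - 1 ≠ 0 := h2.ne'
        field_simp
        ring
  have e3 : 0 ≤ 5 / (2 * (1 + c)) - 3 / c + (1 / c ^ 2) * (1 + 1 / (3 * c)) + 2 / (2 * c - 1)
      - (c + 3) / (2 * (c + 1) * (c + 2)) := by
    have h2c : 0 < 2 * c - 1 := by linarith
    have : 5 / (2 * (1 + c)) - 3 / c + (1 / c ^ 2) * (1 + 1 / (3 * c)) + 2 / (2 * c - 1)
      - (c + 3) / (2 * (c + 1) * (c + 2)) =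
      (45 + 103 * (c - 1) + 37 * (c - 1) ^ 2 - 29 * (c - 1) ^ 3 - 12 * (c - 1) ^ 4)
        / (6 * c ^ 3 * (c + 1) * (c + 2) * (2 * c - 1)) := by
      field_simp
      ring
    rw [this]
    apply div_nonneg _ (by positivity)
    obtain ⟨u, rfl⟩ : ∃ u, c = 1 + u := ⟨c - 1, by ring⟩
    norm_num at hc' ⊢
    have hu : 0 < u := by linarith
    have hu' : u ≤ 1.39 := by norm_num; linarith
    have : u ^ 3 ≤ 1.39 ^ 2 * u := by
      rw [pow_succ]; gcongr
    have : u ^ 4 ≤ 1.39 ^ 3 * u := by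
      rw [pow_succ]; gcongr
    norm_num at *
    nlinarith
  linarith

theorem convexOn_pairExp : ConvexOn ℝ (Set.Icc 1 2.387025) pairExp := by
  have hi : interior (Set.Icc (1 : ℝ) 2.387025) = Set.Ioo 1 2.387025 := interior_Icc
  refine convexOn_of_hasDerivWithinAt2_nonneg (convex_Icc _ _) ?_
    (fun c hc => (hasDerivAt_pairExp ?_).hasDerivWithinAt)
    (fun c hc => (hasDerivAt_deriv_pairExp ?_).hasDerivWithinAt)
    (fun c hc => pairExp_second_deriv_nonneg ?_ ?_)
  · have hcl : ContinuousOn arcosh (Set.Icc 1 2.387025) :=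
      continuousOn_arcosh.mono fun x hx => hx.1
    have hx : Continuous fun c : ℝ => (√c - 1) * log (√c - 1) :=
      continuous_mul_log.comp (by fun_prop : Continuous fun c : ℝ => √c - 1)
    unfold pairExp
    have h0 : ∀ c ∈ Set.Icc (1 : ℝ) 2.387025, 0 < c := fun c hc => by linarith [hc.1]
    have l1 : ContinuousOn (fun c : ℝ => log (1 + c)) (Set.Icc 1 2.387025) :=
      ContinuousOn.log (by fun_prop) fun c hc => by linarith [h0 c hc]
    have l2 : ContinuousOn (fun c : ℝ => log (√c + 1)) (Set.Icc 1 2.387025) :=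
      ContinuousOn.log (by fun_prop) fun c hc => by positivity
    have l3 : ContinuousOn (fun c : ℝ => log c) (Set.Icc 1 2.387025) :=
      ContinuousOn.log (by fun_prop) fun c hc => by linarith [h0 c hc]
    have l4 : ContinuousOn (fun c : ℝ => log (2 * c - 1)) (Set.Icc 1 2.387025) :=
      ContinuousOn.log (by fun_prop) fun c hc => by linarith [hc.1]
    have hx' := hx.continuousOn (s := Set.Icc (1 : ℝ) 2.387025)
    fun_prop
  all_goals rw [hi] at hc
  · exact hc.1
  · exact hc.1
  · exact hc.1
  · exact hc.2.le

theorem pairExp_one : pairExp 1 = 0 := by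
  norm_num [pairExp]
  ring

theorem pairExp_right_nonpos : pairExp 2.387025 ≤ 0 := by
  have hq : √(2.387025 : ℝ) = 1.545 := by
    rw [sqrt_eq_iff_mul_self_eq] <;> norm_num
  have a1 := abs_le.1 (abs_log_sub_taylor_le (y := 0.84675625) 6 (by norm_num [abs_lt]))
  have a2 := abs_le.1 (abs_log_sub_taylor_le (y := 1.2725) 9 (by norm_num [abs_lt]))
  have a3 := abs_le.1 (abs_log_sub_taylor_le (y := 0.7725) 8 (by norm_num [abs_lt]))
  have a4 := abs_le.1 (abs_log_sub_taylor_le (y := 1.09) 5 (by norm_num [abs_lt]))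
  have a5 := abs_le.1 (abs_log_sub_taylor_le (y := 0.9435125) 4 (by norm_num [abs_lt]))
  have a6 := abs_le.1 (abs_log_sub_taylor_le (y := 1.1386) 6 (by norm_num [abs_lt]))
  have l4 : log 4 = 2 * log 2 := by
    rw [show (4 : ℝ) = 2 ^ 2 by norm_num, log_pow]; norm_num
  have b1 : log (1 + 2.387025) = log 0.84675625 + 2 * log 2 := by
    rw [← l4, ← log_mul] <;> norm_num
  have b2 : log (1.545 + 1) = log 1.2725 + log 2 := by rw [← log_mul] <;> norm_num
  have b3 : log 2.387025 = 2 * (log 0.7725 + log 2) := by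
    rw [← log_mul (by norm_num) (by norm_num), show (2.387025 : ℝ) = (0.7725 * 2) ^ 2 by norm_num,
      log_pow]; norm_num
  have b4 : log (1.545 - 1) = log 1.09 - log 2 := by rw [← log_div] <;> norm_num
  have b5 : log (2 * 2.387025 - 1) = log 0.9435125 + 2 * log 2 := by
    rw [← l4, ← log_mul] <;> norm_num
  have hs : (2.1674 : ℝ) ≤ √(2.387025 ^ 2 - 1) := by
    apply le_sqrt_of_sq_le; norm_num
  have b6 : log 1.1386 + 2 * log 2 ≤ arcosh 2.387025 := by
    rw [← l4, ← log_mul (by norm_num) (by norm_num), arcosh]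
    apply log_le_log (by norm_num)
    norm_num at hs ⊢
    linarith
  have l2 := log_two_gt_d9
  have l2' := log_two_lt_d9
  have b7 : (log 1.1386 + 2 * log 2) * 2.1674 ≤ arcosh 2.387025 * √(2.387025 ^ 2 - 1) := by
    apply mul_le_mul b6 hs (by norm_num)
    exact arcosh_nonneg (by norm_num)
  have m6 := a6.1
  have m1 := a1.2
  have m2 := a2.1
  have m3 := a3.1
  have m4 := a4.1
  have m5 := a5.2
  clear a1 a2 a3 a4 a5 a6
  simp only [Finset.sum_range_succ, Finset.sum_range_zero] at m1 m2 m3 m4 m5 m6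
  norm_num [abs_of_pos, abs_of_neg] at m1 m2 m3 m4 m5 m6
  rw [pairExp, hq, b1, b2, b3, b4, b5]
  norm_num at b7 l2 l2' ⊢
  linarith

theorem pairExp_nonpos {c : ℝ} (h1 : 1 ≤ c) (h2 : c ≤ 2.387025) : pairExp c ≤ 0 := by
  have := convexOn_pairExp.le_max_of_mem_Icc (x := 1) (y := 2.387025) (z := c)
    ⟨le_rfl, by norm_num⟩ ⟨by norm_num, le_rfl⟩ ⟨h1, h2⟩
  rw [pairExp_one] at this
  exact this.trans (max_le le_rfl pairExp_right_nonpos)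

/-- `cosh (-log g)`. -/
noncomputable def chalf (g : ℝ) : ℝ := (1 + g ^ 2) / (2 * g)

/-- The solution `τ < 1/2` of `(1 - 2 τ) ^ 2 = 4 δ (1 - δ)` for `δ = 2 g / (1 + g) ^ 2`. -/
noncomputable def tauCrit (g : ℝ) : ℝ := (√(chalf g) - 1) ^ 2 / (2 * (1 + chalf g))

/-- Exponent slope in the weight. -/
noncomputable def pairSlope (g : ℝ) : ℝ :=
  2 * log (1 + g ^ 2) - 2 * log 2 - log g - (3 / 2) * log (1 - g + g ^ 2)
    + (g ^ 2 / (1 + g ^ 2)) * log g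

theorem one_lt_chalf {g : ℝ} (h0 : 0 < g) (h1 : g < 1) : 1 < chalf g := by
  rw [chalf, lt_div_iff₀ (by linarith)]
  nlinarith [sq_pos_of_pos (sub_pos.2 h1)]

theorem log_facts {g : ℝ} (h0 : 0 < g) (h1 : g < 1) :
    log (1 + g ^ 2) = log 2 + log g + log (chalf g) ∧
    log (1 - g + g ^ 2) = log g + log (2 * chalf g - 1) ∧
    2 * log (1 + g) = log 2 + log g + log (1 + chalf g) ∧
    arcosh (chalf g) = - log g ∧ √(chalf g ^ 2 - 1) = (1 - g ^ 2) / (2 * g) := by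
  have hc := one_lt_chalf h0 h1
  have e1 : 1 + g ^ 2 = 2 * g * chalf g := by rw [chalf]; field_simp
  refine ⟨?_, ?_, ?_, ?_, ?_⟩
  · rw [e1, log_mul (by positivity) (by linarith), log_mul (by norm_num) h0.ne']
  · rw [← log_mul h0.ne' (by linarith)]
    congr 1
    linarith
  · rw [← log_mul (by norm_num) h0.ne', ← log_mul (by positivity) (by linarith),
      show 2 * g * (1 + chalf g) = (1 + g) ^ 2 by linarith, log_pow]
    norm_num
  · have : chalf g = cosh (- log g) := by
      rw [cosh_neg, cosh_log h0, chalf]; field_simp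
      ring
    rw [this, arcosh_cosh (by linarith [log_neg h0 h1])]
  · rw [← sqrt_sq (div_nonneg (by nlinarith) (by linarith) : 0 ≤ (1 - g ^ 2) / (2 * g)), chalf]
    congr 1
    field_simp
    ring

theorem log_le_half_sub_inv {c : ℝ} (hc : 1 ≤ c) : log c ≤ (c - 1 / c) / 2 := by
  have := self_le_sinh_iff.2 (log_nonneg hc)
  rwa [sinh_log (by linarith), ← one_div] at this

theorem pairSlope_nonneg {g : ℝ} (h0 : 0 < g) (h1 : g < 1) (hg : chalf g ≤ 2.387025) :
    0 ≤ pairSlope g := by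
  obtain ⟨l1, l2, -, l4, l5⟩ := log_facts h0 h1
  have hc := one_lt_chalf h0 h1
  have e1 : 1 + g ^ 2 = 2 * g * chalf g := by rw [chalf]; field_simp
  have hx := le_arcosh hc.le
  rw [l4] at hx
  have key : pairSlope g = 2 * log (chalf g) - (3 / 2) * log (2 * chalf g - 1)
      + (1 / 2) * (- log g * (√(chalf g ^ 2 - 1) / chalf g)) := by
    rw [pairSlope, l1, l2, l5, e1]
    have : (1 - g ^ 2) / (2 * g) / chalf g = 1 - 2 * (g ^ 2 / (2 * g * chalf g)) := by
      have : chalf g ≠ 0 := by linarith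
      field_simp
      linarith
    rw [this]
    ring
  rw [key]
  generalize chalf g = c at *
  have hs0 : 0 ≤ √(c ^ 2 - 1) := sqrt_nonneg _
  have hs2 : √(c ^ 2 - 1) ^ 2 = c ^ 2 - 1 := sq_sqrt (by nlinarith)
  have hc0 : 0 < c := by linarith
  have a1 : 3 * (c ^ 2 - 1) / (c * (2 + c)) ≤ - log g * (√(c ^ 2 - 1) / c) := by
    refine le_trans (le_of_eq ?_) (mul_le_mul_of_nonneg_right hx (by positivity))
    generalize √(c ^ 2 - 1) = s at *
    rw [← hs2]
    field_simp
  have a2 : 3 * log (2 * c - 1) - 6 * log c ≤ 3 * ((2 * c - 1) / c ^ 2 - 1) := by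
    have := log_le_sub_one_of_pos (x := (2 * c - 1) / c ^ 2) (div_pos (by linarith) (by positivity))
    rw [log_div (by linarith) (by positivity), log_pow] at this
    push_cast at this
    linarith
  have a3 := log_le_half_sub_inv hc.le
  have a4 : 3 * ((2 * c - 1) / c ^ 2 - 1) + 2 * ((c - 1 / c) / 2)
      ≤ 3 * (c ^ 2 - 1) / (c * (2 + c)) := by
    rw [← sub_nonneg]
    have : 3 * (c ^ 2 - 1) / (c * (2 + c)) - (3 * ((2 * c - 1) / c ^ 2 - 1) + 2 * ((c - 1 / c) / 2))
      = (c - 1) * (-c ^ 3 + 3 * c ^ 2 + 4 * c - 6) / (c ^ 2 * (2 + c)) := by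
      field_simp
      ring
    rw [this]
    apply div_nonneg _ (by positivity)
    apply mul_nonneg (by linarith)
    have : -c ^ 3 + 3 * c ^ 2 + 4 * c - 6 = (c - 1) * (- c ^ 2 + 2 * c + 6) := by ring
    rw [this]
    apply mul_nonneg (by linarith)
    norm_num at hg
    nlinarith
  linarith

theorem corner_exponent_nonpos {g : ℝ} (h0 : 0 < g) (h1 : g < 1) (hg : chalf g ≤ 2.387025) :
    binEntropy (tauCrit g) + 3 * log (1 + g) - log 2 - 2 * log (1 + g ^ 2)
      + log (1 - g + g ^ 2) - (g ^ 2 / (1 + g ^ 2)) * log g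
      + (2 * g / (1 + g) ^ 2) * pairSlope g ≤ 0 := by
  obtain ⟨l1, l2, l3, l4, l5⟩ := log_facts h0 h1
  have hc := one_lt_chalf h0 h1
  have e1 : 1 + g ^ 2 = 2 * g * chalf g := by rw [chalf]; field_simp
  have e2 : 2 * g / (1 + g) ^ 2 = 1 / (1 + chalf g) := by
    rw [div_eq_div_iff (by positivity) (by linarith)]; linarith
  have e3 : g ^ 2 / (1 + g ^ 2) = (1 - √(chalf g ^ 2 - 1) / chalf g) / 2 := by
    rw [l5, e1]
    have : chalf g ≠ 0 := by linarith
    field_simp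
    linarith
  have hb : 1 < √(chalf g) := by rw [lt_sqrt] <;> linarith
  have e4 : (1 + chalf g) * binEntropy (tauCrit g) = (1 + chalf g) * (log 2 + log (1 + chalf g))
      - (√(chalf g) - 1) ^ 2 * log (√(chalf g) - 1) - (√(chalf g) + 1) ^ 2 * log (√(chalf g) + 1) := by
    have hb2 := sq_sqrt (by linarith : 0 ≤ chalf g)
    have t1 : 1 - tauCrit g = (√(chalf g) + 1) ^ 2 / (2 * (1 + chalf g)) := by
      rw [tauCrit]; field_simp; linarith
    rw [binEntropy, log_inv, log_inv, t1, tauCrit]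
    rw [log_div (by nlinarith) (by linarith), log_div (by positivity) (by linarith), log_pow, log_pow,
      log_mul (by norm_num) (by linarith)]
    field_simp
    push_cast
    linear_combination (2 * (log 2 + log (1 + chalf g))) * hb2
  have hE := pairExp_nonpos hc.le hg
  have : (1 + chalf g) * (binEntropy (tauCrit g) + 3 * log (1 + g) - log 2 - 2 * log (1 + g ^ 2)
      + log (1 - g + g ^ 2) - (g ^ 2 / (1 + g ^ 2)) * log g
      + (2 * g / (1 + g) ^ 2) * pairSlope g) = pairExp (chalf g) := by
    rw [pairSlope, l1, l2, show 3 * log (1 + g) = 3 / 2 * (2 * log (1 + g)) by ring, l3, e2, e3,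
      pairExp, l4, mul_add, mul_sub, mul_add, mul_sub, mul_sub, mul_add, e4]
    have : chalf g ≠ 0 := by linarith
    field_simp
    ring
  by_contra! h
  have := mul_pos (by linarith : 0 < 1 + chalf g) h
  linarith

theorem hasDerivAt_tanh_add_sinh_sub (d x : ℝ) :
    HasDerivAt (fun x => sinh x / cosh x + d * sinh x - x) (1 / cosh x ^ 2 + d * cosh x - 1) x := by
  have hc := cosh_pos x
  refine ((((hasDerivAt_sinh x).div (hasDerivAt_cosh x) hc.ne').add
    ((hasDerivAt_sinh x).const_mul d)).sub (hasDerivAt_id x)).congr_deriv ?_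
  have : cosh x * cosh x - sinh x * sinh x = 1 := by
    have := cosh_sq_sub_sinh_sq x
    linarith
  rw [this]

theorem le_tanh_add_sinh {d x : ℝ} (hd : 0.295 ≤ d) (hx : 0 ≤ x) :
    x ≤ sinh x / cosh x + d * sinh x := by
  set C : ℝ := 3481 / 1180 + 1 / 11.8 with hC
  set d₀ : ℝ := (C ^ 2 - 1) / C ^ 3 with hd₀
  have hC3 : C = 3581 / 1180 := by rw [hC]; norm_num
  have hdd : d₀ ≤ d := by
    refine le_trans ?_ hd
    rw [hd₀, hC3]; norm_num
  set m : ℝ → ℝ := fun x => sinh x / cosh x + d₀ * sinh x - x with hm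
  have hder : ∀ x, HasDerivAt m (1 / cosh x ^ 2 + d₀ * cosh x - 1) x :=
    hasDerivAt_tanh_add_sinh_sub d₀
  have hcont : Continuous m := by
    rw [continuous_iff_continuousAt]; exact fun x => (hder x).continuousAt
  have hfac : ∀ x, 1 / cosh x ^ 2 + d₀ * cosh x - 1 =
      (cosh x - C) * (d₀ * cosh x ^ 2 - cosh x / C ^ 2 - 1 / C) / cosh x ^ 2 := by
    intro x
    have hc := cosh_pos x
    have : C ≠ 0 := by rw [hC3]; norm_num
    rw [hd₀]
    field_simp
    ring
  have qmono : ∀ u v : ℝ, 1 ≤ u → u ≤ v →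
      d₀ * u ^ 2 - u / C ^ 2 - 1 / C ≤ d₀ * v ^ 2 - v / C ^ 2 - 1 / C := by
    intro u v hu huv
    have h1 : 1 / C ^ 2 ≤ d₀ := by rw [hd₀, hC3]; norm_num
    have h2 : d₀ * v ^ 2 - v / C ^ 2 - (d₀ * u ^ 2 - u / C ^ 2) =
      (v - u) * (d₀ * (v + u) - 1 / C ^ 2) := by ring
    have : 0 ≤ (v - u) * (d₀ * (v + u) - 1 / C ^ 2) := by
      apply mul_nonneg (by linarith)
      have : 0 ≤ 1 / C ^ 2 := by positivity
      nlinarith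
    linarith
  set t₀ : ℝ := log 5.9 with ht₀
  have ct₀ : cosh t₀ = C := by rw [ht₀, cosh_log (by norm_num), hC3]; norm_num
  have st₀ : sinh t₀ = 3381 / 1180 := by rw [ht₀, sinh_log (by norm_num)]; norm_num
  have ht₀pos : 0 ≤ t₀ := log_nonneg (by norm_num)
  have mt₀ : 0 ≤ m t₀ := by
    have : t₀ ≤ 1.785 := by
      rw [ht₀, show (5.9 : ℝ) = 0.7375 * 2 ^ 3 by norm_num, log_mul (by norm_num) (by norm_num),
        log_pow]
      have a1 := (abs_le.1 (abs_log_sub_taylor_le (y := 0.7375) 6 (by norm_num [abs_lt]))).2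
      simp only [Finset.sum_range_succ, Finset.sum_range_zero] at a1
      norm_num [abs_of_pos] at a1
      have := log_two_lt_d9
      norm_num at this ⊢
      linarith
    simp only [hm]
    rw [ct₀, st₀, hd₀, hC3]
    norm_num at this ⊢
    linarith
  have hmain : 0 ≤ m x := by
    rcases le_total t₀ x with h | h
    · have hmon : MonotoneOn m (Set.Ici t₀) := by
        apply monotoneOn_of_deriv_nonneg (convex_Ici _) hcont.continuousOn
        · exact fun y _ => (hder y).differentiableAt.differentiableWithinAt
        · intro y hy
          rw [interior_Ici] at hy
          rw [(hder y).deriv, hfac]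
          have hcy : C ≤ cosh y := by
            rw [← ct₀, cosh_le_cosh, abs_of_nonneg ht₀pos, abs_of_nonneg (by linarith [hy.out])]
            exact hy.out.le
          apply div_nonneg _ (by positivity)
          apply mul_nonneg (by linarith)
          refine le_trans ?_ (qmono C _ (by rw [hC3]; norm_num) hcy)
          rw [hd₀, hC3]; norm_num
      exact mt₀.trans (hmon (Set.mem_Ici.2 le_rfl) h h)
    · by_cases hq : d₀ * cosh x ^ 2 - cosh x / C ^ 2 - 1 / C ≤ 0
      · have hmon : MonotoneOn m (Set.Icc 0 x) := by
          apply monotoneOn_of_deriv_nonneg (convex_Icc _ _) hcont.continuousOn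
          · exact fun y _ => (hder y).differentiableAt.differentiableWithinAt
          · intro y hy
            rw [interior_Icc] at hy
            rw [(hder y).deriv, hfac]
            have hyx : cosh y ≤ cosh x := by
              rw [cosh_le_cosh, abs_of_pos hy.1, abs_of_nonneg hx]; exact hy.2.le
            have hcy : cosh y ≤ C := by
              rw [← ct₀, cosh_le_cosh, abs_of_pos hy.1, abs_of_nonneg ht₀pos]
              exact hy.2.le.trans h
            apply div_nonneg _ (by positivity)
            apply mul_nonneg_of_nonpos_of_nonpos (by linarith)
            exact (qmono _ _ (one_le_cosh y) hyx).trans hq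
        have := hmon (Set.left_mem_Icc.2 hx) (Set.right_mem_Icc.2 hx) hx
        have h0 : m 0 = 0 := by simp [hm]
        rwa [h0] at this
      · push Not at hq
        have hmon : AntitoneOn m (Set.Icc x t₀) := by
          apply antitoneOn_of_deriv_nonpos (convex_Icc _ _) hcont.continuousOn
          · exact fun y _ => (hder y).differentiableAt.differentiableWithinAt
          · intro y hy
            rw [interior_Icc] at hy
            have hy0 : 0 < y := hx.trans_lt hy.1
            rw [(hder y).deriv, hfac]
            have hyx : cosh x ≤ cosh y := by
              rw [cosh_le_cosh, abs_of_pos hy0, abs_of_nonneg hx]; exact hy.1.le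
            have hcy : cosh y ≤ C := by
              rw [← ct₀, cosh_le_cosh, abs_of_pos hy0, abs_of_nonneg ht₀pos]
              exact hy.2.le
            apply div_nonpos_of_nonpos_of_nonneg _ (by positivity)
            apply mul_nonpos_of_nonpos_of_nonneg (by linarith)
            exact hq.le.trans (qmono _ _ (one_le_cosh x) hyx)
        exact mt₀.trans (hmon (Set.left_mem_Icc.2 h) (Set.right_mem_Icc.2 h) h)
  simp only [hm] at hmain
  exact (sub_nonneg.1 hmain).trans
    (add_le_add le_rfl (mul_le_mul_of_nonneg_right hdd (sinh_nonneg_iff.2 hx)))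

theorem le_artanh {y : ℝ} (h0 : 0 ≤ y) (h1 : y < 1) : y ≤ artanh y := by
  rw [artanh_eq_half_log ⟨by linarith, h1.le⟩, log_div (by linarith) (by linarith)]
  have := sum_le_hasSum (Finset.range 1) (fun i _ => by positivity)
    (hasSum_log_sub_log_of_abs_lt_one (x := y) (by rwa [abs_of_nonneg h0]))
  simp at this
  linarith

theorem mul_artanh_le {d v y : ℝ} (hd : 0.295 ≤ d) (hv0 : 0 < v) (hy0 : 0 ≤ y)
    (h : y ^ 2 + v ^ 2 = 1) : v * artanh y ≤ (v + d) * y := by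
  have hy1 : y < 1 := by nlinarith
  have hmem : y ∈ Set.Ioo (-1) 1 := ⟨by linarith, hy1⟩
  have hs : √(1 - y ^ 2) = v := by
    rw [show 1 - y ^ 2 = v ^ 2 by linarith, sqrt_sq hv0.le]
  have := le_tanh_add_sinh hd (artanh_nonneg hy0)
  rw [sinh_artanh hmem, cosh_artanh hmem, hs] at this
  have e : v * (y / v / (1 / v) + d * (y / v)) = (v + d) * y := by field_simp
  rw [← e]
  gcongr

theorem hasDerivAt_binEntropy_half {y : ℝ} (h0 : 0 ≤ y) (h1 : y < 1) :
    HasDerivAt (fun y => binEntropy ((1 - y) / 2)) (- artanh y) y := by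
  have := (hasDerivAt_binEntropy (p := (1 - y) / 2) (by linarith) (by linarith)).comp y
    (((hasDerivAt_id y).const_sub 1).div_const 2)
  refine this.congr_deriv ?_
  rw [artanh_eq_half_log ⟨by linarith, h1.le⟩, show 1 - (1 - y) / 2 = (1 + y) / 2 by ring,
    ← log_div (by linarith) (by linarith)]
  have : (1 + y) / 2 / ((1 - y) / 2) = (1 + y) / (1 - y) := by
    field_simp
  rw [this]
  ring

theorem antitoneOn_entropy_gap {d : ℝ} (hd : 0.295 ≤ d) :
    AntitoneOn (fun v : ℝ => binEntropy ((1 - √(1 - v ^ 2)) / 2) -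
      binEntropy ((1 - √(1 - (v ^ 2 + 2 * d * v + 2 * d))) / 2)) (Set.Icc 0 (1 - 2 * d)) := by
  have hder : ∀ v ∈ Set.Ioo 0 (1 - 2 * d), HasDerivAt (fun v : ℝ => binEntropy ((1 - √(1 - v ^ 2)) / 2) -
      binEntropy ((1 - √(1 - (v ^ 2 + 2 * d * v + 2 * d))) / 2))
      (artanh √(1 - v ^ 2) * v / √(1 - v ^ 2) - artanh √(1 - (v ^ 2 + 2 * d * v + 2 * d)) * (v + d)
        / √(1 - (v ^ 2 + 2 * d * v + 2 * d))) v := by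
    intro v hv
    have h1 : 0 < 1 - (v ^ 2 + 2 * d * v + 2 * d) := by
      norm_num at hd; nlinarith [hv.1, hv.2]
    have h2 : 0 < 1 - v ^ 2 := by norm_num at hd; nlinarith [hv.1, hv.2]
    have q1 := sqrt_pos.2 h1
    have q2 := sqrt_pos.2 h2
    have d1 := (hasDerivAt_binEntropy_half q1.le (by
      rw [sqrt_lt' one_pos]; norm_num at hd; nlinarith [hv.1, hv.2])).comp v
      ((((hasDerivAt_pow 2 v).add ((hasDerivAt_id v).const_mul (2 * d))).add_const (2 * d)).const_sub 1
        |>.sqrt h1.ne')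
    have d2 := (hasDerivAt_binEntropy_half q2.le (by
      rw [sqrt_lt' one_pos]; norm_num at hd; nlinarith [hv.1, hv.2])).comp v
      (((hasDerivAt_pow 2 v).const_sub 1).sqrt h2.ne')
    refine (d2.sub d1).congr_deriv ?_
    simp only [Pi.add_apply, id]
    field_simp
    norm_num
    ring
  apply antitoneOn_of_deriv_nonpos (convex_Icc _ _)
  · apply Continuous.continuousOn
    fun_prop
  · intro v hv
    rw [interior_Icc] at hv
    exact (hder v hv).differentiableAt.differentiableWithinAt
  · intro v hv
    rw [interior_Icc] at hv
    rw [(hder v hv).deriv]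
    have h1 : 0 < 1 - (v ^ 2 + 2 * d * v + 2 * d) := by
      norm_num at hd; nlinarith [hv.1, hv.2]
    have h2 : 0 < 1 - v ^ 2 := by norm_num at hd; nlinarith [hv.1, hv.2]
    have q1 := sqrt_pos.2 h1
    have q2 := sqrt_pos.2 h2
    have a1 : (v + d) ≤ artanh √(1 - (v ^ 2 + 2 * d * v + 2 * d)) * (v + d)
        / √(1 - (v ^ 2 + 2 * d * v + 2 * d)) := by
      rw [le_div_iff₀ q1, mul_comm]
      have hvd : 0 ≤ v + d := by norm_num at hd; linarith [hv.1]
      gcongr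
      apply le_artanh q1.le
      rw [sqrt_lt' one_pos]; norm_num at hd; nlinarith [hv.1, hv.2]
    have a2 : artanh √(1 - v ^ 2) * v / √(1 - v ^ 2) ≤ v + d := by
      rw [div_le_iff₀ q2, mul_comm]
      exact mul_artanh_le hd hv.1 q2.le (by rw [sq_sqrt h2.le]; ring)
    linarith

theorem H_eq (x : ℝ) : H x = binEntropy x / log 2 := by
  rw [H, binEntropy, log_inv, log_inv, logb, logb]
  ring

theorem le_Rbar {d : ℝ} (hd : 0.295 ≤ d) (hd' : d ≤ 1 / 2) :
    H ((1 - √(1 - (1 - 2 * d) ^ 2)) / 2) ≤ Rbar d := by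
  have hd0 : 0 < d := by norm_num at hd; linarith
  rw [Rbar, ← sub_le_iff_le_add']
  apply le_csInf
  · refine Set.Nonempty.image _ ⟨1 / 2, ?_, le_rfl⟩
    have := sqrt_nonneg (1 - 2 * d)
    linarith
  · rintro _ ⟨a, ⟨ha1, ha2⟩, rfl⟩
    have hs1 : 2 * d ≤ 4 * a * (1 - a) := by
      have h1 : 1 - 2 * a ≤ √(1 - 2 * d) := by linarith
      have h2 : (1 - 2 * a) ^ 2 ≤ 1 - 2 * d := by
        rw [← sq_sqrt (by linarith : 0 ≤ 1 - 2 * d)]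
        apply pow_le_pow_left₀ (by linarith) h1
      nlinarith
    have hs2 : 4 * a * (1 - a) ≤ 1 := by nlinarith [sq_nonneg (1 - 2 * a)]
    set v := √(4 * a * (1 - a) - 2 * d + d ^ 2) - d with hv
    have hv2 : (v + d) ^ 2 = 4 * a * (1 - a) - 2 * d + d ^ 2 := by
      rw [hv, sub_add_cancel, sq_sqrt (by nlinarith)]
    have hv0 : 0 ≤ v := by
      rw [hv, sub_nonneg]
      apply le_sqrt_of_sq_le
      linarith
    have hv1 : v ≤ 1 - 2 * d := by
      have : √(4 * a * (1 - a) - 2 * d + d ^ 2) ≤ 1 - d := by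
        rw [sqrt_le_left (by linarith)]
        nlinarith
      linarith
    have hmono := antitoneOn_entropy_gap hd ⟨hv0, hv1⟩ (Set.right_mem_Icc.2 (hv0.trans hv1)) hv1
    simp only at hmono
    have e1 : v ^ 2 + 2 * d * v + 2 * d = 4 * a * (1 - a) := by linarith
    have e2 : (1 - √(1 - 4 * a * (1 - a))) / 2 = a := by
      rw [show 1 - 4 * a * (1 - a) = (1 - 2 * a) ^ 2 by ring, sqrt_sq (by linarith)]
      ring
    have e3 : taunu a (d / 2) = (1 - √(1 - v ^ 2)) / 2 := by
      rw [taunu, show a * (1 - a) - d / 2 * (1 - d / 2) = (v + d) ^ 2 / 2 ^ 2 by rw [hv2]; ring,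
        sqrt_div (sq_nonneg _), sqrt_sq (by linarith), sqrt_sq (by norm_num)]
      rw [show 4 * ((v + d) / 2 - d / 2) ^ 2 = v ^ 2 by ring]
      ring
    have e4 : 1 - ((1 - 2 * d) ^ 2 + 2 * d * (1 - 2 * d) + 2 * d) = 0 := by ring
    rw [e1, e2, e4, sqrt_zero, sub_zero, one_div, binEntropy_two_inv] at hmono
    simp only
    rw [e3, H_eq, H_eq, H_eq]
    have hl : 0 < log 2 := log_pos (by norm_num)
    rw [← sub_div, div_sub_one hl.ne']
    gcongr

theorem tauCrit_eq {g : ℝ} (h0 : 0 < g) (h1 : g < 1) :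
    tauCrit g = (1 - √(1 - (1 - 2 * (2 * g / (1 + g) ^ 2)) ^ 2)) / 2 := by
  have hc := one_lt_chalf h0 h1
  have e1 : 1 + g ^ 2 = 2 * g * chalf g := by rw [chalf]; field_simp
  have e2 : 2 * g / (1 + g) ^ 2 = 1 / (1 + chalf g) := by
    rw [div_eq_div_iff (by positivity) (by linarith)]; linarith
  have hb2 := sq_sqrt (by linarith : 0 ≤ chalf g)
  rw [tauCrit, e2]
  generalize chalf g = c at *
  have : 1 - (1 - 2 * (1 / (1 + c))) ^ 2 = (2 * √c / (1 + c)) ^ 2 := by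
    rw [div_pow, mul_pow, hb2]; field_simp; ring
  rw [this, sqrt_sq (by positivity)]
  field_simp
  linarith

/-- The nontrivial character of `ZMod 2`. -/
def bitSign (a : ZMod 2) : ℝ := if a = 0 then 1 else -1

/-- The Walsh character indexed by `S`. -/
def walsh {n : ℕ} (S : Finset (Fin n)) (v : Fin n → ZMod 2) : ℝ := ∏ i ∈ S, bitSign (v i)

/-- The function whose Walsh transform at `S` is `f |S|`. -/
def walshSum {n : ℕ} (f : ℕ → ℝ) (v : Fin n → ZMod 2) : ℝ :=
  ∑ S : Finset (Fin n), f S.card * walsh S v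

/-- Add or remove an element. -/
def toggle {n : ℕ} (i : Fin n) (S : Finset (Fin n)) : Finset (Fin n) :=
  if i ∈ S then S.erase i else insert i S

theorem bitSign_sub (a b : ZMod 2) : bitSign (a - b) = bitSign a * bitSign b := by
  have h : ∀ x : ZMod 2, x = 0 ∨ x = 1 := by decide
  rcases h a with ha | ha <;> rcases h b with hb | hb <;> subst ha hb <;> simp [bitSign]

theorem bitSign_mul_self (a : ZMod 2) : bitSign a * bitSign a = 1 := by
  unfold bitSign; split_ifs <;> norm_num

theorem walsh_sub {n : ℕ} (S : Finset (Fin n)) (u v : Fin n → ZMod 2) :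
    walsh S (u - v) = walsh S u * walsh S v := by
  simp [walsh, bitSign_sub, Finset.prod_mul_distrib]

theorem walsh_mul_self {n : ℕ} (S : Finset (Fin n)) (v : Fin n → ZMod 2) :
    walsh S v * walsh S v = 1 := by
  simp [walsh, ← Finset.prod_mul_distrib, bitSign_mul_self]

theorem walsh_toggle {n : ℕ} (i : Fin n) (S : Finset (Fin n)) (v : Fin n → ZMod 2) :
    walsh (toggle i S) v = bitSign (v i) * walsh S v := by
  unfold toggle walsh
  split_ifs with h
  · rw [← Finset.mul_prod_erase S _ h, ← mul_assoc, bitSign_mul_self, one_mul]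
  · rw [Finset.prod_insert h]

theorem toggle_toggle {n : ℕ} (i : Fin n) (S : Finset (Fin n)) : toggle i (toggle i S) = S := by
  unfold toggle
  by_cases h : i ∈ S
  · simp [h, Finset.insert_erase h]
  · simp [h, Finset.erase_insert h]

theorem toggle_involutive {n : ℕ} (i : Fin n) : Function.Involutive (toggle i) := toggle_toggle i

theorem sum_bitSign {n : ℕ} (v : Fin n → ZMod 2) :
    ∑ i, bitSign (v i) = (n : ℝ) - 2 * hammingNorm v := by
  have : ∀ i, bitSign (v i) = 1 - 2 * (if v i ≠ 0 then 1 else 0) := by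
    intro i; unfold bitSign; split_ifs <;> simp_all <;> norm_num
  simp_rw [this]
  rw [Finset.sum_sub_distrib, ← Finset.mul_sum, hammingNorm, Finset.sum_boole]
  simp

theorem sum_toggle {n : ℕ} (f : ℕ → ℝ) (S : Finset (Fin n)) :
    ∑ i, f (toggle i S).card = S.card * f (S.card - 1) + ((n : ℝ) - S.card) * f (S.card + 1) := by
  have : ∀ i, f (toggle i S).card = if i ∈ S then f (S.card - 1) else f (S.card + 1) := by
    intro i
    unfold toggle
    split_ifs with h
    · rw [Finset.card_erase_of_mem h]
    · rw [Finset.card_insert_of_notMem h]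
  simp_rw [this]
  rw [Finset.sum_ite, Finset.sum_const, Finset.sum_const, Finset.filter_mem_eq_inter,
    Finset.univ_inter]
  have h2 : (Finset.univ.filter fun i => i ∉ S) = Sᶜ := by ext; simp
  rw [h2, Finset.card_compl, Fintype.card_fin, nsmul_eq_mul, nsmul_eq_mul,
    Nat.cast_sub (by simpa using Finset.card_le_univ S)]

theorem hammingNorm_sub {n : ℕ} (u v : Fin n → ZMod 2) : hammingNorm (u - v) = hammingDist u v := by
  simp [hammingNorm, hammingDist, sub_ne_zero]

theorem mul_walshSum {n : ℕ} (f : ℕ → ℝ) (v : Fin n → ZMod 2) :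
    ((n : ℝ) - 2 * hammingNorm v) * walshSum f v =
      ∑ S : Finset (Fin n), (S.card * f (S.card - 1) + ((n : ℝ) - S.card) * f (S.card + 1))
        * walsh S v := by
  rw [← sum_bitSign, Finset.sum_mul]
  simp_rw [← sum_toggle, Finset.sum_mul]
  rw [Finset.sum_comm (s := Finset.univ (α := Finset (Fin n)))]
  refine Finset.sum_congr rfl fun i _ => ?_
  rw [walshSum, Finset.mul_sum]
  refine Finset.sum_equiv (toggle_involutive i).toPerm (by simp) fun S _ => ?_
  rw [Function.Involutive.coe_toPerm, toggle_toggle, walsh_toggle]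
  ring

/-- Delsarte-type inequality from an approximate eigenvector of the hypercube. -/
theorem sum_sum_walshSum_ge {α : Type*} {n : ℕ} (s : Finset α) (c : α → Fin n → ZMod 2) (f : ℕ → ℝ)
    (l : ℝ) (hf : ∀ k, 0 ≤ f k)
    (h : ∀ k ≤ n, (l + 1) * f k ≤ k * f (k - 1) + ((n : ℝ) - k) * f (k + 1)) :
    (s.card : ℝ) ^ 2 * ∑ S : Finset (Fin n), f S.card ^ 2 ≤
      ∑ i ∈ s, ∑ j ∈ s, ((n : ℝ) - 2 * hammingDist (c i) (c j) - l) * walshSum f (c i - c j) ^ 2 := by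
  set A : Finset (Fin n) → ℝ := fun S => S.card * f (S.card - 1) +
    ((n : ℝ) - S.card) * f (S.card + 1) - l * f S.card with hA
  have e1 : ∀ i j, ((n : ℝ) - 2 * hammingDist (c i) (c j) - l) * walshSum f (c i - c j) ^ 2 =
      ∑ S, ∑ T, A S * f T.card * ((walsh S (c i) * walsh T (c i)) * (walsh S (c j) * walsh T (c j))) := by
    intro i j
    have : ((n : ℝ) - 2 * hammingDist (c i) (c j) - l) * walshSum f (c i - c j) =
        ∑ S, A S * walsh S (c i - c j) := by
      rw [← hammingNorm_sub, sub_mul, mul_walshSum, walshSum, Finset.mul_sum,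
        ← Finset.sum_sub_distrib]
      refine Finset.sum_congr rfl fun S _ => ?_
      rw [hA]; ring
    rw [sq, ← mul_assoc, this, walshSum, Finset.sum_mul_sum]
    refine Finset.sum_congr rfl fun S _ => Finset.sum_congr rfl fun T _ => ?_
    rw [walsh_sub, walsh_sub]; ring
  have e2 : ∑ i ∈ s, ∑ j ∈ s, ((n : ℝ) - 2 * hammingDist (c i) (c j) - l) * walshSum f (c i - c j) ^ 2 =
      ∑ S, ∑ T, A S * f T.card * (∑ i ∈ s, walsh S (c i) * walsh T (c i)) ^ 2 := by
    simp_rw [e1]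
    have : ∀ i, ∑ j ∈ s, ∑ S, ∑ T, A S * f T.card * ((walsh S (c i) * walsh T (c i)) *
        (walsh S (c j) * walsh T (c j))) = ∑ S, ∑ T, A S * f T.card * ((walsh S (c i) * walsh T (c i)) *
        ∑ j ∈ s, (walsh S (c j) * walsh T (c j))) := by
      intro i
      rw [Finset.sum_comm]
      refine Finset.sum_congr rfl fun S _ => ?_
      rw [Finset.sum_comm]
      refine Finset.sum_congr rfl fun T _ => ?_
      rw [Finset.mul_sum, Finset.mul_sum]
    simp_rw [this]
    rw [Finset.sum_comm]
    refine Finset.sum_congr rfl fun S _ => ?_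
    rw [Finset.sum_comm]
    refine Finset.sum_congr rfl fun T _ => ?_
    rw [← Finset.mul_sum, ← Finset.sum_mul, sq]
  rw [e2, Finset.mul_sum]
  have hAf : ∀ S : Finset (Fin n), f S.card ≤ A S := by
    intro S
    have := h S.card (by simpa using Finset.card_le_univ S)
    simp only [hA]
    linarith
  refine Finset.sum_le_sum fun S _ => ?_
  have hS : (s.card : ℝ) ^ 2 * f S.card ^ 2 ≤
      A S * f S.card * (∑ i ∈ s, walsh S (c i) * walsh S (c i)) ^ 2 := by
    simp_rw [walsh_mul_self]
    rw [Finset.sum_const, nsmul_eq_mul, mul_one, mul_comm]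
    gcongr
    rw [sq]
    exact mul_le_mul_of_nonneg_right (hAf S) (hf _)
  refine hS.trans (Finset.single_le_sum (f := fun T : Finset (Fin n) => A S * f T.card *
    (∑ i ∈ s, walsh S (c i) * walsh T (c i)) ^ 2) (fun T _ => ?_) (Finset.mem_univ S))
  exact mul_nonneg (mul_nonneg ((hf _).trans (hAf S)) (hf _)) (sq_nonneg _)

theorem sum_walsh_mul_walsh {n : ℕ} (S T : Finset (Fin n)) :
    ∑ v : Fin n → ZMod 2, walsh S v * walsh T v = if S = T then 2 ^ n else 0 := by
  split_ifs with h
  · subst h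
    simp_rw [walsh_mul_self]
    simp [ZMod.card]
  · obtain ⟨i, hi⟩ : ∃ i, ¬ (i ∈ S ↔ i ∈ T) := by
      by_contra! h'
      exact h (Finset.ext h')
    have key : ∀ (S : Finset (Fin n)) (v : Fin n → ZMod 2), walsh S (v + Pi.single i 1) =
        (if i ∈ S then -1 else 1) * walsh S v := by
      intro S v
      have hw : walsh S (v + Pi.single i 1) = walsh S (v - Pi.single i 1) := by
        congr 1
        ext j
        have : ∀ a b : ZMod 2, a + b = a - b := by decide
        exact this _ _
      rw [hw, walsh_sub, mul_comm]
      congr 1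
      unfold walsh
      split_ifs with hS
      · rw [← Finset.mul_prod_erase S _ hS, Finset.prod_eq_one]
        · simp [bitSign]
        · intro j hj
          simp [bitSign, Finset.ne_of_mem_erase hj]
      · apply Finset.prod_eq_one
        intro j hj
        have : j ≠ i := by rintro rfl; exact hS hj
        simp [bitSign, this]
    have h1 : ∑ v : Fin n → ZMod 2, walsh S v * walsh T v =
        ∑ v : Fin n → ZMod 2, walsh S (v + Pi.single i 1) * walsh T (v + Pi.single i 1) :=
      (Fintype.sum_equiv (Equiv.addRight (Pi.single i 1)) _ _ fun v => rfl).symm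
    have h2 : ∑ v : Fin n → ZMod 2, walsh S (v + Pi.single i 1) * walsh T (v + Pi.single i 1) =
        - ∑ v : Fin n → ZMod 2, walsh S v * walsh T v := by
      rw [← Finset.sum_neg_distrib]
      refine Finset.sum_congr rfl fun v _ => ?_
      rw [key, key]
      by_cases a : i ∈ S <;> by_cases b : i ∈ T <;> simp_all
    linarith

theorem sum_walshSum_sq {n : ℕ} (f : ℕ → ℝ) :
    ∑ v : Fin n → ZMod 2, walshSum f v ^ 2 = 2 ^ n * ∑ S : Finset (Fin n), f S.card ^ 2 := by
  have : ∀ v : Fin n → ZMod 2, walshSum f v ^ 2 =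
      ∑ S, ∑ T, f S.card * f T.card * (walsh S v * walsh T v) := by
    intro v
    rw [sq, walshSum, Finset.sum_mul_sum]
    refine Finset.sum_congr rfl fun S _ => Finset.sum_congr rfl fun T _ => ?_
    ring
  simp_rw [this]
  rw [Finset.sum_comm, Finset.mul_sum]
  refine Finset.sum_congr rfl fun S _ => ?_
  rw [Finset.sum_comm]
  simp_rw [← Finset.mul_sum, sum_walsh_mul_walsh]
  simp
  ring

/-- Value at `w` of the Krawtchouk polynomial of degree `k`. -/
noncomputable def krawtchouk (n w k : ℕ) : ℝ :=
  (((1 + Polynomial.X) ^ (n - w) * (1 - Polynomial.X) ^ w : Polynomial ℝ)).coeff k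

theorem sum_walsh_card {n : ℕ} (v : Fin n → ZMod 2) (k : ℕ) :
    ∑ S : Finset (Fin n), (if S.card = k then walsh S v else 0) = krawtchouk n (hammingNorm v) k := by
  have h1 : ∏ i, (1 + Polynomial.C (bitSign (v i)) * Polynomial.X) =
      ∑ S : Finset (Fin n), Polynomial.C (walsh S v) * (Polynomial.X : Polynomial ℝ) ^ S.card := by
    rw [Finset.prod_one_add, Finset.powerset_univ]
    refine Finset.sum_congr rfl fun S _ => ?_
    rw [Finset.prod_mul_distrib, Finset.prod_const, walsh, map_prod]
  have h2 : ∏ i, (1 + Polynomial.C (bitSign (v i)) * Polynomial.X) =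
      ((1 + Polynomial.X) ^ (n - hammingNorm v) * (1 - Polynomial.X) ^ hammingNorm v :
        Polynomial ℝ) := by
    have : ∀ i, (1 + Polynomial.C (bitSign (v i)) * Polynomial.X : Polynomial ℝ) =
        if v i ≠ 0 then 1 - Polynomial.X else 1 + Polynomial.X := by
      intro i
      unfold bitSign
      by_cases h : v i = 0 <;> simp [h, sub_eq_add_neg]
    simp_rw [this]
    rw [Finset.prod_ite, Finset.prod_const, Finset.prod_const, mul_comm]
    congr 2
    have := Finset.card_filter_add_card_filter_not (s := Finset.univ) (fun i => v i ≠ 0)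
    rw [Finset.card_univ, Fintype.card_fin] at this
    unfold hammingNorm
    omega
  rw [krawtchouk, ← h2, h1, Polynomial.finsetSum_coeff]
  refine Finset.sum_congr rfl fun S _ => ?_
  rw [Polynomial.coeff_C_mul_X_pow]
  simp [eq_comm]

theorem walshSum_eq {n : ℕ} (f : ℕ → ℝ) (v : Fin n → ZMod 2) :
    walshSum f v = ∑ k ∈ Finset.range (n + 1), f k * krawtchouk n (hammingNorm v) k := by
  simp_rw [← sum_walsh_card, Finset.mul_sum]
  rw [Finset.sum_comm, walshSum]
  refine Finset.sum_congr rfl fun S _ => ?_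
  have : S.card ∈ Finset.range (n + 1) := by
    have := Finset.card_le_univ S
    simp at this ⊢
    omega
  simp [Finset.sum_ite_eq, mul_ite, this]

theorem krawtchouk_rec {n w : ℕ} (hw : w + 1 < n) (k : ℕ) :
    ((n : ℝ) - (w + 1)) * krawtchouk n (w + 2) k + (w + 1) * krawtchouk n w k =
      ((n : ℝ) - 2 * k) * krawtchouk n (w + 1) k := by
  obtain ⟨m, rfl⟩ : ∃ m, n = m + w + 2 := ⟨n - w - 2, by omega⟩
  have e0 : m + w + 2 - w = m + 2 := by omega
  have e1 : m + w + 2 - (w + 1) = m + 1 := by omega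
  have e2 : m + w + 2 - (w + 2) = m := by omega
  simp only [krawtchouk, e0, e1, e2]
  set P : Polynomial ℝ := (1 + Polynomial.X) ^ (m + 1) * (1 - Polynomial.X) ^ (w + 1) with hP
  have hd : (Polynomial.X * Polynomial.derivative P).coeff k = k * P.coeff k := by
    cases k with
    | zero => simp
    | succ k => rw [Polynomial.coeff_X_mul, Polynomial.coeff_derivative]; push_cast; ring
  have key : Polynomial.C ((m : ℝ) + 1) * ((1 + Polynomial.X) ^ m * (1 - Polynomial.X) ^ (w + 2)) +
      Polynomial.C ((w : ℝ) + 1) * ((1 + Polynomial.X) ^ (m + 2) * (1 - Polynomial.X) ^ w) =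
      Polynomial.C ((m : ℝ) + w + 2) * P - Polynomial.C 2 * (Polynomial.X * Polynomial.derivative P) := by
    rw [hP, Polynomial.derivative_mul, Polynomial.derivative_pow, Polynomial.derivative_pow]
    simp only [Polynomial.derivative_sub, Polynomial.derivative_one,
      Polynomial.derivative_X, map_add, map_one, map_ofNat, Nat.cast_add, Nat.cast_one,
      Nat.add_sub_cancel]
    ring
  have := congrArg (fun Q => Polynomial.coeff Q k) key
  simp only [Polynomial.coeff_add, Polynomial.coeff_sub, Polynomial.coeff_C_mul, hd] at this
  push_cast
  linarith

theorem krawtchouk_zero (n k : ℕ) : krawtchouk n 0 k = n.choose k := by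
  simp [krawtchouk, Polynomial.coeff_one_add_X_pow]

theorem krawtchouk_one {n : ℕ} (hn : 1 ≤ n) (k : ℕ) :
    (n : ℝ) * krawtchouk n 1 k = ((n : ℝ) - 2 * k) * krawtchouk n 0 k := by
  obtain ⟨m, rfl⟩ : ∃ m, n = m + 1 := ⟨n - 1, by omega⟩
  simp only [krawtchouk, Nat.add_sub_cancel, pow_one, Nat.sub_zero, pow_zero, mul_one]
  set P : Polynomial ℝ := (1 + Polynomial.X) ^ (m + 1) with hP
  have hd : (Polynomial.X * Polynomial.derivative P).coeff k = k * P.coeff k := by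
    cases k with
    | zero => simp
    | succ k => rw [Polynomial.coeff_X_mul, Polynomial.coeff_derivative]; push_cast; ring
  have key : Polynomial.C ((m : ℝ) + 1) * ((1 + Polynomial.X) ^ m * (1 - Polynomial.X)) =
      Polynomial.C ((m : ℝ) + 1) * P - Polynomial.C 2 * (Polynomial.X * Polynomial.derivative P) := by
    rw [hP, Polynomial.derivative_pow]
    simp only [Polynomial.derivative_one,
      Polynomial.derivative_X, map_add, map_one, map_ofNat, Nat.cast_add, Nat.cast_one,
      Nat.add_sub_cancel]
    ring
  have := congrArg (fun Q => Polynomial.coeff Q k) key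
  simp only [Polynomial.coeff_sub, Polynomial.coeff_C_mul, hd] at this
  push_cast
  linarith

/-- Below the first zero the Krawtchouk polynomial decays at most geometrically. -/
theorem krawtchouk_succ_ge {n k : ℕ} {d : ℝ} (hd0 : 0 < d) (hd1 : d < 1 / 2) (hk : k ≤ n)
    (hkn : 2 * √(d * (1 - d)) * n ≤ n - 2 * k) (w : ℕ) (hw : w ≤ d * n) (hwn : w < n) :
    0 < krawtchouk n w k ∧ √(d / (1 - d)) * krawtchouk n w k ≤ krawtchouk n (w + 1) k := by
  have h1d : 0 < 1 - d := by linarith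
  set r := √(d / (1 - d)) with hr
  have hr0 : 0 < r := sqrt_pos.2 (by positivity)
  have hr2 : r ^ 2 = d / (1 - d) := sq_sqrt (by positivity)
  have hrd : √(d * (1 - d)) = r * (1 - d) := by
    rw [hr, ← sqrt_sq h1d.le, ← sqrt_mul (by positivity)]
    congr 1
    rw [sqrt_sq h1d.le]
    field_simp
  rw [hrd] at hkn
  have hr1 : r < 1 := by
    rw [hr, sqrt_lt' one_pos, one_pow, div_lt_one h1d]; linarith
  have hrr : r ^ 2 * (1 - d) = d := by rw [hr2]; field_simp
  induction w with
  | zero =>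
    have hn0 : (0 : ℝ) < n := by exact_mod_cast hwn
    have hp : 0 < krawtchouk n 0 k := by
      rw [krawtchouk_zero]; exact_mod_cast Nat.choose_pos hk
    refine ⟨hp, ?_⟩
    have := krawtchouk_one (by omega : 1 ≤ n) k
    have h2 : r * n ≤ n - 2 * k := by nlinarith [mul_pos hr0 hn0]
    have h3 := mul_le_mul_of_nonneg_right h2 hp.le
    rw [← this] at h3
    refine le_of_mul_le_mul_left ?_ hn0
    linarith
  | succ w ih =>
    push_cast at hw
    obtain ⟨hp, hs⟩ := ih (by linarith) (by omega)
    have hp' : 0 < krawtchouk n (w + 1) k := lt_of_lt_of_le (mul_pos hr0 hp) hs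
    refine ⟨hp', ?_⟩
    have hrec := krawtchouk_rec hwn k
    have hn0 : (0 : ℝ) < n - (w + 1) := by
      have : ((w + 1 : ℕ) : ℝ) < n := by exact_mod_cast hwn
      push_cast at this; linarith
    refine le_of_mul_le_mul_left ?_ (mul_pos hn0 hr0)
    have h1 : (w + 1) * (r * krawtchouk n w k) ≤ (w + 1) * krawtchouk n (w + 1) k := by gcongr
    have h2 := mul_le_mul_of_nonneg_right hkn (mul_pos hr0 hp').le
    have h3 : (w + 1) + r ^ 2 * (n - (w + 1)) ≤ 2 * r ^ 2 * (1 - d) * n := by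
      nlinarith [mul_pos hr0 hr0]
    have h4 := mul_le_mul_of_nonneg_right h3 hp'.le
    have h5 : r * (((n : ℝ) - (w + 1)) * krawtchouk n (w + 2) k) =
        r * ((n - 2 * k) * krawtchouk n (w + 1) k) - r * ((w + 1) * krawtchouk n w k) := by
      rw [← hrec]; ring
    linarith

/-- Words correspond to their supports. -/
def supportEquiv (n : ℕ) : (Fin n → ZMod 2) ≃ Finset (Fin n) where
  toFun v := Finset.univ.filter fun i => v i ≠ 0
  invFun S := fun i => if i ∈ S then 1 else 0
  left_inv v := by
    have h : ∀ x : ZMod 2, x ≠ 0 → 1 = x := by decide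
    ext i
    by_cases hv : v i = 0
    · simp [hv]
    · simp [hv, h _ hv]
  right_inv S := by
    ext i
    simp

theorem card_supportEquiv {n : ℕ} (v : Fin n → ZMod 2) :
    (supportEquiv n v).card = hammingNorm v := rfl

theorem card_hammingNorm_eq (n w : ℕ) :
    (Finset.univ.filter fun v : Fin n → ZMod 2 => hammingNorm v = w).card = n.choose w := by
  have : (Finset.powersetCard w (Finset.univ : Finset (Fin n))).card = n.choose w := by
    rw [Finset.card_powersetCard, Finset.card_univ, Fintype.card_fin]
  rw [← this]
  refine Finset.card_equiv (supportEquiv n) fun v => ?_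
  simp [Finset.mem_powersetCard, card_supportEquiv]

/-- A binomial distribution has mass at least `1 / (N + 1)` at its mode. -/
theorem binomial_mode_ge {N : ℕ} {x : ℝ} (h0 : 0 < x) (h1 : x < 1) :
    1 / ((N : ℝ) + 1) ≤ (N.choose ⌊((N : ℝ) + 1) * x⌋₊) * x ^ ⌊((N : ℝ) + 1) * x⌋₊ *
      (1 - x) ^ (N - ⌊((N : ℝ) + 1) * x⌋₊) := by
  set m := ⌊((N : ℝ) + 1) * x⌋₊ with hm
  set a : ℕ → ℝ := fun k => (N.choose k) * x ^ k * (1 - x) ^ (N - k) with ha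
  have h1x : 0 < 1 - x := by linarith
  have hmN : m ≤ N := by
    have : m < N + 1 := by
      rw [hm, Nat.floor_lt (by positivity)]
      push_cast
      nlinarith
    omega
  have hrec : ∀ k, k < N → a (k + 1) * ((k + 1) * (1 - x)) = a k * (((N : ℝ) - k) * x) := by
    intro k hk
    simp only [ha]
    have hc : (N.choose (k + 1) : ℝ) * (k + 1) = N.choose k * ((N : ℝ) - k) := by
      have := Nat.choose_succ_right_eq N k
      rw [← Nat.cast_sub hk.le]
      exact_mod_cast this
    have e : N - k = N - (k + 1) + 1 := by omega
    rw [e, pow_succ, pow_succ]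
    linear_combination x ^ k * x * (1 - x) ^ (N - (k + 1)) * (1 - x) * hc
  have ha0 : ∀ k, 0 ≤ a k := fun k => by positivity
  have hup : ∀ k, k < m → a k ≤ a (k + 1) := by
    intro k hk
    have hkm : ((k : ℝ) + 1) ≤ (N + 1) * x := by
      have := Nat.floor_le (by positivity : 0 ≤ ((N : ℝ) + 1) * x)
      have h2 : ((k + 1 : ℕ) : ℝ) ≤ m := by exact_mod_cast hk
      push_cast at h2
      linarith
    refine le_of_mul_le_mul_right ?_ (by positivity : 0 < ((k : ℝ) + 1) * (1 - x))
    rw [hrec k (by omega)]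
    exact mul_le_mul_of_nonneg_left (by linarith) (ha0 k)
  have hdown : ∀ k, m ≤ k → k < N → a (k + 1) ≤ a k := by
    intro k hk hkN
    have hkm : (N + 1) * x < (k : ℝ) + 1 := by
      have := Nat.lt_floor_add_one (((N : ℝ) + 1) * x)
      have h2 : (m : ℝ) ≤ k := by exact_mod_cast hk
      linarith
    refine le_of_mul_le_mul_right ?_ (by positivity : 0 < ((k : ℝ) + 1) * (1 - x))
    rw [hrec k hkN]
    exact mul_le_mul_of_nonneg_left (by linarith) (ha0 k)
  have hle : ∀ k ≤ N, a k ≤ a m := by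
    intro k hk
    rcases le_total k m with h | h
    · obtain ⟨j, hj⟩ : ∃ j, m = k + j := ⟨m - k, by omega⟩
      have : ∀ j, k + j ≤ m → a k ≤ a (k + j) := by
        intro j
        induction j with
        | zero => simp
        | succ j ih => intro hj; exact (ih (by omega)).trans (hup (k + j) (by omega))
      rw [hj]; exact this j hj.ge
    · obtain ⟨j, rfl⟩ : ∃ j, k = m + j := ⟨k - m, by omega⟩
      clear h
      induction j with
      | zero => simp
      | succ j ih => exact (hdown (m + j) (by omega) (by omega)).trans (ih (by omega))
  have hsum : ∑ k ∈ Finset.range (N + 1), a k = 1 := by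
    have := add_pow x (1 - x) N
    rw [add_sub_cancel, one_pow] at this
    rw [this]
    refine Finset.sum_congr rfl fun k _ => ?_
    simp only [ha]; ring
  have : (1 : ℝ) ≤ (N + 1) * a m := by
    have h := Finset.sum_le_card_nsmul (Finset.range (N + 1)) a (a m) fun k hk =>
      hle k (Nat.lt_succ_iff.1 (Finset.mem_range.1 hk))
    rw [hsum] at h
    simpa using h
  rw [div_le_iff₀ (by positivity)]
  linarith

theorem walshSum_sq_mul_choose_le {n : ℕ} (f : ℕ → ℝ) (v : Fin n → ZMod 2) :
    (n.choose (hammingNorm v)) * walshSum f v ^ 2 ≤ 2 ^ n * ∑ S : Finset (Fin n), f S.card ^ 2 := by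
  rw [← sum_walshSum_sq, ← card_hammingNorm_eq, ← nsmul_eq_mul, ← Finset.sum_const]
  have : ∀ u ∈ Finset.univ.filter (fun u : Fin n → ZMod 2 => hammingNorm u = hammingNorm v),
      walshSum f v ^ 2 = walshSum f u ^ 2 := by
    intro u hu
    rw [Finset.mem_filter] at hu
    rw [walshSum_eq, walshSum_eq, hu.2]
  rw [Finset.sum_congr rfl this]
  exact Finset.sum_le_sum_of_subset_of_nonneg (Finset.filter_subset _ _) fun _ _ _ => sq_nonneg _

theorem choose_le_choose_of_le_half {n a b : ℕ} (hab : a ≤ b) (hb : 2 * b ≤ n) :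
    n.choose a ≤ n.choose b := by
  induction b, hab using Nat.le_induction with
  | base => exact le_rfl
  | succ b _ ih =>
    exact (ih (by omega)).trans (Nat.choose_le_succ_of_lt_half_left (by omega))

theorem walshSum_sq_le {n w₂ : ℕ} {f : ℕ → ℝ} {d : ℝ} (hd0 : 0 < d) (hd1 : d < 1 / 2)
    (hf : ∀ k, 0 ≤ f k)
    (hsupp : ∀ k, f k ≠ 0 → k ≤ n ∧ 2 * √(d * (1 - d)) * n ≤ n - 2 * k)
    (hm : ⌊((n : ℝ) + 1) * d⌋₊ ≤ w₂) (hw₂ : 2 * w₂ ≤ n)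
    (v : Fin n → ZMod 2) (hv : hammingNorm v ≤ w₂) :
    walshSum f v ^ 2 * (d / (1 - d)) ^ (w₂ - ⌊((n : ℝ) + 1) * d⌋₊) ≤
      ((n : ℝ) + 1) * 2 ^ n * (∑ S : Finset (Fin n), f S.card ^ 2) * (1 - d) ^ n
        * (d / (1 - d)) ^ hammingNorm v := by
  have h1d : 0 < 1 - d := by linarith
  set r := d / (1 - d) with hr
  have hr0 : 0 < r := by positivity
  have hr1 : r ≤ 1 := by rw [hr, div_le_one h1d]; linarith
  set m := ⌊((n : ℝ) + 1) * d⌋₊ with hmdef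
  set S2 := ∑ S : Finset (Fin n), f S.card ^ 2 with hS2
  have hS2' : 0 ≤ S2 := Finset.sum_nonneg fun _ _ => sq_nonneg _
  have hmode : 1 ≤ ((n : ℝ) + 1) * n.choose m * (1 - d) ^ n * r ^ m := by
    have := binomial_mode_ge (N := n) hd0 (by linarith)
    rw [div_le_iff₀ (by positivity)] at this
    refine this.trans (le_of_eq ?_)
    have e : (1 - d) ^ n = (1 - d) ^ (n - m) * (1 - d) ^ m := by
      rw [← pow_add]; congr 1; omega
    rw [e, hr, div_pow]
    have : (1 - d) ^ m ≠ 0 := by positivity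
    field_simp
    rw [← hmdef]; ring
  have hgen : ∀ u : Fin n → ZMod 2, m ≤ hammingNorm u → hammingNorm u ≤ w₂ →
      walshSum f u ^ 2 ≤ ((n : ℝ) + 1) * 2 ^ n * S2 * (1 - d) ^ n * r ^ m := by
    intro u hu hu'
    have h1 := walshSum_sq_mul_choose_le f u
    have h2 : (n.choose m : ℝ) ≤ n.choose (hammingNorm u) := by
      exact_mod_cast choose_le_choose_of_le_half hu (by omega)
    have h3 : n.choose m * walshSum f u ^ 2 ≤ 2 ^ n * S2 :=
      (mul_le_mul_of_nonneg_right h2 (sq_nonneg _)).trans h1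
    calc walshSum f u ^ 2 ≤ (((n : ℝ) + 1) * n.choose m * (1 - d) ^ n * r ^ m) * walshSum f u ^ 2 :=
          le_mul_of_one_le_left (sq_nonneg _) hmode
      _ = (((n : ℝ) + 1) * (1 - d) ^ n * r ^ m) * (n.choose m * walshSum f u ^ 2) := by ring
      _ ≤ (((n : ℝ) + 1) * (1 - d) ^ n * r ^ m) * (2 ^ n * S2) := by gcongr
      _ = _ := by ring
  rcases le_total m (hammingNorm v) with h | h
  · calc walshSum f v ^ 2 * r ^ (w₂ - m) ≤
        (((n : ℝ) + 1) * 2 ^ n * S2 * (1 - d) ^ n * r ^ m) * r ^ (w₂ - m) := by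
          gcongr; exact hgen v h hv
      _ = ((n : ℝ) + 1) * 2 ^ n * S2 * (1 - d) ^ n * r ^ w₂ := by
          rw [mul_assoc, ← pow_add]; congr 2; omega
      _ ≤ _ := by
          apply mul_le_mul_of_nonneg_left _ (by positivity)
          exact pow_le_pow_of_le_one hr0.le hr1 hv
  · set Φ : ℕ → ℝ := fun w => ∑ k ∈ Finset.range (n + 1), f k * krawtchouk n w k with hΦ
    have hΦv : ∀ u : Fin n → ZMod 2, walshSum f u = Φ (hammingNorm u) := fun u => walshSum_eq f u
    have hstep : ∀ w, w < m → 0 ≤ Φ w ∧ √r * Φ w ≤ Φ (w + 1) := by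
      intro w hw
      have hwd : (w : ℝ) ≤ d * n := by
        have := Nat.floor_le (by positivity : 0 ≤ ((n : ℝ) + 1) * d)
        have h2 : ((w + 1 : ℕ) : ℝ) ≤ m := by exact_mod_cast hw
        push_cast at h2
        linarith
      have hk : ∀ k, 0 ≤ f k * krawtchouk n w k ∧
          √r * (f k * krawtchouk n w k) ≤ f k * krawtchouk n (w + 1) k := by
        intro k
        by_cases h0 : f k = 0
        · simp [h0]
        · obtain ⟨a, b⟩ := hsupp k h0
          obtain ⟨p, q⟩ := krawtchouk_succ_ge hd0 hd1 a b w hwd (by omega)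
          refine ⟨mul_nonneg (hf k) p.le, ?_⟩
          have := mul_le_mul_of_nonneg_left q (hf k)
          linarith
      refine ⟨Finset.sum_nonneg fun k _ => (hk k).1, ?_⟩
      rw [hΦ, Finset.mul_sum]
      exact Finset.sum_le_sum fun k _ => (hk k).2
    have hind : ∀ j w, w + j ≤ m → Φ w ^ 2 * r ^ j ≤ Φ (w + j) ^ 2 := by
      intro j
      induction j with
      | zero => simp
      | succ j ih =>
        intro w hw
        obtain ⟨p, q⟩ := hstep (w + j) (by omega)
        have h2 : (√r * Φ (w + j)) ^ 2 ≤ Φ (w + j + 1) ^ 2 :=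
          pow_le_pow_left₀ (by positivity) q 2
        rw [mul_pow, sq_sqrt hr0.le] at h2
        have := mul_le_mul_of_nonneg_right (ih w (by omega)) hr0.le
        rw [← add_assoc, pow_succ r j]
        linarith
    obtain ⟨u, hu⟩ : ∃ u : Fin n → ZMod 2, hammingNorm u = m := by
      have : 0 < (Finset.univ.filter fun v : Fin n → ZMod 2 => hammingNorm v = m).card := by
        rw [card_hammingNorm_eq]; exact Nat.choose_pos (by omega)
      obtain ⟨u, hu⟩ := Finset.card_pos.1 this
      exact ⟨u, (Finset.mem_filter.1 hu).2⟩
    have h1 := hgen u hu.ge (by omega)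
    have h2 := hind (m - hammingNorm v) (hammingNorm v) (by omega)
    rw [hΦv, hu] at h1
    rw [show hammingNorm v + (m - hammingNorm v) = m by omega] at h2
    have h3 : Φ (hammingNorm v) ^ 2 * r ^ (m - hammingNorm v) ≤
      (((n : ℝ) + 1) * 2 ^ n * S2 * (1 - d) ^ n * r ^ hammingNorm v) * r ^ (m - hammingNorm v) := by
      refine (h2.trans h1).trans (le_of_eq ?_)
      have : r ^ m = r ^ hammingNorm v * r ^ (m - hammingNorm v) := by
        rw [← pow_add]; congr 1; omega
      rw [this]; ring
    have h4 := le_of_mul_le_mul_right h3 (by positivity)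
    rw [hΦv]
    refine le_trans ?_ h4
    exact mul_le_of_le_one_right (sq_nonneg _) (pow_le_one₀ hr0.le hr1)

theorem mul_sub_mul_pos_iff {k t L : ℕ} (h : 0 < ((k : ℝ) - t + L) * (t - k)) :
    k + 1 ≤ t ∧ t + 1 ≤ k + L := by
  rcases pos_and_pos_or_neg_and_neg_of_mul_pos h with ⟨h1, h2⟩ | ⟨h1, h2⟩
  · have h3 : k < t := by exact_mod_cast sub_pos.1 h2
    have h4 : (t : ℝ) < (k + L : ℕ) := by push_cast; linarith
    exact ⟨h3, by exact_mod_cast h4⟩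
  · have := (Nat.cast_nonneg L : (0 : ℝ) ≤ L)
    linarith

set_option maxHeartbeats 800000 in
theorem exists_near_eigenfunction {τ ε : ℝ} (h0 : 0 < τ) (h1 : τ < 1 / 2) (hε : 0 < ε) :
    ∀ᶠ n : ℕ in atTop, ∃ f : ℕ → ℝ, (∀ k, 0 ≤ f k) ∧ (∀ k, f k ≠ 0 → (k : ℝ) ≤ τ * n) ∧
      (∃ k ≤ n, f k ≠ 0) ∧
      ∀ k ≤ n, (2 * √(τ * (1 - τ)) - ε) * n * f k ≤ k * f (k - 1) + ((n : ℝ) - k) * f (k + 1) := by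
  obtain ⟨L, hL⟩ := exists_nat_ge (2 / ε + 2)
  have h1τ : 0 < 1 - τ := by linarith
  set s := √(τ * (1 - τ)) with hs
  have hs0 : 0 < s := by positivity
  have hss : s ^ 2 = τ * (1 - τ) := sq_sqrt (by positivity)
  have hs1 : s ≤ 1 / 2 := by nlinarith [sq_nonneg (1 - 2 * τ)]
  set a := s / (1 - τ) with ha
  have ha0 : 0 < a := by positivity
  have ha1 : (1 - τ) * a = s := by rw [ha]; field_simp
  have ha2 : τ / a = s := by
    rw [ha, div_div_eq_mul_div, div_eq_iff hs0.ne', ← hss]; ring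
  have hL2 : (2 : ℝ) ≤ L := by have : 0 < 2 / ε := by positivity
                               linarith
  have hL' : 1 / ((L : ℝ) - 1) ≤ ε / 2 := by
    rw [div_le_iff₀ (by linarith)]
    have h := mul_le_mul_of_nonneg_left hL hε.le
    have : ε * (2 / ε + 2) = 2 + 2 * ε := by field_simp
    nlinarith
  have hev1 : ∀ᶠ n : ℕ in atTop, 2 * ((L : ℝ) + 1) / a ≤ ε / 2 * n := by
    exact (tendsto_natCast_atTop_atTop.const_mul_atTop (by positivity)).eventually_ge_atTop _
  have hev2 : ∀ᶠ n : ℕ in atTop, (L : ℝ) + 1 ≤ τ * n :=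
    (tendsto_natCast_atTop_atTop.const_mul_atTop h0).eventually_ge_atTop _
  have hev3 : ∀ᶠ n : ℕ in atTop, ((L : ℝ) + 1) / a ≤ s * n :=
    (tendsto_natCast_atTop_atTop.const_mul_atTop hs0).eventually_ge_atTop _
  filter_upwards [hev1, hev2, hev3] with n hn1 hn2 hn3
  set t := ⌊τ * n⌋₊ with ht
  have htle : (t : ℝ) ≤ τ * n := Nat.floor_le (by positivity)
  have htlt : τ * n < t + 1 := Nat.lt_floor_add_one _
  have hLt : L ≤ t := by
    have : (L : ℝ) < t + 1 := by linarith
    exact Nat.lt_succ_iff.1 (by exact_mod_cast this)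
  have htn : t ≤ n := by
    have : (t : ℝ) ≤ n := htle.trans (by nlinarith [(Nat.cast_nonneg n : (0 : ℝ) ≤ n)])
    exact_mod_cast this
  set h : ℕ → ℝ := fun k => max 0 (((k : ℝ) - t + L) * (t - k)) with hh
  have hnn : ∀ k, 0 ≤ h k := fun k => le_max_left _ _
  have hge : ∀ k : ℕ, ((k : ℝ) - t + L) * (t - k) ≤ h k := fun k => le_max_right _ _
  have hpos : ∀ k, h k ≠ 0 → 0 < ((k : ℝ) - t + L) * (t - k) := by
    intro k hk
    by_contra hc
    exact hk (max_eq_left (not_lt.1 hc))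
  refine ⟨fun k => a ^ k * h k, fun k => mul_nonneg (by positivity) (hnn k), ?_, ?_, ?_⟩
  · intro k hk
    obtain ⟨h3, -⟩ := mul_sub_mul_pos_iff (hpos k (right_ne_zero_of_mul hk))
    have : (k : ℝ) + 1 ≤ t := by exact_mod_cast h3
    linarith
  · have hL2' : 2 ≤ L := by exact_mod_cast hL2
    refine ⟨t - 1, by omega, mul_ne_zero (by positivity) ?_⟩
    have : ((t - 1 : ℕ) : ℝ) = t - 1 := by rw [Nat.cast_sub (by omega)]; simp
    refine ne_of_gt (lt_of_lt_of_le ?_ (hge _))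
    rw [this]; nlinarith
  · intro k hk
    have hkn : (k : ℝ) ≤ n := by exact_mod_cast hk
    by_cases hk0 : h k = 0
    · simp only [hk0, mul_zero]
      exact add_nonneg (mul_nonneg (by positivity) (mul_nonneg (by positivity) (hnn _)))
        (mul_nonneg (by linarith) (mul_nonneg (by positivity) (hnn _)))
    have hp := hpos k hk0
    obtain ⟨h3, h4⟩ := mul_sub_mul_pos_iff hp
    have h3' : (k : ℝ) + 1 ≤ t := by exact_mod_cast h3
    have h4' : (t : ℝ) + 1 ≤ k + L := by exact_mod_cast h4
    have hkval : h k = ((k : ℝ) - t + L) * (t - k) := max_eq_right hp.le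
    have hk1 : 1 ≤ k := by omega
    obtain ⟨j, rfl⟩ : ∃ j, k = j + 1 := ⟨k - 1, by omega⟩
    have hA := hge j
    have hB := hge (j + 1 + 1)
    push_cast at *
    set μ := s * n - ((L : ℝ) + 1) / a with hμ
    have hμ0 : 0 ≤ μ := by linarith
    have hc1 : μ ≤ ((j : ℝ) + 1) / a := by
      rw [hμ, ← ha2, div_mul_eq_mul_div, ← sub_div]
      gcongr; linarith
    have hc2 : μ ≤ ((n : ℝ) - (j + 1)) * a := by
      have : s * n ≤ ((n : ℝ) - (j + 1)) * a := by
        rw [← ha1]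
        have : (1 - τ) * n ≤ (n : ℝ) - (j + 1) := by linarith
        have := mul_le_mul_of_nonneg_right this ha0.le
        linarith
      have h5 : 0 ≤ ((L : ℝ) + 1) / a := by positivity
      linarith
    have hsum : 2 * h (j + 1) - 2 ≤ h j + h (j + 1 + 1) := by rw [hkval]; linarith
    have hlow : (L : ℝ) - 1 ≤ h (j + 1) := by rw [hkval]; nlinarith
    have hε2 : 1 ≤ ε / 2 * h (j + 1) := by
      rw [div_le_iff₀ (by linarith)] at hL'
      exact hL'.trans (mul_le_mul_of_nonneg_left hlow (by positivity))
    have key : (2 * s - ε) * n * h (j + 1) ≤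
        ((j : ℝ) + 1) / a * h j + ((n : ℝ) - (j + 1)) * a * h (j + 1 + 1) := by
      have e1 := mul_le_mul_of_nonneg_right hc1 (hnn j)
      have e2 := mul_le_mul_of_nonneg_right hc2 (hnn (j + 1 + 1))
      have e3 : μ * (2 * h (j + 1) - 2) ≤ μ * (h j + h (j + 1 + 1)) :=
        mul_le_mul_of_nonneg_left hsum hμ0
      have e4 : μ * 2 ≤ μ * (ε * h (j + 1)) := mul_le_mul_of_nonneg_left (by linarith) hμ0
      have e5 : μ * ε ≤ ε / 2 * n := by
        have : μ ≤ 1 / 2 * n := by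
          have h5 : 0 ≤ ((L : ℝ) + 1) / a := by positivity
          have h6 := mul_le_mul_of_nonneg_right hs1 (Nat.cast_nonneg n : (0 : ℝ) ≤ n)
          linarith
        have h7 := mul_le_mul_of_nonneg_right this hε.le
        linarith
      have e6 : 2 * s * n - ε / 2 * n ≤ 2 * μ := by
        rw [hμ]; have : 2 * ((L : ℝ) + 1) / a = 2 * (((L : ℝ) + 1) / a) := by ring
        linarith
      have e7 := mul_le_mul_of_nonneg_right e5 (hnn (j + 1))
      have e8 := mul_le_mul_of_nonneg_right e6 (hnn (j + 1))
      linarith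
    have e : ((j : ℝ) + 1) * (a ^ j * h j) + ((n : ℝ) - (j + 1)) * (a ^ (j + 1 + 1) * h (j + 1 + 1))
        = a ^ (j + 1) * (((j : ℝ) + 1) / a * h j + ((n : ℝ) - (j + 1)) * a * h (j + 1 + 1)) := by
      field_simp
      ring
    rw [e]
    have := mul_le_mul_of_nonneg_left key (by positivity : 0 ≤ a ^ (j + 1))
    linarith

theorem eventually_mul_pow_le_exp (C : ℝ) (k : ℕ) {c : ℝ} (hc : 0 < c) :
    ∀ᶠ n : ℕ in atTop, C * ((n : ℝ) + 2) ^ k ≤ exp (c * n) := by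
  have h := (isLittleO_pow_exp_pos_mul_atTop k hc).bound
    (show 0 < 1 / ((|C| + 1) * exp (2 * c)) by positivity)
  have h2 : Tendsto (fun n : ℕ => (n : ℝ) + 2) atTop atTop :=
    tendsto_atTop_add_const_right _ _ tendsto_natCast_atTop_atTop
  filter_upwards [h2.eventually h] with n hn
  rw [norm_of_nonneg (by positivity), norm_of_nonneg (exp_pos _).le, mul_add, exp_add, mul_comm c 2,
    one_div_mul_eq_div, le_div_iff₀ (by positivity)] at hn
  have e : 0 < exp (2 * c) := exp_pos _
  have h3 : ((n : ℝ) + 2) ^ k * (|C| + 1) ≤ exp (c * n) := by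
    refine le_of_mul_le_mul_right ?_ e
    linarith
  have h4 : 0 ≤ ((n : ℝ) + 2) ^ k := by positivity
  nlinarith [le_abs_self C]

theorem walshSum_zero_sq_mul_le {n : ℕ} {f : ℕ → ℝ} {T x : ℝ} (hx0 : 0 < x) (hx1 : x ≤ 1)
    (hf : ∀ k, f k ≠ 0 → (k : ℝ) ≤ T) :
    walshSum f (0 : Fin n → ZMod 2) ^ 2 * x ^ T ≤
      (1 + x) ^ n * ∑ S : Finset (Fin n), f S.card ^ 2 := by
  classical
  have h1 : walshSum f (0 : Fin n → ZMod 2) = ∑ S : Finset (Fin n), f S.card := by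
    simp [walshSum, walsh, bitSign]
  set A := Finset.univ.filter fun S : Finset (Fin n) => f S.card ≠ 0 with hA
  have h2 : ∑ S : Finset (Fin n), f S.card = ∑ S ∈ A, f S.card := (Finset.sum_filter_ne_zero _).symm
  have h3 : (∑ S ∈ A, f S.card) ^ 2 ≤ A.card * ∑ S ∈ A, f S.card ^ 2 := sq_sum_le_card_mul_sum_sq
  have h4 : (A.card : ℝ) * x ^ T ≤ (1 + x) ^ n := by
    calc (A.card : ℝ) * x ^ T = ∑ S ∈ A, x ^ T := by simp
      _ ≤ ∑ S ∈ A, x ^ S.card := by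
          refine Finset.sum_le_sum fun S hS => ?_
          rw [← rpow_natCast]
          exact rpow_le_rpow_of_exponent_ge hx0 hx1 (hf _ (Finset.mem_filter.1 hS).2)
      _ ≤ ∑ S : Finset (Fin n), x ^ S.card :=
          Finset.sum_le_sum_of_subset_of_nonneg (Finset.subset_univ _) fun _ _ _ => by positivity
      _ = (1 + x) ^ n := by
          have := Fintype.sum_pow_mul_eq_add_pow (Fin n) x 1
          simpa [add_comm] using this
  have h5 : ∑ S ∈ A, f S.card ^ 2 ≤ ∑ S : Finset (Fin n), f S.card ^ 2 :=
    Finset.sum_le_sum_of_subset_of_nonneg (Finset.subset_univ _) fun _ _ _ => sq_nonneg _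
  rw [h1, h2]
  calc _ ≤ (A.card * ∑ S ∈ A, f S.card ^ 2) * x ^ T := by gcongr
    _ = (A.card * x ^ T) * ∑ S ∈ A, f S.card ^ 2 := by ring
    _ ≤ _ := by
      refine mul_le_mul h4 h5 (Finset.sum_nonneg fun _ _ => sq_nonneg _) (by positivity)

theorem card_sq_mul_le_sum_pairs {α : Type*} [DecidableEq α] {n w₂ : ℕ} {f : ℕ → ℝ} {d : ℝ}
    (hd0 : 0 < d) (hd1 : d < 1 / 2) (hf : ∀ k, 0 ≤ f k)
    (hsupp : ∀ k, f k ≠ 0 → k ≤ n ∧ 2 * √(d * (1 - d)) * n ≤ n - 2 * k)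
    (hm : ⌊((n : ℝ) + 1) * d⌋₊ ≤ w₂) (hw₂ : 2 * w₂ ≤ n)
    (hne : ∃ k ≤ n, f k ≠ 0)
    (heig : ∀ k ≤ n, ((n : ℝ) - 2 * w₂ - 1) * f k ≤ k * f (k - 1) + ((n : ℝ) - k) * f (k + 1))
    (s : Finset α) (c : α → Fin n → ZMod 2)
    (hdiag : 2 * ((n : ℝ) + 2) * walshSum f (0 : Fin n → ZMod 2) ^ 2 ≤
      s.card * ∑ S : Finset (Fin n), f S.card ^ 2) :
    (s.card : ℝ) ^ 2 * (d / (1 - d)) ^ (w₂ - ⌊((n : ℝ) + 1) * d⌋₊) ≤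
      2 * ((n : ℝ) + 2) * (n + 1) * (2 * (1 - d)) ^ n *
        ∑ i ∈ s, ∑ j ∈ s with j ≠ i ∧ hammingDist (c j) (c i) ≤ w₂,
          (d / (1 - d)) ^ hammingDist (c j) (c i) := by
  set F := ∑ S : Finset (Fin n), f S.card ^ 2 with hF
  have hF0 : 0 < F := by
    obtain ⟨k, hk, hfk⟩ := hne
    obtain ⟨S, -, hS⟩ := Finset.exists_subset_card_eq (show k ≤ (Finset.univ : Finset (Fin n)).card by simpa)
    refine Finset.sum_pos' (fun _ _ => sq_nonneg _) ⟨S, Finset.mem_univ _, ?_⟩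
    rw [hS]; positivity
  have h1d : 0 < 1 - d := by linarith
  set r := d / (1 - d) with hr
  have hr0 : 0 < r := by positivity
  have hw₂' : (2 : ℝ) * w₂ ≤ n := by exact_mod_cast hw₂
  set φ := fun v : Fin n → ZMod 2 => walshSum f v with hφ
  set g := r ^ (w₂ - ⌊((n : ℝ) + 1) * d⌋₊) with hg
  have hg0 : 0 ≤ g := by positivity
  set K := ((n : ℝ) + 1) * 2 ^ n * F * (1 - d) ^ n with hK
  have h1 := sum_sum_walshSum_ge s c f ((n : ℝ) - 2 * w₂ - 2) hf (fun k hk => by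
    have := heig k hk
    calc _ = ((n : ℝ) - 2 * w₂ - 1) * f k := by ring
      _ ≤ _ := this)
  have h2 : ∀ i ∈ s, ∑ j ∈ s, ((n : ℝ) - 2 * hammingDist (c i) (c j) - ((n : ℝ) - 2 * w₂ - 2)) *
      walshSum f (c i - c j) ^ 2 ≤ ((n : ℝ) + 2) * φ 0 ^ 2 +
        ∑ j ∈ s with j ≠ i ∧ hammingDist (c j) (c i) ≤ w₂, ((n : ℝ) + 2) * φ (c i - c j) ^ 2 := by
    intro i hi
    rw [← Finset.add_sum_erase s _ hi, Finset.sum_filter, ← Finset.add_sum_erase s _ hi]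
    simp only [hammingDist_self, sub_self, ne_eq, not_true_eq_false, false_and, if_false, zero_add]
    refine add_le_add ?_ (Finset.sum_le_sum fun j hj => ?_)
    · apply mul_le_mul_of_nonneg_right _ (sq_nonneg _)
      push_cast; linarith
    · rw [hammingDist_comm (c i)]
      have hj' := (Finset.mem_erase.1 hj).1
      split_ifs with h
      · apply mul_le_mul_of_nonneg_right _ (sq_nonneg _)
        have : (0 : ℝ) ≤ hammingDist (c j) (c i) := Nat.cast_nonneg _
        linarith
      · have h : w₂ + 1 ≤ hammingDist (c j) (c i) := by
          by_contra hc; exact h ⟨hj', by omega⟩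
        have : (w₂ : ℝ) + 1 ≤ hammingDist (c j) (c i) := by exact_mod_cast h
        apply mul_nonpos_of_nonpos_of_nonneg _ (sq_nonneg _)
        linarith
  have h3 := h1.trans (Finset.sum_le_sum h2)
  rw [Finset.sum_add_distrib, Finset.sum_const, nsmul_eq_mul] at h3
  have h4 : ∀ i ∈ s, (∑ j ∈ s with j ≠ i ∧ hammingDist (c j) (c i) ≤ w₂,
      ((n : ℝ) + 2) * φ (c i - c j) ^ 2) * g ≤ ((n : ℝ) + 2) * K *
      ∑ j ∈ s with j ≠ i ∧ hammingDist (c j) (c i) ≤ w₂, r ^ hammingDist (c j) (c i) := by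
    intro i _
    rw [Finset.sum_mul, Finset.mul_sum]
    refine Finset.sum_le_sum fun j hj => ?_
    have hj' := (Finset.mem_filter.1 hj).2.2
    have h := walshSum_sq_le hd0 hd1 hf hsupp hm hw₂ (c i - c j)
      (by rwa [hammingNorm_sub, hammingDist_comm])
    rw [hammingNorm_sub, hammingDist_comm] at h
    calc ((n : ℝ) + 2) * φ (c i - c j) ^ 2 * g = ((n : ℝ) + 2) * (φ (c i - c j) ^ 2 * g) := by ring
      _ ≤ ((n : ℝ) + 2) * (K * r ^ hammingDist (c j) (c i)) := by gcongr
      _ = _ := by ring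
  have h5 := Finset.sum_le_sum h4
  rw [← Finset.sum_mul, ← Finset.mul_sum] at h5
  set P := ∑ i ∈ s, ∑ j ∈ s with j ≠ i ∧ hammingDist (c j) (c i) ≤ w₂, r ^ hammingDist (c j) (c i)
  set Q := ∑ i ∈ s, ∑ j ∈ s with j ≠ i ∧ hammingDist (c j) (c i) ≤ w₂,
      ((n : ℝ) + 2) * φ (c i - c j) ^ 2
  have h6 : (s.card : ℝ) ^ 2 * F ≤ 2 * Q := by
    have := mul_le_mul_of_nonneg_left hdiag (Nat.cast_nonneg s.card : (0 : ℝ) ≤ s.card)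
    have e : φ 0 = walshSum f (0 : Fin n → ZMod 2) := rfl
    rw [e] at h3
    linarith
  have h7 := mul_le_mul_of_nonneg_right h6 hg0
  refine le_of_mul_le_mul_right ?_ hF0
  rw [mul_pow]
  calc _ = (s.card : ℝ) ^ 2 * F * g := by ring
    _ ≤ 2 * (Q * g) := by linarith
    _ ≤ 2 * (((n : ℝ) + 2) * K * P) := by linarith
    _ = _ := by rw [hK]; ring

theorem exp_mul_le_of_natCast {a b : ℝ} (hab : a ≤ b) (n : ℕ) : exp (a * n) ≤ exp (b * n) :=
  exp_le_exp.2 (mul_le_mul_of_nonneg_right hab (Nat.cast_nonneg n))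

theorem eventually_le_mul_natCast (a : ℝ) {b : ℝ} (hb : 0 < b) : ∀ᶠ n : ℕ in atTop, a ≤ b * n :=
  (tendsto_natCast_atTop_atTop.const_mul_atTop hb).eventually_ge_atTop _

set_option maxHeartbeats 1000000 in
theorem exists_pairs_lower_bound {d τ η : ℝ} (hd0 : 0 < d) (hd1 : d < 1 / 2) (hτ0 : 0 < τ)
    (hτ1 : τ < 1 / 2) (h1 : 2 * √(τ * (1 - τ)) = 1 - 2 * d)
    (h2 : 1 - 2 * τ = 2 * √(d * (1 - d))) (hη : 0 < η) :
    ∃ ε > 0, ∀ᶠ n : ℕ in atTop, ∃ w₂ : ℕ, (w₂ : ℝ) ≤ (d + η) * n ∧ 2 * w₂ ≤ n ∧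
      ∀ {α : Type} [DecidableEq α] (s : Finset α) (c : α → Fin n → ZMod 2),
        exp ((binEntropy τ - ε) * n) ≤ s.card →
        (s.card : ℝ) ^ 2 * exp (-η * n) ≤ (2 * (1 - d)) ^ n *
          ∑ i ∈ s, ∑ j ∈ s with j ≠ i ∧ hammingDist (c j) (c i) ≤ w₂,
            (d / (1 - d)) ^ hammingDist (c j) (c i) := by
  have h1d : 0 < 1 - d := by linarith
  have h1τ : 0 < 1 - τ := by linarith
  set r := d / (1 - d) with hr
  have hr0 : 0 < r := by positivity
  have hr1 : r < 1 := by rw [hr, div_lt_one h1d]; linarith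
  set b := -log r with hb
  have hb0 : 0 < b := by have := log_neg hr0 hr1; linarith
  obtain ⟨ε₁, hε0, hεη, hεd, hεb⟩ : ∃ ε₁ > 0, ε₁ ≤ η / 2 ∧ ε₁ < 1 / 2 - d ∧ ε₁ * b ≤ η / 2 := by
    refine ⟨min (min (η / 2) ((1 / 2 - d) / 2)) (η / (2 * b)), ?_, ?_, ?_, ?_⟩
    · exact lt_min (lt_min (by linarith) (by linarith)) (by positivity)
    · exact (min_le_left _ _).trans (min_le_left _ _)
    · exact ((min_le_left _ _).trans (min_le_right _ _)).trans_lt (by linarith)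
    · calc _ ≤ η / (2 * b) * b := mul_le_mul_of_nonneg_right (min_le_right _ _) hb0.le
        _ = _ := by field_simp
  obtain ⟨τ', hτ'0, hτ'1, hτ'⟩ : ∃ τ', 0 < τ' ∧ τ' < τ ∧ 1 - 2 * d - ε₁ / 2 < 2 * √(τ' * (1 - τ')) := by
    have hc : ContinuousAt (fun x : ℝ => 2 * √(x * (1 - x))) τ := by fun_prop
    have e1 : ∀ᶠ x in nhdsWithin τ (Set.Iio τ), 1 - 2 * d - ε₁ / 2 < 2 * √(x * (1 - x)) :=
      nhdsWithin_le_nhds (hc.eventually_const_lt (by simp only [h1]; linarith))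
    have e2 : ∀ᶠ x in nhdsWithin τ (Set.Iio τ), x ∈ Set.Ioo 0 τ := Ioo_mem_nhdsLT hτ0
    obtain ⟨x, hx, hx'⟩ := (e1.and e2).exists
    exact ⟨x, hx'.1, hx'.2, hx⟩
  set x := τ / (1 - τ) with hx
  have hx0 : 0 < x := by positivity
  have hx1 : x < 1 := by rw [hx, div_lt_one h1τ]; linarith
  set ε := (τ - τ') * (-log x) / 2 with hε
  have hεpos : 0 < ε := by
    have := log_neg hx0 hx1
    have : 0 < (τ - τ') * (-log x) := mul_pos (by linarith) (by linarith)
    positivity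
  refine ⟨ε, hεpos, ?_⟩
  filter_upwards [exists_near_eigenfunction hτ'0 (by linarith) (half_pos hε0),
    eventually_le_mul_natCast 3 hε0, eventually_le_mul_natCast d (half_pos hη),
    eventually_le_mul_natCast d (show 0 < 1 / 2 - d - ε₁ by linarith),
    eventually_mul_pow_le_exp 2 1 hεpos, eventually_mul_pow_le_exp 2 2 (half_pos hη)]
    with n ⟨f, hf, hfs, hne, heig⟩ hn1 hn2 hn3 hn4 hn5
  have hn0 : (0 : ℝ) ≤ n := Nat.cast_nonneg n
  set m := ⌊((n : ℝ) + 1) * d⌋₊ with hm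
  set t := ⌊ε₁ * n⌋₊ with ht
  have hm1 : (m : ℝ) ≤ (n + 1) * d := Nat.floor_le (by positivity)
  have hm2 : ((n : ℝ) + 1) * d < m + 1 := Nat.lt_floor_add_one _
  have ht1 : (t : ℝ) ≤ ε₁ * n := Nat.floor_le (by positivity)
  have ht2 : ε₁ * n < t + 1 := Nat.lt_floor_add_one _
  have hw₂ : 2 * (m + t) ≤ n := by
    have : (2 * (m + t) : ℝ) ≤ n := by linarith
    exact_mod_cast this
  refine ⟨m + t, ?_, hw₂, ?_⟩
  · push_cast
    have := mul_le_mul_of_nonneg_right hεη hn0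
    linarith
  intro α _ s c hs
  have hsupp : ∀ k, f k ≠ 0 → k ≤ n ∧ 2 * √(d * (1 - d)) * n ≤ n - 2 * k := by
    intro k hk
    have hk1 := hfs k hk
    have hk2 : (k : ℝ) ≤ τ * n := hk1.trans (mul_le_mul_of_nonneg_right hτ'1.le hn0)
    constructor
    · have : (k : ℝ) ≤ n := by nlinarith
      exact_mod_cast this
    · rw [← h2]; linarith
  have hdiag : 2 * ((n : ℝ) + 2) * walshSum f (0 : Fin n → ZMod 2) ^ 2 ≤
      s.card * ∑ S : Finset (Fin n), f S.card ^ 2 := by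
    have hF0 : 0 ≤ ∑ S : Finset (Fin n), f S.card ^ 2 := Finset.sum_nonneg fun _ _ => sq_nonneg _
    set F := ∑ S : Finset (Fin n), f S.card ^ 2
    have h := walshSum_zero_sq_mul_le (n := n) hx0 hx1.le hfs
    have ex : 1 + x = exp (-log (1 - τ)) := by
      rw [exp_neg, exp_log h1τ, hx]; field_simp; ring
    rw [ex, rpow_def_of_pos hx0, ← exp_nat_mul] at h
    have h' : walshSum f (0 : Fin n → ZMod 2) ^ 2 ≤ exp ((binEntropy τ - 2 * ε) * n) * F := by
      refine le_of_mul_le_mul_right (h.trans (le_of_eq ?_)) (exp_pos (log x * (τ' * n)))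
      rw [mul_right_comm, ← exp_add]
      congr 2
      have : log x = log τ - log (1 - τ) := log_div hτ0.ne' h1τ.ne'
      rw [hε, binEntropy, log_inv, log_inv, this]
      ring
    calc _ ≤ exp (ε * n) * (exp ((binEntropy τ - 2 * ε) * n) * F) := by
          gcongr
          simpa using hn4
      _ = exp ((binEntropy τ - ε) * n) * F := by
          rw [← mul_assoc, ← exp_add]; congr 2; ring
      _ ≤ _ := by gcongr
  have main := card_sq_mul_le_sum_pairs hd0 hd1 hf hsupp (w₂ := m + t) (by omega) hw₂ hne
    (fun k hk => le_trans (mul_le_mul_of_nonneg_right (by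
      push_cast
      have h3 : (1 - 2 * d - ε₁) * n ≤ (2 * √(τ' * (1 - τ')) - ε₁ / 2) * n :=
        mul_le_mul_of_nonneg_right (by linarith) hn0
      linarith) (hf k)) (heig k hk)) s c hdiag
  rw [← hm, Nat.add_sub_cancel_left] at main
  set P := ∑ i ∈ s, ∑ j ∈ s with j ≠ i ∧ hammingDist (c j) (c i) ≤ m + t, r ^ hammingDist (c j) (c i)
  have hP0 : 0 ≤ P := Finset.sum_nonneg fun _ _ => Finset.sum_nonneg fun _ _ => by positivity
  have hrt : exp (-(η / 2) * n) ≤ r ^ t := by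
    have : r ^ t = exp (t * log r) := by rw [exp_nat_mul, exp_log hr0]
    rw [this]
    apply exp_le_exp.2
    have e1 := mul_le_mul_of_nonneg_right ht1 hb0.le
    have e2 := mul_le_mul_of_nonneg_right hεb hn0
    have e3 : (t : ℝ) * log r = -(t * b) := by rw [hb]; ring
    rw [e3]; linarith
  have hB : 0 ≤ (2 * (1 - d)) ^ n * P := mul_nonneg (pow_nonneg (by linarith) _) hP0
  have e0 : exp (-(η / 2) * n) * exp (η / 2 * n) = 1 := by
    rw [← exp_add, neg_mul, neg_add_cancel, exp_zero]
  have e1 : exp (-η * n) = exp (-(η / 2) * n) * exp (-(η / 2) * n) := by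
    rw [← exp_add]; congr 1; ring
  rw [e1]
  rw [mul_assoc _ _ P] at main
  generalize (2 * (1 - d)) ^ n * P = B at main hB ⊢
  calc (s.card : ℝ) ^ 2 * (exp (-(η / 2) * n) * exp (-(η / 2) * n))
      ≤ (s.card : ℝ) ^ 2 * (r ^ t * exp (-(η / 2) * n)) := by gcongr
    _ = (s.card : ℝ) ^ 2 * r ^ t * exp (-(η / 2) * n) := by ring
    _ ≤ (2 * ((n : ℝ) + 2) * (n + 1) * B) * exp (-(η / 2) * n) := by gcongr
    _ = 2 * ((n : ℝ) + 2) * (n + 1) * (B * exp (-(η / 2) * n)) := by ring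
    _ ≤ exp (η / 2 * n) * (B * exp (-(η / 2) * n)) := by
        gcongr
        refine le_trans ?_ hn5
        nlinarith
    _ = B * (exp (-(η / 2) * n) * exp (η / 2 * n)) := by ring
    _ = _ := by rw [e0, mul_one]

/-- The sets meeting `A` in `k` points and its complement in `s` points. -/
def shell {n : ℕ} (A : Finset (Fin n)) (k s : ℕ) : Finset (Finset (Fin n)) :=
  Finset.univ.filter fun z => (z.filter (· ∈ A)).card = k ∧ (z.filter (· ∉ A)).card = s

theorem prod_ite_ite {n : ℕ} (A A' z : Finset (Fin n)) (a b c d : ℝ) :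
    ∏ i ∈ z, (if i ∈ A then (if i ∈ A' then a else b) else (if i ∈ A' then c else d)) =
      a ^ ((z.filter (· ∈ A)).filter (· ∈ A')).card * b ^ ((z.filter (· ∈ A)).filter (· ∉ A')).card *
      (c ^ ((z.filter (· ∉ A)).filter (· ∈ A')).card *
        d ^ ((z.filter (· ∉ A)).filter (· ∉ A')).card) := by
  rw [Finset.prod_ite, Finset.prod_ite, Finset.prod_ite]
  simp only [Finset.prod_const]

theorem card_filter_quarters {n : ℕ} (A A' z : Finset (Fin n)) :
    (z.filter (· ∈ A)).card = ((z.filter (· ∈ A)).filter (· ∈ A')).card +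
      ((z.filter (· ∈ A)).filter (· ∉ A')).card ∧
    (z.filter (· ∉ A)).card = ((z.filter (· ∉ A)).filter (· ∈ A')).card +
      ((z.filter (· ∉ A)).filter (· ∉ A')).card ∧
    (z.filter (· ∈ A')).card = ((z.filter (· ∈ A)).filter (· ∈ A')).card +
      ((z.filter (· ∉ A)).filter (· ∈ A')).card ∧
    (z.filter (· ∉ A')).card = ((z.filter (· ∈ A)).filter (· ∉ A')).card +
      ((z.filter (· ∉ A)).filter (· ∉ A')).card := by
  refine ⟨(Finset.card_filter_add_card_filter_not _).symm,
    (Finset.card_filter_add_card_filter_not _).symm, ?_, ?_⟩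
  · rw [Finset.filter_comm, Finset.filter_comm (· ∉ A)]
    exact (Finset.card_filter_add_card_filter_not _).symm
  · rw [Finset.filter_comm, Finset.filter_comm (· ∉ A)]
    exact (Finset.card_filter_add_card_filter_not _).symm

theorem card_shell_inter_shell_mul_le {n w k s h : ℕ} {g : ℝ} (hg : 0 < g) {A A' : Finset (Fin n)}
    (hA : A.card = w) (hA' : A'.card = w) (hh : (A.filter (· ∉ A')).card = h) :
    ((shell A k s ∩ shell A' k s).card : ℝ) * (g ^ (3 * s) * g ^ (w - h)) ≤
      (1 + g) ^ n * (1 - g + g ^ 2) ^ (n - w - h) * g ^ k := by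
  set F : Fin n → ℝ := fun i => if i ∈ A then (if i ∈ A' then g⁻¹ else g)
    else (if i ∈ A' then g else g ^ 3) with hF
  have hF0 : ∀ i, 0 ≤ F i := by intro i; simp only [hF]; split_ifs <;> positivity
  have hprod : ∑ z : Finset (Fin n), ∏ i ∈ z, F i = ∏ i, (1 + F i) := by
    rw [Finset.prod_one_add, Finset.powerset_univ]
  have h1 : ∏ i, (1 + F i) = (1 + g) ^ n * (1 - g + g ^ 2) ^ (n - w - h) * (g⁻¹) ^ (w - h) := by
    have e : ∀ i, 1 + F i = if i ∈ A then (if i ∈ A' then 1 + g⁻¹ else 1 + g)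
        else (if i ∈ A' then 1 + g else 1 + g ^ 3) := by
      intro i; simp only [hF]; split_ifs <;> rfl
    obtain ⟨q1, q2, q3, q4⟩ := card_filter_quarters A A' Finset.univ
    have q5 : (Finset.univ.filter (· ∈ A)).card = w := by simpa using hA
    have q6 : (Finset.univ.filter (· ∈ A')).card = w := by simpa using hA'
    have q7 : ((Finset.univ.filter (· ∈ A)).filter (· ∉ A')).card = h := by
      rw [← hh]; congr 1; simp
    have q8 : (Finset.univ.filter (· ∉ A)).card + w = n := by
      rw [← q5, add_comm, Finset.card_filter_add_card_filter_not]; simp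
    rw [Finset.prod_congr rfl fun i _ => e i, prod_ite_ite]
    generalize ((Finset.univ.filter (· ∈ A)).filter (· ∈ A')).card = a at *
    generalize ((Finset.univ.filter (· ∈ A)).filter (· ∉ A')).card = b at *
    generalize ((Finset.univ.filter (· ∉ A)).filter (· ∈ A')).card = c at *
    generalize ((Finset.univ.filter (· ∉ A)).filter (· ∉ A')).card = d at *
    have ea : w - h = a := by omega
    have ec : c = b := by omega
    have ed : n - w - h = d := by omega
    have en : n = a + b + (b + d) := by omega
    rw [ea, ed, ec, en, show 1 + g ^ 3 = (1 + g) * (1 - g + g ^ 2) by ring,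
      show 1 + g⁻¹ = (1 + g) * g⁻¹ by field_simp; ring, mul_pow, mul_pow]
    ring
  have h2 : ∀ z ∈ shell A k s ∩ shell A' k s, g ^ (3 * s) * (g⁻¹) ^ k = ∏ i ∈ z, F i := by
    intro z hz
    simp only [shell, Finset.mem_inter, Finset.mem_filter, Finset.mem_univ, true_and] at hz
    obtain ⟨q1, q2, q3, q4⟩ := card_filter_quarters A A' z
    obtain ⟨⟨e1, e2⟩, e3, e4⟩ := hz
    rw [prod_ite_ite]
    generalize ((z.filter (· ∈ A)).filter (· ∈ A')).card = a at *
    generalize ((z.filter (· ∈ A)).filter (· ∉ A')).card = b at *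
    generalize ((z.filter (· ∉ A)).filter (· ∈ A')).card = c at *
    generalize ((z.filter (· ∉ A)).filter (· ∉ A')).card = d at *
    have ec : c = b := by omega
    have ek : k = a + b := by omega
    have es : s = b + d := by omega
    rw [ec, ek, es, inv_pow, inv_pow]
    field_simp
    ring
  have h3 : ((shell A k s ∩ shell A' k s).card : ℝ) * (g ^ (3 * s) * (g⁻¹) ^ k) ≤ ∏ i, (1 + F i) := by
    rw [← hprod, ← nsmul_eq_mul, ← Finset.sum_const, Finset.sum_congr rfl h2]
    exact Finset.sum_le_sum_of_subset_of_nonneg (Finset.subset_univ _) fun z _ _ =>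
      Finset.prod_nonneg fun i _ => hF0 i
  rw [h1] at h3
  have h4 := mul_le_mul_of_nonneg_right h3 (by positivity : 0 ≤ g ^ k * g ^ (w - h))
  have e1 : (g⁻¹) ^ k * g ^ k = 1 := by rw [← mul_pow, inv_mul_cancel₀ hg.ne', one_pow]
  have e2 : (g⁻¹) ^ (w - h) * g ^ (w - h) = 1 := by
    rw [← mul_pow, inv_mul_cancel₀ hg.ne', one_pow]
  calc _ = ((shell A k s ∩ shell A' k s).card : ℝ) * (g ^ (3 * s) * g ^ (w - h)) *
        ((g⁻¹) ^ k * g ^ k) := by rw [e1, mul_one]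
    _ = ((shell A k s ∩ shell A' k s).card : ℝ) * (g ^ (3 * s) * (g⁻¹) ^ k) *
        (g ^ k * g ^ (w - h)) := by ring
    _ ≤ _ := h4
    _ = (1 + g) ^ n * (1 - g + g ^ 2) ^ (n - w - h) * g ^ k * ((g⁻¹) ^ (w - h) * g ^ (w - h)) := by
        ring
    _ = _ := by rw [e2, mul_one]

theorem card_shell {n w : ℕ} (A : Finset (Fin n)) (hA : A.card = w) (k s : ℕ) :
    (shell A k s).card = w.choose k * (n - w).choose s := by
  have e : (Aᶜ).card = n - w := by rw [Finset.card_compl, hA, Fintype.card_fin]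
  rw [← hA, ← Finset.card_powersetCard k A, hA, ← e, ← Finset.card_powersetCard s Aᶜ,
    ← Finset.card_product]
  refine Finset.card_nbij' (fun z => (z.filter (· ∈ A), z.filter (· ∉ A))) (fun x => x.1 ∪ x.2)
    ?_ ?_ ?_ ?_
  · intro z hz
    simp only [shell, Finset.coe_filter, Finset.mem_univ, true_and, Set.mem_ofPred_eq] at hz
    simp only [Finset.coe_product, Set.mem_prod, Finset.mem_coe, Finset.mem_powersetCard]
    refine ⟨⟨fun i hi => (Finset.mem_filter.1 hi).2, hz.1⟩, fun i hi => ?_, hz.2⟩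
    exact Finset.mem_compl.2 (Finset.mem_filter.1 hi).2
  · rintro ⟨x, y⟩ hz
    simp only [Finset.coe_product, Set.mem_prod, Finset.mem_coe, Finset.mem_powersetCard] at hz
    obtain ⟨⟨h1, h2⟩, h3, h4⟩ := hz
    have e1 : (x ∪ y).filter (· ∈ A) = x := by
      ext i
      have := @h1 i; have := @h3 i
      simp only [Finset.mem_filter, Finset.mem_union, Finset.mem_compl] at *
      tauto
    have e2 : (x ∪ y).filter (· ∉ A) = y := by
      ext i
      have := @h1 i; have := @h3 i
      simp only [Finset.mem_filter, Finset.mem_union, Finset.mem_compl] at *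
      tauto
    simp [shell, e1, e2, h2, h4]
  · intro z _
    exact Finset.filter_union_filter_not_eq _ z
  · rintro ⟨x, y⟩ hz
    simp only [Finset.coe_product, Set.mem_prod, Finset.mem_coe, Finset.mem_powersetCard] at hz
    obtain ⟨⟨h1, h2⟩, h3, h4⟩ := hz
    refine Prod.ext ?_ ?_
    · ext i
      have := @h1 i; have := @h3 i
      simp only [Finset.mem_filter, Finset.mem_union, Finset.mem_compl] at *
      tauto
    · ext i
      have := @h1 i; have := @h3 i
      simp only [Finset.mem_filter, Finset.mem_union, Finset.mem_compl] at *
      tauto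

theorem card_mul_le_card_biUnion {α β : Type*} [DecidableEq β] (N : Finset α) (Y : α → Finset β)
    {y : ℕ} {B : ℝ} (hy : ∀ j ∈ N, (Y j).card = y)
    (hB : ∀ j ∈ N, ∑ j' ∈ N, ((Y j ∩ Y j').card : ℝ) ≤ B * y) :
    (N.card : ℝ) * y ≤ B * (N.biUnion Y).card := by
  set U := N.biUnion Y with hU
  have hsub : ∀ j ∈ N, Y j ⊆ U := fun j hj => Finset.subset_biUnion_of_mem Y hj
  have hc : ∀ j ∈ N, ∀ j' : α, ((Y j ∩ Y j').card : ℝ) =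
      ∑ z ∈ U, (if z ∈ Y j then (1 : ℝ) else 0) * (if z ∈ Y j' then (1 : ℝ) else 0) := by
    intro j hj j'
    simp only [ite_mul, one_mul, zero_mul, ← ite_and]
    rw [Finset.sum_boole]
    congr 2
    ext z
    simp only [Finset.mem_inter, Finset.mem_filter]
    exact ⟨fun h => ⟨hsub j hj h.1, h⟩, fun h => h.2⟩
  have h1 : (N.card : ℝ) * y = ∑ z ∈ U, ∑ j ∈ N, (if z ∈ Y j then (1 : ℝ) else 0) := by
    rw [Finset.sum_comm, ← nsmul_eq_mul, ← Finset.sum_const]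
    refine Finset.sum_congr rfl fun j hj => ?_
    rw [← hy j hj, ← Finset.inter_self (Y j), hc j hj]
    refine Finset.sum_congr rfl fun z _ => ?_
    split_ifs <;> simp_all
  have h2 : ∑ z ∈ U, (∑ j ∈ N, (if z ∈ Y j then (1 : ℝ) else 0)) ^ 2 ≤ B * (N.card * y) := by
    have : ∀ z ∈ U, (∑ j ∈ N, (if z ∈ Y j then (1 : ℝ) else 0)) ^ 2 =
        ∑ j ∈ N, ∑ j' ∈ N, (if z ∈ Y j then (1 : ℝ) else 0) * (if z ∈ Y j' then (1 : ℝ) else 0) := by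
      intro z _; rw [sq, Finset.sum_mul_sum]
    rw [Finset.sum_congr rfl this, Finset.sum_comm]
    calc _ = ∑ j ∈ N, ∑ j' ∈ N, ((Y j ∩ Y j').card : ℝ) := by
          refine Finset.sum_congr rfl fun j hj => ?_
          rw [Finset.sum_comm]
          exact Finset.sum_congr rfl fun j' _ => (hc j hj j').symm
      _ ≤ ∑ j ∈ N, B * y := Finset.sum_le_sum hB
      _ = _ := by rw [Finset.sum_const, nsmul_eq_mul]; ring
  have h3 := sq_sum_le_card_mul_sum_sq (s := U)
    (f := fun z => ∑ j ∈ N, (if z ∈ Y j then (1 : ℝ) else 0))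
  rw [← h1] at h3
  have h4 := h3.trans (mul_le_mul_of_nonneg_left h2 (Nat.cast_nonneg U.card))
  rcases (by positivity : 0 ≤ (N.card : ℝ) * y).eq_or_lt with h | h
  · rw [← h]
    rcases N.eq_empty_or_nonempty with rfl | ⟨j, hj⟩
    · simp [hU]
    · have hB' := hB j hj
      have hN : 0 < (N.card : ℝ) := by exact_mod_cast Finset.card_pos.2 ⟨j, hj⟩
      have hy0 : (y : ℝ) = 0 := by
        rcases mul_eq_zero.1 h.symm with h | h
        · linarith
        · exact h
      have : U = ∅ := by
        refine Finset.subset_empty.1 (Finset.biUnion_subset.2 fun j hj => ?_)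
        rw [Finset.subset_empty, ← Finset.card_eq_zero, hy j hj]; exact_mod_cast hy0
      rw [this]; simp
  · refine le_of_mul_le_mul_right ?_ h
    calc _ = ((N.card : ℝ) * y) ^ 2 := by ring
      _ ≤ _ := h4
      _ = _ := by ring

/-- The coordinates in which two words differ. -/
def diffSet {n : ℕ} (x y : Fin n → ZMod 2) : Finset (Fin n) := Finset.univ.filter fun i => x i ≠ y i

/-- The word obtained from `x` by flipping the coordinates in `z`. -/
def flipWord {n : ℕ} (x : Fin n → ZMod 2) (z : Finset (Fin n)) : Fin n → ZMod 2 :=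
  fun i => if i ∈ z then x i + 1 else x i

theorem mem_diffSet {n : ℕ} {x y : Fin n → ZMod 2} {i : Fin n} : i ∈ diffSet x y ↔ x i ≠ y i := by
  simp [diffSet]

theorem card_diffSet {n : ℕ} (x y : Fin n → ZMod 2) : (diffSet x y).card = hammingDist x y := rfl

theorem diffSet_flipWord {n : ℕ} (u x : Fin n → ZMod 2) (z : Finset (Fin n)) :
    diffSet u (flipWord x z) = symmDiff (diffSet u x) z := by
  have h : ∀ a b : ZMod 2, a ≠ b + 1 ↔ ¬ a ≠ b := by decide
  ext i
  simp only [Finset.mem_symmDiff, mem_diffSet, flipWord]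
  have := h (u i) (x i)
  by_cases hz : i ∈ z
  · simp only [hz, if_true, not_true_eq_false, and_false, true_and, false_or]
    exact this
  · simp only [hz, if_false, not_false_eq_true, and_true, false_and, or_false]

theorem diffSet_self {n : ℕ} (x : Fin n → ZMod 2) : diffSet x x = ∅ := by simp [diffSet]

theorem symmDiff_diffSet {n : ℕ} (u v x : Fin n → ZMod 2) :
    diffSet u v = symmDiff (diffSet u x) (diffSet v x) := by
  have h : ∀ a b c : ZMod 2, a ≠ b ↔ (a ≠ c ∧ ¬ b ≠ c) ∨ (b ≠ c ∧ ¬ a ≠ c) := by decide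
  ext i
  simp only [Finset.mem_symmDiff, mem_diffSet]
  exact h _ _ _

theorem flipWord_injective {n : ℕ} (x : Fin n → ZMod 2) : Function.Injective (flipWord x) := by
  intro z z' h
  have := congrArg (diffSet x) h
  simpa [diffSet_flipWord, diffSet_self] using this

theorem card_symmDiff_of_mem_shell {n w k s : ℕ} {A z : Finset (Fin n)} (hA : A.card = w)
    (hz : z ∈ shell A k s) : (symmDiff A z).card + k = w + s ∧ z.card = k + s := by
  obtain ⟨h1, h2⟩ := (Finset.mem_filter.1 hz).2
  have e1 : (z.filter (· ∈ A)) = A ∩ z := by ext i; simp [and_comm]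
  have e2 : (z.filter (· ∉ A)) = z \ A := by ext i; simp
  rw [e1] at h1
  rw [e2] at h2
  have h3 := Finset.card_sdiff_add_card_inter A z
  have h4 := Finset.card_sdiff_add_card_inter z A
  rw [Finset.inter_comm z A] at h4
  have h5 : (symmDiff A z).card = (A \ z).card + (z \ A).card := by
    rw [symmDiff_def]
    exact Finset.card_union_of_disjoint disjoint_sdiff_sdiff
  omega

/-- The probability that transmission of `c i` is not decoded correctly for the family `c` of
codewords indexed by `s`. -/
noncomputable def errProb {α : Type*} [DecidableEq α] {n : ℕ} (p : ℝ) (s : Finset α)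
    (c : α → Fin n → ZMod 2) (i : α) : ℝ :=
  Px p (c i) (Finset.univ.filter fun y => ∃ j ∈ s, j ≠ i ∧ hammingDist (c j) y ≤ hammingDist (c i) y)

theorem errProb_nonneg {α : Type*} [DecidableEq α] {n : ℕ} {p : ℝ} (hp0 : 0 ≤ p) (hp1 : p ≤ 1)
    (s : Finset α) (c : α → Fin n → ZMod 2) (i : α) : 0 ≤ errProb p s c i :=
  Finset.sum_nonneg fun _ _ => mul_nonneg (by positivity) (pow_nonneg (by linarith) _)

theorem errProb_mono {α : Type*} [DecidableEq α] {n : ℕ} {p : ℝ} (hp0 : 0 ≤ p) (hp1 : p ≤ 1)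
    {s s' : Finset α} (hs : s' ⊆ s) (c : α → Fin n → ZMod 2) (i : α) :
    errProb p s' c i ≤ errProb p s c i := by
  refine Finset.sum_le_sum_of_subset_of_nonneg (fun y hy => ?_) fun _ _ _ =>
    mul_nonneg (by positivity) (pow_nonneg (by linarith) _)
  obtain ⟨j, hj, h⟩ := (Finset.mem_filter.1 hy).2
  exact Finset.mem_filter.2 ⟨Finset.mem_univ _, j, hs hj, h⟩

theorem mul_card_biUnion_shell_le_errProb {α : Type*} [DecidableEq α] {n w k t : ℕ} {p : ℝ}
    (hp0 : 0 ≤ p) (hp1 : p ≤ 1) {s N : Finset α} (hN : N ⊆ s) (c : α → Fin n → ZMod 2) {i : α}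
    (hi : i ∉ N) (hw : ∀ j ∈ N, hammingDist (c j) (c i) = w) (hk : w ≤ 2 * k) :
    p ^ (k + t) * (1 - p) ^ (n - (k + t)) *
      (N.biUnion fun j => shell (diffSet (c j) (c i)) k t).card ≤ errProb p s c i := by
  set U := N.biUnion fun j => shell (diffSet (c j) (c i)) k t with hU
  have hmem : ∀ z ∈ U, ∃ j ∈ N, z ∈ shell (diffSet (c j) (c i)) k t := fun z hz =>
    Finset.mem_biUnion.1 hz
  have hdist : ∀ z ∈ U, hammingDist (c i) (flipWord (c i) z) = k + t := by
    intro z hz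
    obtain ⟨j, hj, hz⟩ := hmem z hz
    rw [← card_diffSet, diffSet_flipWord, diffSet_self, ← Finset.bot_eq_empty, bot_symmDiff]
    exact (card_symmDiff_of_mem_shell (hw j hj) hz).2
  have h1 : p ^ (k + t) * (1 - p) ^ (n - (k + t)) * (U.card : ℝ) =
      ∑ y ∈ U.image (flipWord (c i)), p ^ hammingDist (c i) y * (1 - p) ^ (n - hammingDist (c i) y) := by
    rw [Finset.sum_image fun a _ b _ h => flipWord_injective _ h, mul_comm, ← nsmul_eq_mul,
      ← Finset.sum_const]
    exact Finset.sum_congr rfl fun z hz => by rw [hdist z hz]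
  rw [h1]
  refine Finset.sum_le_sum_of_subset_of_nonneg (fun y hy => ?_) fun _ _ _ =>
    mul_nonneg (by positivity) (pow_nonneg (by linarith) _)
  obtain ⟨z, hz, rfl⟩ := Finset.mem_image.1 hy
  obtain ⟨j, hj, hz'⟩ := hmem z hz
  refine Finset.mem_filter.2 ⟨Finset.mem_univ _, j, hN hj, fun h => hi (h ▸ hj), ?_⟩
  rw [hdist z hz, ← card_diffSet, diffSet_flipWord]
  have := (card_symmDiff_of_mem_shell (A := diffSet (c j) (c i)) (hw j hj) hz').1
  omega

theorem hammingDist_eq_two_mul {n w : ℕ} {u v x : Fin n → ZMod 2} (hu : hammingDist u x = w)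
    (hv : hammingDist v x = w) :
    hammingDist u v = 2 * ((diffSet u x).filter (· ∉ diffSet v x)).card ∧
      ((diffSet u x).filter (· ∉ diffSet v x)).card ≤ w ∧
      w + ((diffSet u x).filter (· ∉ diffSet v x)).card ≤ n := by
  rw [← card_diffSet] at hu hv
  rw [← card_diffSet, symmDiff_diffSet u v x]
  generalize diffSet u x = A at *
  generalize diffSet v x = A' at *
  have e : A.filter (· ∉ A') = A \ A' := by ext i; simp
  rw [e]
  have h3 := Finset.card_sdiff_add_card_inter A A'
  have h4 := Finset.card_sdiff_add_card_inter A' A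
  rw [Finset.inter_comm A' A] at h4
  have h5 : (symmDiff A A').card = (A \ A').card + (A' \ A).card := by
    rw [symmDiff_def]
    exact Finset.card_union_of_disjoint disjoint_sdiff_sdiff
  have h6 : ((A \ A') ∪ A').card = (A \ A').card + A'.card :=
    Finset.card_union_of_disjoint Finset.sdiff_disjoint
  have h7 : ((A \ A') ∪ A').card ≤ n := by simpa using Finset.card_le_univ ((A \ A') ∪ A')
  omega

theorem sum_card_shell_inter_le {α : Type*} [DecidableEq α] {n w k t : ℕ} {g γ T₀ : ℝ}
    (hg0 : 0 < g) (hg1 : g < 1) (hγ : γ = 2 * g / (1 + g ^ 2)) (hT₀ : 0 ≤ T₀)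
    {N : Finset α} {c : α → Fin n → ZMod 2} {x : Fin n → ZMod 2}
    (hw : ∀ j ∈ N, hammingDist (c j) x = w) (hk : w / 2 + k = w) (hwn : w + w / 2 ≤ n)
    {j : α} (hj : j ∈ N)
    (hlow : ∀ l < w, ((N.filter fun j' => j' ≠ j ∧ hammingDist (c j') (c j) = l).card : ℝ) ≤ T₀ / γ ^ l)
    (hcard : (N.card : ℝ) - 1 ≤ T₀ / γ ^ w) :
    ∑ j' ∈ N, ((shell (diffSet (c j) x) k t ∩ shell (diffSet (c j') x) k t).card : ℝ) ≤
      (shell (diffSet (c j) x) k t).card +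
      ((n : ℝ) + 1) * (T₀ / γ ^ w * ((1 + g) ^ n * (1 - g + g ^ 2) ^ (n - w - w / 2) / g ^ (3 * t))) := by
  have hγ0 : 0 < γ := by rw [hγ]; positivity
  have hγ1 : γ ≤ 1 := by
    rw [hγ, div_le_one (by positivity)]; nlinarith [sq_nonneg (1 - g)]
  set e := 1 - g + g ^ 2 with he
  have he0 : 0 < e := by rw [he]; nlinarith
  have hge : g ≤ e := by rw [he]; nlinarith [sq_nonneg (1 - g)]
  have hγe : γ ^ 2 * e ≤ g := by
    have h2 : γ ^ 2 * e = 4 * g ^ 2 * e / (1 + g ^ 2) ^ 2 := by rw [hγ]; field_simp; ring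
    rw [h2, div_le_iff₀ (by positivity), he]
    nlinarith [mul_nonneg hg0.le (sq_nonneg (1 - 2 * g + g ^ 2)), mul_pos hg0 hg0,
      mul_nonneg hg0.le (sq_nonneg ((1 - g) ^ 2))]
  set h₀ := w / 2 with hh₀
  set V : ℝ := (1 + g) ^ n * e ^ (n - w - h₀) / g ^ (3 * t) with hV
  have hV0 : 0 ≤ V := by positivity
  set Y := fun j' => shell (diffSet (c j') x) k t with hY
  have hbound : ∀ j' ∈ N, ∃ h ≤ w, w + h ≤ n ∧ hammingDist (c j') (c j) = 2 * h ∧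
      ((Y j ∩ Y j').card : ℝ) ≤ (1 + g) ^ n * e ^ (n - w - h) * g ^ k / (g ^ (3 * t) * g ^ (w - h)) := by
    intro j' hj'
    obtain ⟨a1, a2, a3⟩ := hammingDist_eq_two_mul (hw j hj) (hw j' hj')
    refine ⟨_, a2, a3, by rw [hammingDist_comm]; exact a1, ?_⟩
    rw [le_div_iff₀ (by positivity)]
    exact card_shell_inter_shell_mul_le (A := diffSet (c j) x) (A' := diffSet (c j') x) hg0
      (hw j hj) (hw j' hj') rfl
  have hlevel : ∀ l ∈ Finset.range (n + 1),
      ∑ j' ∈ (N.erase j).filter (fun j' => hammingDist (c j') (c j) = l), ((Y j ∩ Y j').card : ℝ) ≤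
        T₀ / γ ^ w * V := by
    intro l _
    set M := (N.erase j).filter (fun j' => hammingDist (c j') (c j) = l) with hM
    rcases M.eq_empty_or_nonempty with h | ⟨j₁, hj₁⟩
    · rw [h, Finset.sum_empty]; positivity
    have hMN : ∀ j' ∈ M, j' ∈ N := fun j' h => Finset.mem_of_mem_erase (Finset.mem_filter.1 h).1
    obtain ⟨h, hhw, hhn, hl, -⟩ := hbound j₁ (hMN j₁ hj₁)
    rw [(Finset.mem_filter.1 hj₁).2] at hl
    set X := (1 + g) ^ n * e ^ (n - w - h) * g ^ k / (g ^ (3 * t) * g ^ (w - h)) with hX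
    have h1 : ∑ j' ∈ M, ((Y j ∩ Y j').card : ℝ) ≤ M.card * X := by
      rw [← nsmul_eq_mul]
      refine Finset.sum_le_card_nsmul _ _ _ fun j' hj' => ?_
      obtain ⟨h', -, -, hl', hle⟩ := hbound j' (hMN j' hj')
      rw [(Finset.mem_filter.1 hj').2] at hl'
      have : h' = h := by omega
      rwa [this] at hle
    refine h1.trans ?_
    rcases lt_or_ge (2 * h) w with hlt | hge'
    · have hM1 : (M.card : ℝ) ≤ T₀ / γ ^ (2 * h) := by
        rw [← hl]
        refine le_trans (le_of_eq ?_) (hlow l (by omega))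
        congr 2
        ext a
        simp only [hM, Finset.mem_filter, Finset.mem_erase]
        tauto
      obtain ⟨m, hm⟩ : ∃ m, h₀ = h + m := ⟨h₀ - h, by omega⟩
      have hXV : X * g ^ m = V * e ^ m := by
        have e1 : n - w - h = (n - w - h₀) + m := by omega
        have e2 : w - h = k + m := by omega
        rw [hX, hV, e1, e2]
        field_simp
        ring
      have hp : (γ ^ 2 * e) ^ m ≤ g ^ m := pow_le_pow_left₀ (by positivity) hγe m
      calc (M.card : ℝ) * X ≤ T₀ / γ ^ (2 * h) * X := by gcongr
        _ ≤ T₀ / γ ^ w * V := by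
          rw [div_mul_eq_mul_div, div_mul_eq_mul_div, div_le_div_iff₀ (by positivity) (by positivity)]
          refine le_of_mul_le_mul_right ?_ (show 0 < g ^ m by positivity)
          have e3 : γ ^ w ≤ γ ^ (2 * h) * γ ^ (2 * m) := by
            rw [← pow_add]; exact pow_le_pow_of_le_one hγ0.le hγ1 (by omega)
          calc T₀ * X * γ ^ w * g ^ m = T₀ * (X * g ^ m) * γ ^ w := by ring
            _ = T₀ * (V * e ^ m) * γ ^ w := by rw [hXV]
            _ ≤ T₀ * (V * e ^ m) * (γ ^ (2 * h) * γ ^ (2 * m)) := by gcongr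
            _ = T₀ * V * γ ^ (2 * h) * (γ ^ 2 * e) ^ m := by rw [mul_pow, ← pow_mul]; ring
            _ ≤ T₀ * V * γ ^ (2 * h) * g ^ m := by gcongr
    · obtain ⟨m, hm⟩ : ∃ m, h = h₀ + m := ⟨h - h₀, by omega⟩
      have hXV : X * e ^ m = V * g ^ m := by
        have e1 : n - w - h₀ = (n - w - h) + m := by omega
        have e2 : k = (w - h) + m := by omega
        rw [hX, hV, e1, e2]
        field_simp
        ring
      have hXV' : X ≤ V := by
        refine le_of_mul_le_mul_right ?_ (show 0 < e ^ m by positivity)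
        rw [hXV]
        gcongr
      have hM1 : (M.card : ℝ) ≤ T₀ / γ ^ w := by
        refine le_trans ?_ hcard
        have : M.card + 1 ≤ N.card := by
          have h3 := Finset.card_filter_le (N.erase j) (fun j' => hammingDist (c j') (c j) = l)
          have h4 := Finset.card_erase_add_one hj
          rw [hM]
          omega
        have : (M.card : ℝ) + 1 ≤ N.card := by exact_mod_cast this
        linarith
      have : 0 ≤ X := by positivity
      gcongr
  have hfib : ∑ j' ∈ N.erase j, ((Y j ∩ Y j').card : ℝ) =
      ∑ l ∈ Finset.range (n + 1), ∑ j' ∈ (N.erase j).filter (fun j' => hammingDist (c j') (c j) = l),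
        ((Y j ∩ Y j').card : ℝ) := by
    refine (Finset.sum_fiberwise_of_maps_to (fun j' _ => ?_) _).symm
    rw [Finset.mem_range, Nat.lt_succ_iff]
    simpa using hammingDist_le_card_fintype (x := c j') (y := c j)
  rw [← Finset.add_sum_erase N _ hj, Finset.inter_self]
  refine add_le_add le_rfl ?_
  change ∑ j' ∈ N.erase j, ((Y j ∩ Y j').card : ℝ) ≤ _
  rw [hfib]
  refine (Finset.sum_le_card_nsmul _ _ _ hlevel).trans (le_of_eq ?_)
  simp

theorem two_pow_le_mul_choose_half (w : ℕ) : (2 : ℝ) ^ w ≤ (w + 1) * w.choose (w / 2) := by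
  have h := Finset.sum_le_card_nsmul (Finset.range (w + 1)) (fun r => w.choose r) (w.choose (w / 2))
    fun r _ => Nat.choose_le_middle r w
  rw [Nat.sum_range_choose, Finset.card_range, smul_eq_mul] at h
  exact_mod_cast h

theorem errProb_ge_of_regular {α : Type*} [DecidableEq α] {n w k t : ℕ} {g γ p T₀ B : ℝ}
    (hg0 : 0 < g) (hg1 : g < 1) (hγ : γ = 2 * g / (1 + g ^ 2)) (hp : p = g ^ 2 / (1 + g ^ 2))
    (hT₀ : 0 ≤ T₀) (hB : 0 ≤ B)
    {s N : Finset α} (hNs : N ⊆ s) {c : α → Fin n → ZMod 2} {i : α} (hi : i ∉ N)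
    (hw : ∀ j ∈ N, hammingDist (c j) (c i) = w) (hk : w / 2 + k = w) (hwn : w + w / 2 ≤ n)
    (ht : t = ⌊(((n - w : ℕ) : ℝ) + 1) * p⌋₊)
    (hlow : ∀ j ∈ N, ∀ l < w,
      ((N.filter fun j' => j' ≠ j ∧ hammingDist (c j') (c j) = l).card : ℝ) ≤ T₀ / γ ^ l)
    (hcard : (N.card : ℝ) - 1 ≤ T₀ / γ ^ w) (hcard' : T₀ / γ ^ w ≤ N.card)
    (hBY : ((n : ℝ) + 1) *
      (T₀ / γ ^ w * ((1 + g) ^ n * (1 - g + g ^ 2) ^ (n - w - w / 2) / g ^ (3 * t))) ≤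
      B * (w.choose k * (n - w).choose t : ℕ)) :
    T₀ * g / (((n : ℝ) + 1) ^ 2 * (1 + B)) ≤ errProb p s c i := by
  have hγ0 : 0 < γ := by rw [hγ]; positivity
  have hp0 : 0 < p := by rw [hp]; positivity
  have hq : 1 - p = 1 / (1 + g ^ 2) := by rw [hp]; field_simp; ring
  have hq0 : 0 < 1 - p := by rw [hq]; positivity
  have htn : t ≤ n - w := by
    have h1 : (t : ℝ) ≤ (((n - w : ℕ) : ℝ) + 1) * p := by rw [ht]; exact Nat.floor_le (by positivity)
    have h2 : (((n - w : ℕ) : ℝ) + 1) * p < ((n - w : ℕ) : ℝ) + 1 :=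
      mul_lt_of_lt_one_right (by positivity) (by linarith)
    have h3 : (t : ℝ) < ((n - w + 1 : ℕ) : ℝ) := by push_cast; linarith
    exact Nat.lt_succ_iff.1 (by exact_mod_cast h3)
  have h1 := mul_card_biUnion_shell_le_errProb (k := k) (t := t) hp0.le (by linarith) hNs c hi hw (by omega)
  have h2 := card_mul_le_card_biUnion N (fun j => shell (diffSet (c j) (c i)) k t) (B := 1 + B)
    (fun j hj => card_shell (diffSet (c j) (c i)) (hw j hj) k t) (fun j hj => by
      refine (sum_card_shell_inter_le hg0 hg1 hγ hT₀ hw hk hwn hj (hlow j hj) hcard).trans ?_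
      rw [card_shell (diffSet (c j) (c i)) (hw j hj) k t]
      linarith)
  set U := N.biUnion fun j => shell (diffSet (c j) (c i)) k t
  set y : ℕ := w.choose k * (n - w).choose t with hy
  have h3 : γ ^ w * g ≤ ((n : ℝ) + 1) ^ 2 * (p ^ (k + t) * (1 - p) ^ (n - (k + t)) * y) := by
    have e1 : n - (k + t) = (n - w - t) + (w - k) := by omega
    have f1 := two_pow_le_mul_choose_half w
    rw [Nat.choose_symm_of_eq_add (show w = w / 2 + k by omega)] at f1
    have f2 := binomial_mode_ge (N := n - w) hp0 (by linarith)
    rw [← ht, div_le_iff₀ (by positivity)] at f2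
    have f3 : (γ / 2) ^ w * g ≤ p ^ k * (1 - p) ^ (w - k) := by
      have e2 : (γ / 2) ^ w = g ^ w / (1 + g ^ 2) ^ w := by rw [hγ, ← div_pow]; congr 1; field_simp
      have e3 : p ^ k * (1 - p) ^ (w - k) = g ^ (2 * k) / (1 + g ^ 2) ^ w := by
        have : (1 + g ^ 2) ^ w = (1 + g ^ 2) ^ k * (1 + g ^ 2) ^ (w - k) := by
          rw [← pow_add]; congr 1; omega
        rw [hq, hp, div_pow, div_pow, this, ← pow_mul, one_pow]
        field_simp
      rw [e2, e3, div_mul_eq_mul_div]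
      gcongr
      rw [← pow_succ]
      exact pow_le_pow_of_le_one hg0.le hg1.le (by omega)
    have hw1 : (w : ℝ) + 1 ≤ n + 1 := by
      have : (w : ℝ) ≤ n := by exact_mod_cast (by omega : w ≤ n)
      linarith
    have hw2 : ((n - w : ℕ) : ℝ) + 1 ≤ n + 1 := by
      have : ((n - w : ℕ) : ℝ) ≤ n := by exact_mod_cast (by omega : n - w ≤ n)
      linarith
    rw [e1, pow_add, pow_add, hy]
    push_cast
    calc γ ^ w * g = 2 ^ w * 1 * ((γ / 2) ^ w * g) := by rw [div_pow]; field_simp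
      _ ≤ ((n + 1) * (w.choose k)) * (((n - w).choose t) * p ^ t * (1 - p) ^ (n - w - t) * (n + 1)) *
          (p ^ k * (1 - p) ^ (w - k)) := by
        have f1' : (2 : ℝ) ^ w ≤ (n + 1) * (w.choose k) := f1.trans (by gcongr)
        have f2' : 1 ≤ (((n - w).choose t) * p ^ t * (1 - p) ^ (n - w - t) * ((n : ℝ) + 1)) :=
          f2.trans (by gcongr)
        gcongr
      _ = _ := by ring
  have ha : 0 ≤ p ^ (k + t) * (1 - p) ^ (n - (k + t)) := by positivity
  rw [div_le_iff₀ (by positivity)]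
  have hT : T₀ ≤ N.card * γ ^ w := by rwa [div_le_iff₀ (by positivity)] at hcard'
  calc T₀ * g ≤ N.card * (γ ^ w * g) := by
        rw [← mul_assoc]; gcongr
    _ ≤ N.card * (((n : ℝ) + 1) ^ 2 * (p ^ (k + t) * (1 - p) ^ (n - (k + t)) * y)) := by gcongr
    _ = ((n : ℝ) + 1) ^ 2 * (p ^ (k + t) * (1 - p) ^ (n - (k + t))) * (N.card * y) := by ring
    _ ≤ ((n : ℝ) + 1) ^ 2 * (p ^ (k + t) * (1 - p) ^ (n - (k + t))) * ((1 + B) * U.card) := by gcongr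
    _ = (((n : ℝ) + 1) ^ 2 * (1 + B)) * (p ^ (k + t) * (1 - p) ^ (n - (k + t)) * U.card) := by ring
    _ ≤ (((n : ℝ) + 1) ^ 2 * (1 + B)) * errProb p s c i := by gcongr
    _ = _ := by ring

theorem pow_div_le_mul_choose {n w k t : ℕ} {g γ p : ℝ}
    (hg0 : 0 < g) (hg1 : g < 1) (hγ : γ = 2 * g / (1 + g ^ 2)) (hp : p = g ^ 2 / (1 + g ^ 2))
    (hk : w / 2 + k = w) (hwn : w + w / 2 ≤ n) (ht : t = ⌊(((n - w : ℕ) : ℝ) + 1) * p⌋₊) :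
    (1 + g) ^ n * (1 - g + g ^ 2) ^ (n - w - w / 2) / g ^ (3 * t) / γ ^ w ≤
      ((n : ℝ) + 1) ^ 2 * (w.choose k * (n - w).choose t : ℕ) *
        exp ((log (1 + g) + log (1 - g + g ^ 2) - p * log g - log (1 + g ^ 2)) * n
          + w * pairSlope g - p * log g) := by
  have hγ0 : 0 < γ := by rw [hγ]; positivity
  have hp0 : 0 < p := by rw [hp]; positivity
  have hq : 1 - p = 1 / (1 + g ^ 2) := by rw [hp]; field_simp; ring
  have hq0 : 0 < 1 - p := by rw [hq]; positivity
  have he0 : 0 < 1 - g + g ^ 2 := by nlinarith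
  have he1 : log (1 - g + g ^ 2) ≤ 0 := log_nonpos he0.le (by nlinarith)
  have hlg : log g ≤ 0 := log_nonpos hg0.le hg1.le
  have ht1 : (t : ℝ) ≤ (((n - w : ℕ) : ℝ) + 1) * p := by
    rw [ht]; exact Nat.floor_le (by positivity)
  have hnw : ((n - w : ℕ) : ℝ) = n - w := Nat.cast_sub (by omega)
  have htn : t ≤ n - w := by
    have h2 : (((n - w : ℕ) : ℝ) + 1) * p < ((n - w : ℕ) : ℝ) + 1 :=
      mul_lt_of_lt_one_right (by positivity) (by linarith)
    have h3 : (t : ℝ) < ((n - w + 1 : ℕ) : ℝ) := by push_cast; linarith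
    exact Nat.lt_succ_iff.1 (by exact_mod_cast h3)
  have f1 := two_pow_le_mul_choose_half w
  rw [Nat.choose_symm_of_eq_add (show w = w / 2 + k by omega)] at f1
  have f2 := binomial_mode_ge (N := n - w) hp0 (by linarith)
  rw [← ht, div_le_iff₀ (by positivity), mul_assoc (Nat.cast _)] at f2
  have e3 : p ^ t * (1 - p) ^ (n - w - t) = g ^ (2 * t) / (1 + g ^ 2) ^ (n - w) := by
    have : (1 + g ^ 2) ^ (n - w) = (1 + g ^ 2) ^ t * (1 + g ^ 2) ^ (n - w - t) := by
      rw [← pow_add]; congr 1; omega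
    rw [hq, hp, div_pow, div_pow, this, ← pow_mul, one_pow]
    field_simp
  rw [e3] at f2
  have hw1 : (w : ℝ) ≤ n := by exact_mod_cast (by omega : w ≤ n)
  have hw2 : ((n - w : ℕ) : ℝ) + 1 ≤ n + 1 := by
    have : (0 : ℝ) ≤ w := Nat.cast_nonneg w
    linarith
  set D := (1 + g ^ 2) ^ (n - w) with hD
  have hD0 : 0 < D := by positivity
  have f3 : 2 ^ w * D ≤ ((n : ℝ) + 1) ^ 2 * (w.choose k * (n - w).choose t : ℕ) * g ^ (2 * t) := by
    have a1 : (2 : ℝ) ^ w ≤ (n + 1) * w.choose k := f1.trans (by gcongr)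
    have a2 : D ≤ (n - w).choose t * g ^ (2 * t) * (n + 1) := by
      have : 1 * D ≤ (n - w).choose t * (g ^ (2 * t) / D) * (((n - w : ℕ) : ℝ) + 1) * D := by gcongr
      calc D = 1 * D := (one_mul _).symm
        _ ≤ _ := this
        _ = (n - w).choose t * g ^ (2 * t) * (((n - w : ℕ) : ℝ) + 1) := by field_simp
        _ ≤ _ := by gcongr
    calc _ ≤ ((n + 1) * (w.choose k : ℝ)) * ((n - w).choose t * g ^ (2 * t) * (n + 1)) := by gcongr
      _ = _ := by push_cast; ring
  have f4 : (1 + g) ^ n * (1 - g + g ^ 2) ^ (n - w - w / 2) / (g ^ t * γ ^ w * 2 ^ w * D) ≤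
      exp ((log (1 + g) + log (1 - g + g ^ 2) - p * log g - log (1 + g ^ 2)) * n
          + w * pairSlope g - p * log g) := by
    have hL : ∀ x : ℝ, 0 < x → ∀ m : ℕ, x ^ m = exp (m * log x) := fun x hx m => by
      rw [exp_nat_mul, exp_log hx]
    rw [hD, hL (1 + g) (by positivity) n, hL _ he0 (n - w - w / 2), hL g hg0 t, hL γ hγ0 w,
      hL 2 (by norm_num) w, hL (1 + g ^ 2) (by positivity) (n - w), ← exp_add, ← exp_add, ← exp_add, ← exp_add,
      ← exp_sub]
    apply exp_le_exp.2
    have hlγ : log γ = log 2 + log g - log (1 + g ^ 2) := by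
      rw [hγ, log_div (by positivity) (by positivity), log_mul (by norm_num) hg0.ne']
    have hc1 : ((n - w - w / 2 : ℕ) : ℝ) = n - w - ((w / 2 : ℕ) : ℝ) := by
      rw [Nat.cast_sub (by omega), hnw]
    have hc2 : ((w / 2 : ℕ) : ℝ) ≤ w / 2 := Nat.cast_div_le
    have g1 : ((n - w - w / 2 : ℕ) : ℝ) * log (1 - g + g ^ 2) ≤ (n - 3 / 2 * w) * log (1 - g + g ^ 2) :=
      mul_le_mul_of_nonpos_right (by rw [hc1]; linarith) he1
    have g2 := mul_le_mul_of_nonpos_right ht1 hlg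
    rw [hnw] at g2 ⊢
    have hps : pairSlope g = 2 * log (1 + g ^ 2) - 2 * log 2 - log g
        - 3 / 2 * log (1 - g + g ^ 2) + p * log g := by rw [pairSlope, hp]
    rw [hlγ, hps]
    linarith
  calc (1 + g) ^ n * (1 - g + g ^ 2) ^ (n - w - w / 2) / g ^ (3 * t) / γ ^ w
      = 2 ^ w * D * ((1 + g) ^ n * (1 - g + g ^ 2) ^ (n - w - w / 2) / (g ^ t * γ ^ w * 2 ^ w * D))
        / g ^ (2 * t) := by
        have : g ^ (3 * t) = g ^ t * g ^ (2 * t) := by rw [← pow_add]; congr 1; omega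
        rw [this]; field_simp
    _ ≤ (((n : ℝ) + 1) ^ 2 * (w.choose k * (n - w).choose t : ℕ) * g ^ (2 * t)) *
        exp ((log (1 + g) + log (1 - g + g ^ 2) - p * log g - log (1 + g ^ 2)) * n
          + w * pairSlope g - p * log g) / g ^ (2 * t) := by gcongr
    _ = _ := by field_simp

theorem tauCrit_spec {g d : ℝ} (h0 : 0 < g) (h1 : g < 1) (hd : d = 2 * g / (1 + g) ^ 2) :
    0 < d ∧ d < 1 / 2 ∧ 0 < tauCrit g ∧ tauCrit g < 1 / 2 ∧
      2 * √(tauCrit g * (1 - tauCrit g)) = 1 - 2 * d ∧ 1 - 2 * tauCrit g = 2 * √(d * (1 - d)) := by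
  have hd0 : 0 < d := by rw [hd]; positivity
  have hd1 : d < 1 / 2 := by
    rw [hd, div_lt_div_iff₀ (by positivity) (by norm_num)]
    nlinarith [mul_pos (sub_pos.2 h1) (sub_pos.2 h1)]
  have hτ := tauCrit_eq h0 h1
  rw [← hd] at hτ
  set u := √(1 - (1 - 2 * d) ^ 2) with hu
  have hu2 : u ^ 2 = 1 - (1 - 2 * d) ^ 2 := sq_sqrt (by nlinarith)
  have hu0 : 0 < u := sqrt_pos.2 (by nlinarith)
  have hu1 : u < 1 := by nlinarith
  refine ⟨hd0, hd1, by linarith, by linarith, ?_, ?_⟩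
  · have : tauCrit g * (1 - tauCrit g) = ((1 - 2 * d) / 2) ^ 2 := by rw [hτ]; linarith
    rw [this, sqrt_sq (by linarith)]; ring
  · have : d * (1 - d) = (u / 2) ^ 2 := by linarith
    rw [this, sqrt_sq (by linarith), hτ]; ring

theorem sum_pow_lt_of_degree_lt {α : Type*} [DecidableEq α] {n W : ℕ} {γ T : ℝ} (hγ : 0 < γ)
    (s : Finset α) (c : α → Fin n → ZMod 2)
    (h : ∀ i ∈ s, ∀ l ≤ W,
      ((s.filter fun j => j ≠ i ∧ hammingDist (c j) (c i) = l).card : ℝ) ≤ T / γ ^ l) :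
    ∑ i ∈ s, ∑ j ∈ s with j ≠ i ∧ hammingDist (c j) (c i) ≤ W, γ ^ hammingDist (c j) (c i) ≤
      s.card * ((W + 1) * T) := by
  rw [← nsmul_eq_mul]
  refine Finset.sum_le_card_nsmul _ _ _ fun i hi => ?_
  have e := Finset.sum_fiberwise_of_maps_to
    (s := s.filter fun j => j ≠ i ∧ hammingDist (c j) (c i) ≤ W) (t := Finset.range (W + 1))
    (g := fun j => hammingDist (c j) (c i))
    (fun j hj => by
      have := (Finset.mem_filter.1 hj).2.2
      exact Finset.mem_range.2 (by omega)) (fun j => γ ^ hammingDist (c j) (c i))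
  rw [← e]
  have : ∀ l ∈ Finset.range (W + 1), ∑ j ∈ s.filter (fun j => j ≠ i ∧ hammingDist (c j) (c i) ≤ W)
      with hammingDist (c j) (c i) = l, γ ^ hammingDist (c j) (c i) ≤ T := by
    intro l hl
    have hl := Finset.mem_range.1 hl
    have e1 : (s.filter fun j => j ≠ i ∧ hammingDist (c j) (c i) ≤ W).filter
        (fun j => hammingDist (c j) (c i) = l)
        = s.filter fun j => j ≠ i ∧ hammingDist (c j) (c i) = l := by
      ext j
      simp only [Finset.mem_filter]
      constructor
      · rintro ⟨⟨a, b, -⟩, d⟩; exact ⟨a, b, d⟩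
      · rintro ⟨a, b, d⟩; exact ⟨⟨a, b, by omega⟩, d⟩
    rw [e1, Finset.sum_congr rfl (g := fun _ => γ ^ l)
      (fun j hj => by rw [(Finset.mem_filter.1 hj).2.2]), Finset.sum_const, nsmul_eq_mul]
    exact (le_div_iff₀ (by positivity)).1 (h i hi l (by omega))
  have h3 := Finset.sum_le_card_nsmul _ _ _ this
  rw [Finset.card_range, nsmul_eq_mul] at h3
  exact_mod_cast h3

theorem exists_large_degree {n W : ℕ} {γ θ : ℝ} (hγ : 0 < γ) (hθ : 0 < θ) (hW : W ≤ n)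
    {α : Type*} [DecidableEq α] (s : Finset α) (c : α → Fin n → ZMod 2) (hs : 0 < s.card)
    (h : (s.card : ℝ) ^ 2 * θ ≤ (2 / (1 + γ)) ^ n *
      ∑ i ∈ s, ∑ j ∈ s with j ≠ i ∧ hammingDist (c j) (c i) ≤ W, γ ^ hammingDist (c j) (c i)) :
    ∃ l ≤ W, ∃ i ∈ s, s.card * θ * ((1 + γ) / 2) ^ n / (2 * (n + 1)) / γ ^ l ≤
      ((s.filter fun j => j ≠ i ∧ hammingDist (c j) (c i) = l).card : ℝ) := by
  by_contra hcon
  push Not at hcon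
  have hs' : (0 : ℝ) < s.card := by exact_mod_cast hs
  have h1 := sum_pow_lt_of_degree_lt hγ s c (W := W) fun i hi l hl => (hcon l hl i hi).le
  have h2 := h.trans (mul_le_mul_of_nonneg_left h1 (by positivity))
  have hWn : (W : ℝ) ≤ n := by exact_mod_cast hW
  have e : (2 / (1 + γ)) ^ n * (s.card * ((W + 1) *
      (s.card * θ * ((1 + γ) / 2) ^ n / (2 * (n + 1))))) =
      s.card ^ 2 * θ * ((W + 1) / (2 * (n + 1))) := by
    have : (2 / (1 + γ)) ^ n * ((1 + γ) / 2) ^ n = 1 := by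
      rw [← mul_pow]; convert one_pow n; field_simp
    calc _ = (2 / (1 + γ)) ^ n * ((1 + γ) / 2) ^ n * (s.card ^ 2 * θ * ((W + 1) / (2 * (n + 1)))) := by
          ring
      _ = _ := by rw [this, one_mul]
  rw [e] at h2
  have h3 : ((W : ℝ) + 1) / (2 * (n + 1)) < 1 := by
    rw [div_lt_one (by positivity)]; linarith
  have h4 := mul_lt_mul_of_pos_left h3 (by positivity : 0 < (s.card : ℝ) ^ 2 * θ)
  linarith

theorem exists_minimal_large_degree {n W : ℕ} {γ T : ℝ} {α : Type*} [DecidableEq α] {s : Finset α}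
    {c : α → Fin n → ZMod 2} (h : ∃ l ≤ W, ∃ i ∈ s, T / γ ^ l ≤
      ((s.filter fun j => j ≠ i ∧ hammingDist (c j) (c i) = l).card : ℝ)) :
    ∃ w ≤ W, ∃ i ∈ s, T / γ ^ w ≤
      ((s.filter fun j => j ≠ i ∧ hammingDist (c j) (c i) = w).card : ℝ) ∧
      ∀ j ∈ s, ∀ l < w,
        ((s.filter fun j' => j' ≠ j ∧ hammingDist (c j') (c j) = l).card : ℝ) ≤ T / γ ^ l := by
  classical
  have h' : ∃ l, ∃ i ∈ s, T / γ ^ l ≤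
      ((s.filter fun j => j ≠ i ∧ hammingDist (c j) (c i) = l).card : ℝ) := by
    obtain ⟨l, -, h⟩ := h
    exact ⟨l, h⟩
  obtain ⟨i, hi, hdeg⟩ := Nat.find_spec h'
  refine ⟨Nat.find h', ?_, i, hi, hdeg, fun j hj l hl => ?_⟩
  · obtain ⟨l, hl, h⟩ := h
    exact (Nat.find_min' h' h).trans hl
  · have := Nat.find_min h' hl
    push Not at this
    exact (this j hj).le

theorem mul_exp_le_of_growth {r L₀ S κ η d A a : ℝ} {n w : ℕ} {T V Q Y G : ℝ} (hS : 0 ≤ S)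
    (hκS : κ * S ≤ η / 8) (hw : (w : ℝ) ≤ (d + κ) * n) (hV : V ^ n = exp (L₀ * n)) (hQ0 : 0 ≤ Q)
    (hT0 : 0 ≤ T) (hT : T ≤ exp (r * n) * V ^ n) (hY : 0 ≤ Y) (hG : 0 < G)
    (hQ : Q / G ≤ ((n : ℝ) + 1) ^ 2 * Y * exp (A * n + w * S - a))
    (hcorner : r + L₀ + A + d * S ≤ 0)
    (hn : exp (-a) * ((n : ℝ) + 2) ^ 3 ≤ exp (η / 8 * n)) :
    ((n : ℝ) + 1) * (T / G * Q) ≤ exp (η / 4 * n) * Y := by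
  have hn0 : (0 : ℝ) ≤ n := Nat.cast_nonneg n
  have hwd : (w : ℝ) * S ≤ (d + κ) * n * S := by gcongr
  have a1 := mul_le_mul_of_nonneg_right hcorner hn0
  have a2 := mul_le_mul_of_nonneg_right hκS hn0
  calc ((n : ℝ) + 1) * (T / G * Q) = (n + 1) * (T * (Q / G)) := by ring
    _ ≤ (n + 1) * ((exp (r * n) * V ^ n) * ((n + 1) ^ 2 * Y * exp (A * n + w * S - a))) := by
      have := hT0.trans hT
      gcongr
    _ = (n + 1) ^ 3 * exp (r * n + L₀ * n + (A * n + w * S - a)) * Y := by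
      rw [hV, exp_add, exp_add]; ring
    _ ≤ (n + 2) ^ 3 * exp (-a + η / 8 * n) * Y := by
      have h1 : r * n + L₀ * n + (A * n + w * S - a) ≤ -a + η / 8 * n := by linarith
      have h2 : (n : ℝ) + 1 ≤ n + 2 := by linarith
      gcongr
    _ = exp (-a) * (n + 2) ^ 3 * exp (η / 8 * n) * Y := by rw [exp_add]; ring
    _ ≤ exp (η / 8 * n) * exp (η / 8 * n) * Y := by gcongr
    _ = exp (η / 4 * n) * Y := by rw [← exp_add]; congr 2; ring

theorem exp_mul_le_div_of_growth {r η κ ε m g v : ℝ} {n : ℕ} (hg : 0 < g) (hη : 0 < η)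
    (hκ : κ ≤ η / 4) (hε : ε ≤ η / 4) (hv : 0 ≤ v) (hm : exp ((r - ε) * n) ≤ m)
    (hn : 4 / g * ((n : ℝ) + 2) ^ 3 ≤ exp (η / 4 * n)) :
    exp ((r - η) * n) * v ≤
      m * exp (-κ * n) * v / (2 * (n + 1)) * g / ((n + 1) ^ 2 * (1 + exp (η / 4 * n))) := by
  have hB1 : 1 ≤ exp (η / 4 * n) := one_le_exp (by positivity)
  rw [le_div_iff₀ (by positivity)]
  have e1 : exp ((r - η) * n) = exp ((r - η / 4) * n) * exp (-κ * n) * exp (-(η / 4) * n) *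
      exp ((κ - η / 2) * n) := by
    rw [← exp_add, ← exp_add, ← exp_add]; congr 1; ring
  have e2 : exp ((κ - η / 2) * n) ≤ exp (-(η / 4) * n) := exp_mul_le_of_natCast (by linarith) n
  have e3 : exp (-(η / 4) * n) * exp (η / 4 * n) = 1 := by
    rw [← exp_add, neg_mul, neg_add_cancel, exp_zero]
  have e4 : exp ((r - η / 4) * n) ≤ m := (exp_mul_le_of_natCast (by linarith) n).trans hm
  have hm0 : 0 < m := (exp_pos _).trans_le hm
  have e5 : (n + 1 : ℝ) ^ 3 * 4 * exp (-(η / 4) * n) ≤ g := by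
    have : (n + 1 : ℝ) ^ 3 ≤ (n + 2) ^ 3 := by gcongr; norm_num
    have a : 4 / g * (n + 1 : ℝ) ^ 3 ≤ exp (η / 4 * n) := by
      refine le_trans ?_ hn
      gcongr
    rw [div_mul_eq_mul_div, div_le_iff₀ hg] at a
    calc (n + 1 : ℝ) ^ 3 * 4 * exp (-(η / 4) * n) = 4 * (n + 1) ^ 3 * exp (-(η / 4) * n) := by ring
      _ ≤ exp (η / 4 * n) * g * exp (-(η / 4) * n) := by gcongr
      _ = g * (exp (-(η / 4) * n) * exp (η / 4 * n)) := by ring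
      _ = g := by rw [e3, mul_one]
  set X := exp (-(η / 4) * n)
  set Z := exp (η / 4 * n)
  set θ := exp (-κ * n)
  have hX : 0 < X := exp_pos _
  have hZ : 0 < Z := exp_pos _
  have hθ : 0 < θ := exp_pos _
  calc exp ((r - η) * n) * v * ((n + 1) ^ 2 * (1 + Z))
      ≤ (m * θ * X * X) * v * ((n + 1) ^ 2 * (Z + Z)) := by rw [e1]; gcongr
    _ = m * θ * v / (2 * (n + 1)) * ((n + 1) ^ 3 * 4 * X) * (X * Z) := by field_simp; ring
    _ ≤ m * θ * v / (2 * (n + 1)) * g * (X * Z) := by gcongr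
    _ = _ := by rw [e3, mul_one]

set_option maxHeartbeats 1000000 in
theorem exists_errProb_ge {g p η : ℝ} (hg0 : 0 < g) (hg1 : g < 1) (hc : chalf g ≤ 2.387025)
    (hp : p = g ^ 2 / (1 + g ^ 2)) (hη : 0 < η) :
    ∃ ε > 0, ∀ᶠ n : ℕ in atTop, ∀ {α : Type} [DecidableEq α] (s : Finset α)
      (c : α → Fin n → ZMod 2), exp ((binEntropy (tauCrit g) - ε) * n) ≤ s.card →
      (s.card : ℝ) ≤ 2 * exp (binEntropy (tauCrit g) * n) →
      ∃ i ∈ s, exp ((binEntropy (tauCrit g) - η) * n) * ((1 + g) ^ 2 / (2 * (1 + g ^ 2))) ^ n ≤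
        errProb p s c i := by
  obtain ⟨hd0, hd1, hτ0, hτ1, hτd, hdτ⟩ := tauCrit_spec hg0 hg1 rfl
  have hslope := pairSlope_nonneg hg0 hg1 hc
  have hcorner := corner_exponent_nonpos hg0 hg1 hc
  rw [← hp] at hcorner
  set d := 2 * g / (1 + g) ^ 2 with hd
  set r := binEntropy (tauCrit g) with hr
  set S := pairSlope g with hS
  have hN : 0 < 1 + g ^ 2 := by positivity
  have he0 : 0 < 1 - g + g ^ 2 := by nlinarith
  obtain ⟨κ, hκ0, hκ1, hκS⟩ : ∃ κ > 0, κ ≤ η / 4 ∧ κ * S ≤ η / 8 := by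
    refine ⟨min (η / 4) (η / (8 * (S + 1))), lt_min (by positivity) (by positivity),
      min_le_left _ _, ?_⟩
    have : min (η / 4) (η / (8 * (S + 1))) * S ≤ η / (8 * (S + 1)) * (S + 1) := by
      gcongr
      · exact min_le_right _ _
      · linarith
    calc _ ≤ _ := this
      _ = η / 8 := by field_simp
  obtain ⟨ε₀, hε₀, hLP⟩ := exists_pairs_lower_bound hd0 hd1 hτ0 hτ1 hτd hdτ hκ0
  refine ⟨min ε₀ (η / 4), lt_min hε₀ (by positivity), ?_⟩
  set γ := 2 * g / (1 + g ^ 2) with hγ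
  have hγ0 : 0 < γ := by positivity
  have hdγ : d / (1 - d) = γ := by
    have : 1 - d = (1 + g ^ 2) / (1 + g) ^ 2 := by rw [hd]; field_simp; ring
    rw [this, hd, hγ]; field_simp
  have h2d : 2 * (1 - d) = 2 / (1 + γ) := by
    rw [← hdγ]
    have : (1 - d) ≠ 0 := by linarith
    field_simp; ring
  have hV : (1 + g) ^ 2 / (2 * (1 + g ^ 2)) = (1 + γ) / 2 := by
    rw [hγ]; field_simp; ring
  rw [hV]
  set V := (1 + γ) / 2 with hVdef
  have hV0 : 0 < V := by positivity
  have hlV : log V = 2 * log (1 + g) - log 2 - log (1 + g ^ 2) := by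
    rw [← hV, log_div (by positivity) (by positivity), log_pow, log_mul (by norm_num) hN.ne']
    push_cast; ring
  filter_upwards [hLP, eventually_mul_pow_le_exp (exp (-(p * log g))) 3 (c := η / 8) (by positivity),
    eventually_mul_pow_le_exp (4 / g) 3 (c := η / 4) (by positivity)] with n hn hn1 hn2
  obtain ⟨W, hW1, hW2, hpairs⟩ := hn
  intro α _ s c hs1 hs2
  have hs0 : (0 : ℝ) < s.card := (exp_pos _).trans_le hs1
  have hsc : 0 < s.card := by exact_mod_cast hs0
  have hLPs := hpairs s c ((exp_mul_le_of_natCast (by linarith [min_le_left ε₀ (η / 4)]) n).trans hs1)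
  rw [hdγ, h2d] at hLPs
  have hex := exists_minimal_large_degree
    (exists_large_degree hγ0 (exp_pos _) (by omega : W ≤ n) s c hsc hLPs)
  obtain ⟨T, hT⟩ : ∃ T, T = s.card * exp (-κ * n) * V ^ n / (2 * (n + 1)) := ⟨_, rfl⟩
  rw [← hT] at hex
  have hT0 : 0 < T := by rw [hT]; positivity
  obtain ⟨w, hwW, i, his, hdeg, hmin⟩ := hex
  obtain ⟨N, hNsub, hNcard⟩ := Finset.exists_subset_card_eq (Nat.ceil_le.2 hdeg)
  refine ⟨i, his, ?_⟩
  have hNs : N ⊆ s := hNsub.trans (Finset.filter_subset _ _)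
  have hTw : 0 ≤ T / γ ^ w := div_nonneg hT0.le (pow_pos hγ0 w).le
  have hlow : ∀ j ∈ N, ∀ l < w,
      ((N.filter fun j' => j' ≠ j ∧ hammingDist (c j') (c j) = l).card : ℝ) ≤ T / γ ^ l := by
    intro j hj l hl
    refine le_trans ?_ (hmin j (hNs hj) l hl)
    exact_mod_cast Finset.card_le_card (Finset.filter_subset_filter _ hNs)
  have hk : w / 2 + (w - w / 2) = w := by omega
  have hwn : w + w / 2 ≤ n := by omega
  have hTle : T ≤ exp (r * n) * V ^ n := by
    rw [hT, div_le_iff₀ (by positivity)]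
    have : exp (-κ * n) ≤ 1 := exp_le_one_iff.2 (by
      have : 0 ≤ κ * (n : ℝ) := by positivity
      linarith)
    calc (s.card : ℝ) * exp (-κ * n) * V ^ n ≤ 2 * exp (r * n) * 1 * V ^ n := by gcongr
      _ = exp (r * n) * V ^ n * (2 * (0 + 1)) := by ring
      _ ≤ exp (r * n) * V ^ n * (2 * (n + 1)) := by gcongr; positivity
  have hVn : V ^ n = exp (log V * n) := by rw [mul_comm, exp_nat_mul, exp_log hV0]
  have hB := errProb_ge_of_regular (B := exp (η / 4 * n)) hg0 hg1 hγ hp hT0.le (exp_pos _).le hNs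
    (fun h => (Finset.mem_filter.1 (hNsub h)).2.1 rfl)
    (fun j hj => (Finset.mem_filter.1 (hNsub hj)).2.2) hk hwn rfl hlow
    (by rw [hNcard, sub_le_iff_le_add]; exact (Nat.ceil_lt_add_one hTw).le)
    (by rw [hNcard]; exact Nat.le_ceil _)
    (mul_exp_le_of_growth hslope hκS (le_trans (Nat.cast_le.2 hwW) hW1) hVn (div_nonneg
      (mul_nonneg (by positivity) (pow_nonneg he0.le _)) (by positivity)) hT0.le hTle
      (Nat.cast_nonneg _) (pow_pos hγ0 w) (pow_div_le_mul_choose hg0 hg1 hγ hp hk hwn rfl)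
      (by rw [hlV]; linarith) hn1)
  rw [hT] at hB
  exact (exp_mul_le_div_of_growth hg0 hη hκ1 (min_le_right _ _) (by positivity) hs1 hn2).trans hB

theorem sum_errProb_ge {g p η : ℝ} (hg0 : 0 < g) (hg1 : g < 1) (hc : chalf g ≤ 2.387025)
    (hp : p = g ^ 2 / (1 + g ^ 2)) (hη : 0 < η) :
    ∃ ε > 0, ∀ᶠ n : ℕ in atTop, ∀ {α : Type} [DecidableEq α] (s : Finset α)
      (c : α → Fin n → ZMod 2), 2 * exp ((binEntropy (tauCrit g) - ε) * n) + 2 ≤ s.card →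
      s.card / 2 * (exp ((binEntropy (tauCrit g) - η) * n) *
        ((1 + g) ^ 2 / (2 * (1 + g ^ 2))) ^ n) ≤ ∑ i ∈ s, errProb p s c i := by
  obtain ⟨ε, hε, h⟩ := exists_errProb_ge hg0 hg1 hc hp hη
  refine ⟨ε, hε, ?_⟩
  filter_upwards [h] with n hn
  intro α _ s c hs
  obtain ⟨-, -, hτ0, hτ1, -, -⟩ := tauCrit_spec hg0 hg1 rfl
  have hr : 0 < binEntropy (tauCrit g) := binEntropy_pos hτ0 (by linarith)
  set r := binEntropy (tauCrit g)
  set E := exp ((r - η) * n) * ((1 + g) ^ 2 / (2 * (1 + g ^ 2))) ^ n with hE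
  have hE0 : 0 ≤ E := by positivity
  have hp0 : 0 ≤ p := by rw [hp]; positivity
  have hp1 : p ≤ 1 := by rw [hp, div_le_one (by positivity)]; linarith
  set X := exp ((r - ε) * n) with hX
  have hX1 : X ≤ exp (r * n) := exp_mul_le_of_natCast (by linarith) n
  have hR1 : 1 ≤ exp (r * n) := one_le_exp (by positivity)
  have hK1 := Nat.ceil_lt_add_one (exp_pos ((r - ε) * n)).le
  rw [← hX] at hK1
  have hbad : (s.filter fun i => ¬ E ≤ errProb p s c i).card < ⌈X⌉₊ := by
    by_contra hcon
    push Not at hcon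
    obtain ⟨s', hs', hcard⟩ := Finset.exists_subset_card_eq hcon
    obtain ⟨i, hi, hiE⟩ := hn s' c (by rw [hcard]; exact Nat.le_ceil _) (by rw [hcard]; linarith)
    have h1 := (Finset.mem_filter.1 (hs' hi)).2
    exact h1.not_ge (hiE.trans (errProb_mono hp0 hp1 (hs'.trans (Finset.filter_subset _ _)) c i))
  have hsplit := Finset.card_filter_add_card_filter_not (s := s) (fun i => E ≤ errProb p s c i)
  have hbad' : ((s.filter fun i => ¬ E ≤ errProb p s c i).card : ℝ) ≤ s.card / 2 := by
    have : ((s.filter fun i => ¬ E ≤ errProb p s c i).card : ℝ) ≤ ⌈X⌉₊ := by exact_mod_cast hbad.le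
    linarith
  have hgood : (s.card : ℝ) / 2 ≤ (s.filter fun i => E ≤ errProb p s c i).card := by
    have : ((s.filter fun i => E ≤ errProb p s c i).card : ℝ) +
      (s.filter fun i => ¬ E ≤ errProb p s c i).card = s.card := by exact_mod_cast hsplit
    linarith
  calc (s.card : ℝ) / 2 * E ≤ (s.filter fun i => E ≤ errProb p s c i).card * E := by gcongr
    _ ≤ ∑ i ∈ s.filter fun i => E ≤ errProb p s c i, errProb p s c i := by
      rw [← nsmul_eq_mul]
      exact Finset.card_nsmul_le_sum _ _ _ fun i hi => (Finset.mem_filter.1 hi).2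
    _ ≤ _ := Finset.sum_le_sum_of_subset_of_nonneg (Finset.filter_subset _ _)
      fun i _ _ => errProb_nonneg hp0 hp1 s c i

theorem hammingDist_fin_append {m k : ℕ} (x : Fin (m + k) → ZMod 2) (u : Fin m → ZMod 2)
    (v : Fin k → ZMod 2) : hammingDist x (Fin.append u v) =
      hammingDist (fun a => x (Fin.castAdd k a)) u + hammingDist (fun a => x (Fin.natAdd m a)) v := by
  simp only [hammingDist, Finset.card_filter, Fin.sum_univ_add, Fin.append_left, Fin.append_right]

theorem sum_errProb_list_le {α : Type*} [DecidableEq α] {m k r : ℕ} {p : ℝ} (hp0 : 0 ≤ p)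
    (hp1 : p ≤ 1) (hr : r ≤ k) (s : Finset α) (c : α → Fin (m + k) → ZMod 2) :
    p ^ r * (1 - p) ^ (k - r) * ∑ v : Fin k → ZMod 2,
      ∑ i ∈ s.filter (fun i => hammingDist (fun a => c i (Fin.natAdd m a)) v = r),
        errProb p (s.filter fun i => hammingDist (fun a => c i (Fin.natAdd m a)) v = r)
          (fun i a => c i (Fin.castAdd k a)) i ≤ ∑ i ∈ s, errProb p s c i := by
  have hq : 0 ≤ 1 - p := by linarith
  have key : ∀ i, errProb p s c i = ∑ v : Fin k → ZMod 2, ∑ u : Fin m → ZMod 2,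
      if ∃ j ∈ s, j ≠ i ∧ hammingDist (c j) (Fin.append u v) ≤ hammingDist (c i) (Fin.append u v)
      then p ^ hammingDist (c i) (Fin.append u v) *
        (1 - p) ^ (m + k - hammingDist (c i) (Fin.append u v)) else 0 := by
    intro i
    rw [errProb, Px, Finset.sum_filter, ← (Fin.appendEquiv m k).sum_comp, Fintype.sum_prod_type_right]
    rfl
  simp_rw [Finset.sum_filter]
  rw [Finset.sum_comm, Finset.mul_sum]
  refine Finset.sum_le_sum fun i hi => ?_
  rw [key, Finset.mul_sum]
  refine Finset.sum_le_sum fun v _ => ?_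
  split_ifs with hv
  · rw [errProb, Px, Finset.sum_filter, Finset.mul_sum]
    refine Finset.sum_le_sum fun u _ => ?_
    split_ifs with h1 h2 h2
    · rw [hammingDist_fin_append, hv]
      have hle : hammingDist (fun a => c i (Fin.castAdd k a)) u ≤ m := by
        simpa using hammingDist_le_card_fintype (x := fun a => c i (Fin.castAdd k a)) (y := u)
      have : m + k - (hammingDist (fun a => c i (Fin.castAdd k a)) u + r) =
        (m - hammingDist (fun a => c i (Fin.castAdd k a)) u) + (k - r) := by omega
      rw [this, pow_add, pow_add]
      exact le_of_eq (by ring)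
    · exfalso
      obtain ⟨j, hj, hji, hd⟩ := h1
      refine h2 ⟨j, (Finset.mem_filter.1 hj).1, hji, ?_⟩
      rw [hammingDist_fin_append, hammingDist_fin_append, hv, (Finset.mem_filter.1 hj).2]
      omega
    · rw [mul_zero]; positivity
    · rw [mul_zero]
  · rw [mul_zero]
    exact Finset.sum_nonneg fun u _ => by split_ifs <;> positivity

theorem card_hammingDist_eq {k : ℕ} (x : Fin k → ZMod 2) (r : ℕ) :
    (Finset.univ.filter fun v => hammingDist x v = r).card = k.choose r := by
  have e : (Finset.powersetCard r (Finset.univ : Finset (Fin k))).card = k.choose r := by simp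
  rw [← e]
  symm
  refine Finset.card_bij (fun z _ => flipWord x z) (fun z hz => ?_)
    (fun z _ z' _ h => flipWord_injective x h) (fun v hv => ?_)
  · have hz := (Finset.mem_powersetCard.1 hz).2
    have := congrArg Finset.card (diffSet_flipWord x x z)
    rw [diffSet_self, ← Finset.bot_eq_empty, bot_symmDiff] at this
    rw [Finset.mem_filter, ← card_diffSet, this]
    simpa using hz
  · refine ⟨diffSet x v, ?_, ?_⟩
    · exact Finset.mem_powersetCard.2 ⟨Finset.subset_univ _, (Finset.mem_filter.1 hv).2⟩
    · ext a
      have h : ∀ a b : ZMod 2, a ≠ b → a + 1 = b := by decide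
      simp only [flipWord, mem_diffSet]
      split_ifs with hx
      · exact h _ _ hx
      · exact not_not.1 hx

theorem sum_errProb_ge_of_list {α : Type*} [DecidableEq α] {m k r : ℕ} {p E : ℝ} (hp0 : 0 ≤ p)
    (hp1 : p ≤ 1) (hr : r ≤ k) (hE : 0 ≤ E) (s : Finset α) (c : α → Fin (m + k) → ZMod 2)
    (h : ∀ (t : Finset α) (c' : α → Fin m → ZMod 2),
      (s.card : ℝ) * k.choose r / (2 * 2 ^ k) ≤ t.card →
        t.card / 2 * E ≤ ∑ i ∈ t, errProb p t c' i) :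
    p ^ r * (1 - p) ^ (k - r) * k.choose r * E / 4 * s.card ≤ ∑ i ∈ s, errProb p s c i := by
  have hq : 0 ≤ 1 - p := by linarith
  refine le_trans ?_ (sum_errProb_list_le hp0 hp1 hr s c)
  set L : (Fin k → ZMod 2) → Finset α := fun v =>
    s.filter fun i => hammingDist (fun a => c i (Fin.natAdd m a)) v = r with hL
  set A : ℝ := s.card * k.choose r / (2 * 2 ^ k) with hA
  have hsum : ∑ v, ((L v).card : ℝ) = s.card * k.choose r := by
    have : ∑ v, (L v).card = s.card * k.choose r := by
      simp only [hL, Finset.card_filter]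
      rw [Finset.sum_comm, ← smul_eq_mul, ← Finset.sum_const]
      refine Finset.sum_congr rfl fun i _ => ?_
      rw [← Finset.card_filter, card_hammingDist_eq]
    exact_mod_cast this
  have hv : ∀ v, ((L v).card - A) / 2 * E ≤
      ∑ i ∈ L v, errProb p (L v) (fun i a => c i (Fin.castAdd k a)) i := by
    intro v
    by_cases hv : A ≤ (L v).card
    · refine le_trans ?_ (h (L v) _ hv)
      have : 0 ≤ A := by positivity
      gcongr
      linarith
    · refine le_trans ?_ (Finset.sum_nonneg fun i _ => errProb_nonneg hp0 hp1 _ _ i)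
      exact mul_nonpos_of_nonpos_of_nonneg (by linarith [not_le.1 hv]) hE
  have hcardv : ∑ _v : Fin k → ZMod 2, A = s.card * k.choose r / 2 := by
    rw [Finset.sum_const, Finset.card_univ, Fintype.card_fun, ZMod.card, Fintype.card_fin,
      nsmul_eq_mul, hA]
    push_cast
    field_simp
  calc p ^ r * (1 - p) ^ (k - r) * k.choose r * E / 4 * s.card
      = p ^ r * (1 - p) ^ (k - r) * ∑ v, ((L v).card - A) / 2 * E := by
        rw [← Finset.sum_mul, ← Finset.sum_div, Finset.sum_sub_distrib, hsum, hcardv]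
        ring
    _ ≤ _ := by
        gcongr with v
        exact hv v

theorem pow_mul_pow_div_one_add {a : ℝ} (ha : 0 < a) {r k : ℕ} (hr : r ≤ k) :
    (a / (1 + a)) ^ r * (1 - a / (1 + a)) ^ (k - r) = a ^ r / (1 + a) ^ k := by
  have h1 : 1 - a / (1 + a) = 1 / (1 + a) := by field_simp; ring
  have h2 : (1 + a) ^ k = (1 + a) ^ r * (1 + a) ^ (k - r) := by
    rw [← pow_add]; congr 1; omega
  rw [h1, div_pow, div_pow, h2, one_pow]
  field_simp

theorem choose_floor_bounds {g : ℝ} (hg0 : 0 < g) (hg1 : g < 1) (k : ℕ) :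
    ∃ r ≤ k, exp (k * (log (1 + g) - g / (1 + g) * log g) + log g) ≤ (k + 1) * k.choose r ∧
      exp (k * (log (1 + g) - log (1 + g ^ 2) + g / (1 + g) * log g) + log g) ≤ (k + 1) *
        ((g ^ 2 / (1 + g ^ 2)) ^ r * (1 - g ^ 2 / (1 + g ^ 2)) ^ (k - r) * k.choose r) := by
  set ρ := g / (1 + g) with hρ
  have hρ0 : 0 < ρ := by positivity
  have hρ1 : ρ < 1 := by rw [hρ, div_lt_one (by positivity)]; linarith
  have hlg : log g < 0 := log_neg hg0 hg1
  have h0 := binomial_mode_ge (N := k) hρ0 hρ1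
  set r := ⌊((k : ℝ) + 1) * ρ⌋₊ with hr
  have hr1 : (r : ℝ) ≤ (k + 1) * ρ := Nat.floor_le (by positivity)
  have hr2 : ((k : ℝ) + 1) * ρ < r + 1 := Nat.lt_floor_add_one _
  have hrk : r ≤ k := by
    have h2 : ((k : ℝ) + 1) * ρ < k + 1 := mul_lt_of_lt_one_right (by positivity) hρ1
    have h3 : (r : ℝ) < ((k + 1 : ℕ) : ℝ) := by push_cast; linarith
    exact Nat.lt_succ_iff.1 (by exact_mod_cast h3)
  rw [mul_assoc, hρ, pow_mul_pow_div_one_add hg0 hrk, div_le_iff₀ (by positivity)] at h0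
  have h1 : (1 + g) ^ k ≤ (k + 1) * k.choose r * g ^ r := by
    have := mul_le_mul_of_nonneg_right h0 (by positivity : 0 ≤ (1 + g) ^ k)
    calc (1 + g) ^ k = 1 * (1 + g) ^ k := (one_mul _).symm
      _ ≤ _ := this
      _ = _ := by field_simp
  have hL : ∀ x : ℝ, 0 < x → ∀ m : ℕ, x ^ m = exp (m * log x) := fun x hx m => by
    rw [exp_nat_mul, exp_log hx]
  refine ⟨r, hrk, ?_, ?_⟩
  · have h2 : exp (k * (log (1 + g) - ρ * log g) + log g) ≤ (1 + g) ^ k / g ^ r := by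
      rw [hL _ (by positivity) k, hL g hg0 r, ← exp_sub]
      apply exp_le_exp.2
      have : ((r : ℝ) + 1 - k * ρ) * log g ≤ 0 :=
        mul_nonpos_of_nonneg_of_nonpos (by linarith) hlg.le
      linarith
    refine h2.trans ?_
    rwa [div_le_iff₀ (by positivity)]
  · rw [pow_mul_pow_div_one_add (by positivity) hrk]
    have h2 : exp (k * (log (1 + g) - log (1 + g ^ 2) + ρ * log g) + log g) ≤
        (1 + g) ^ k / (1 + g ^ 2) ^ k * g ^ r := by
      rw [hL (1 + g) (by positivity) k, hL g hg0 r, hL (1 + g ^ 2) (by positivity) k, ← exp_sub,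
        ← exp_add]
      apply exp_le_exp.2
      have : 0 ≤ ((r : ℝ) - 1 - k * ρ) * log g :=
        mul_nonneg_of_nonpos_of_nonpos (by linarith) hlg.le
      linarith
    refine h2.trans ?_
    calc (1 + g) ^ k / (1 + g ^ 2) ^ k * g ^ r
        ≤ ((k + 1) * k.choose r * g ^ r) / (1 + g ^ 2) ^ k * g ^ r := by gcongr
      _ = _ := by rw [← pow_mul, mul_comm 2 r, pow_mul]; ring

theorem exists_mem_Icc_mul_eq {a x b : ℝ} (h1 : a ≤ x) (h2 : x ≤ b) :
    ∃ θ : ℝ, 0 ≤ θ ∧ θ ≤ 1 ∧ (b - a) * θ = x - a := by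
  rcases (h1.trans h2).eq_or_lt with h | h
  · exact ⟨0, le_rfl, zero_le_one, by linarith⟩
  · refine ⟨(x - a) / (b - a), div_nonneg (by linarith) (by linarith),
      div_le_one_of_le₀ (by linarith) (by linarith), ?_⟩
    have : b - a ≠ 0 := by linarith
    field_simp

theorem sum_errProb_ge_of_rate {g p η x : ℝ} (hg0 : 0 < g) (hg1 : g < 1) (hc : chalf g ≤ 2.387025)
    (hp : p = g ^ 2 / (1 + g ^ 2)) (hη : 0 < η) (hx1 : binEntropy (tauCrit g) ≤ x)
    (hx2 : x ≤ log 2 - (log (1 + g) - g / (1 + g) * log g)) :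
    ∀ᶠ n : ℕ in atTop, ∀ {α : Type} [DecidableEq α] (s : Finset α)
      (c : α → Fin n → ZMod 2), exp (x * n) ≤ s.card →
      exp ((x + (2 * log (1 + g) - log 2 - log (1 + g ^ 2)) - η) * n) * s.card ≤
        ∑ i ∈ s, errProb p s c i := by
  obtain ⟨-, -, hτ0, hτ1, -, -⟩ := tauCrit_spec hg0 hg1 rfl
  have hr1 : 0 < binEntropy (tauCrit g) := binEntropy_pos hτ0 (by linarith)
  obtain ⟨ε₀, hε₀, hbase⟩ := sum_errProb_ge hg0 hg1 hc hp (half_pos hη)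
  have hp0 : 0 ≤ p := by rw [hp]; positivity
  have hp1 : p ≤ 1 := by rw [hp, div_le_one (by positivity)]; linarith
  obtain ⟨θ, hθ0, hθ1, hθ⟩ := exists_mem_Icc_mul_eq hx1 hx2
  set r₁ := binEntropy (tauCrit g) with hr₁
  obtain ⟨b, hb⟩ : ∃ b, b = log 2 - (log (1 + g) - g / (1 + g) * log g) := ⟨_, rfl⟩
  rw [← hb] at hx2 hθ
  have hL : log 2 - (log (1 + g) - g / (1 + g) * log g) = b := hb.symm
  have hV : ∀ m : ℕ, ((1 + g) ^ 2 / (2 * (1 + g ^ 2))) ^ m =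
      exp ((2 * log (1 + g) - log 2 - log (1 + g ^ 2)) * m) := by
    intro m
    have : 2 * log (1 + g) - log 2 - log (1 + g ^ 2) = log ((1 + g) ^ 2 / (2 * (1 + g ^ 2))) := by
      rw [log_div (by positivity) (by positivity), log_pow, log_mul (by norm_num) (by positivity)]
      push_cast; ring
    rw [this, mul_comm (log _), exp_nat_mul, exp_log (by positivity)]
  set lV := 2 * log (1 + g) - log 2 - log (1 + g ^ 2) with hlV
  obtain ⟨ε, hε, hεr, hεε⟩ : ∃ ε > 0, ε ≤ r₁ ∧ ε ≤ ε₀ :=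
    ⟨min r₁ ε₀, lt_min hr1 hε₀, min_le_left _ _, min_le_right _ _⟩
  obtain ⟨κ, hκ0, hκ1, hκη⟩ : ∃ κ > 0, κ ≤ 1 ∧ κ * (b - r₁) ≤ η / 4 := by
    refine ⟨min 1 (η / (4 * (b - r₁ + 1))), lt_min one_pos (div_pos hη (by linarith)),
      min_le_left _ _, ?_⟩
    have h1 : min 1 (η / (4 * (b - r₁ + 1))) * (b - r₁) ≤
        η / (4 * (b - r₁ + 1)) * (b - r₁ + 1) :=
      mul_le_mul (min_le_right _ _) (by linarith) (by linarith)
        (div_pos hη (by linarith)).le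
    have : b - r₁ + 1 ≠ 0 := by linarith
    calc _ ≤ _ := h1
      _ = η / 4 := by field_simp
  set β := (1 - κ) * θ with hβ
  have hβ0 : 0 ≤ β := mul_nonneg (by linarith) hθ0
  have hβ1 : β ≤ 1 - κ := mul_le_of_le_one_right (by linarith) hθ1
  have hβx : (b - r₁) * β = (1 - κ) * (x - r₁) := by rw [hβ, ← hθ]; ring
  have hκx : κ * (x - r₁) ≤ κ * (b - r₁) := by gcongr
  have hκx0 : 0 ≤ κ * (x - r₁) := mul_nonneg hκ0.le (by linarith)
  obtain ⟨M, hM⟩ := eventually_atTop.1 hbase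
  filter_upwards [eventually_le_mul_natCast (M : ℝ) hκ0,
    eventually_mul_pow_le_exp (8 / g) 1 (c := ε * κ) (by positivity),
    eventually_mul_pow_le_exp (4 / g * exp (b - r₁)) 1 (c := η / 4) (by positivity)] with n hn1 hn2 hn3
  have hn0 : (0 : ℝ) ≤ n := Nat.cast_nonneg n
  obtain ⟨k, hk1, hk2⟩ : ∃ k : ℕ, (k : ℝ) ≤ β * n ∧ β * n ≤ k + 1 :=
    ⟨⌊β * n⌋₊, Nat.floor_le (by positivity), (Nat.lt_floor_add_one _).le⟩
  have hkn : k ≤ n := by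
    have : (k : ℝ) ≤ n := hk1.trans (by nlinarith)
    exact_mod_cast this
  obtain ⟨m, rfl⟩ : ∃ m, n = m + k := ⟨n - k, by omega⟩
  push_cast at hk1 hk2 hn0 hn1 hn2 hn3 ⊢
  have hmκ : κ * ((m : ℝ) + k) ≤ m := by nlinarith
  have hm : M ≤ m := by
    have : (M : ℝ) ≤ m := hn1.trans hmκ
    exact_mod_cast this
  have hm0 : (0 : ℝ) ≤ m := Nat.cast_nonneg m
  have hk0 : (0 : ℝ) ≤ k := Nat.cast_nonneg k
  obtain ⟨r, hrk, hch1, hch2⟩ := choose_floor_bounds hg0 hg1 k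
  rw [← hp] at hch2
  rw [exp_add, exp_log hg0] at hch1 hch2
  rw [pow_one] at hn2 hn3
  have hxk : r₁ * m + b * k ≤ x * (m + k) := by
    have := mul_le_mul_of_nonneg_left hk1 (by linarith : 0 ≤ b - r₁)
    rw [← mul_assoc, hβx] at this
    have := mul_nonneg hκx0 hn0
    linarith
  have hxk' : (x - η / 4) * (m + k) - (b - r₁) ≤ r₁ * m + b * k := by
    have h1 := mul_le_mul_of_nonneg_left hk2 (by linarith : 0 ≤ b - r₁)
    rw [← mul_assoc, hβx] at h1
    have h2 := mul_le_mul_of_nonneg_right (hκx.trans hκη) hn0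
    linarith
  intro α _ s c hs
  have hmain := sum_errProb_ge_of_list hp0 hp1 hrk
    (E := exp ((r₁ - η / 2) * m) * ((1 + g) ^ 2 / (2 * (1 + g ^ 2))) ^ m) (by positivity) s c
    (fun t c' ht => hM m hm t c' (by
      refine le_trans ?_ ht
      rw [le_div_iff₀ (by positivity)]
      have e1 : exp ((r₁ - ε₀) * m) ≤ exp ((r₁ - ε) * m) := exp_mul_le_of_natCast (by linarith) m
      have e2 : 1 ≤ exp ((r₁ - ε) * m) := one_le_exp (mul_nonneg (by linarith) hm0)
      have e3 : (2 : ℝ) ^ k = exp (k * log 2) := by rw [exp_nat_mul, exp_log (by norm_num)]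
      have e4 : 8 * ((m : ℝ) + k + 2) ≤ g * exp (ε * m) := by
        have : exp (ε * κ * (m + k)) ≤ exp (ε * m) := exp_le_exp.2 (by
          rw [mul_assoc]; gcongr)
        have h5 := hn2.trans this
        rw [div_mul_eq_mul_div, div_le_iff₀ hg0] at h5
        linarith
      have e5 : ((k : ℝ) + 1) ≤ m + k + 2 := by linarith
      have e6 : (0 : ℝ) < k + 1 := by positivity
      refine le_of_mul_le_mul_left ?_ e6
      calc ((k : ℝ) + 1) * ((2 * exp ((r₁ - ε₀) * m) + 2) * (2 * 2 ^ k))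
          ≤ (m + k + 2) * ((2 * exp ((r₁ - ε) * m) + 2 * exp ((r₁ - ε) * m)) * (2 * 2 ^ k)) := by
            exact mul_le_mul e5 (mul_le_mul_of_nonneg_right (by linarith) (by positivity))
              (by positivity) (by positivity)
        _ = (8 * (m + k + 2)) * (exp ((r₁ - ε) * m) * exp (k * log 2)) := by rw [e3]; ring
        _ ≤ (g * exp (ε * m)) * (exp ((r₁ - ε) * m) * exp (k * log 2)) := by gcongr
        _ = exp (r₁ * m + k * log 2) * g := by
            have : exp (r₁ * m + k * log 2) =
              exp (ε * m) * (exp ((r₁ - ε) * m) * exp (k * log 2)) := by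
              rw [← exp_add, ← exp_add]; congr 1; ring
            rw [this]; ring
        _ ≤ exp (x * (m + k) + k * (log (1 + g) - g / (1 + g) * log g)) * g := by
            rw [hb] at hxk
            exact mul_le_mul_of_nonneg_right (exp_le_exp.2 (by linarith)) hg0.le
        _ ≤ s.card * ((k + 1) * k.choose r) := by
            rw [exp_add, mul_assoc]; gcongr
        _ = (k + 1) * (s.card * k.choose r) := by ring))
  refine le_trans ?_ hmain
  gcongr
  have hcon : (log (1 + g) - log (1 + g ^ 2) + g / (1 + g) * log g) = lV + b := by
    rw [hlV, hb]; ring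
  rw [hcon] at hch2
  rw [hV]
  have e5 : ((k : ℝ) + 1) ≤ m + k + 2 := by linarith
  have e6 : (0 : ℝ) < k + 1 := by positivity
  have e7 : 4 * exp (b - r₁) * (k + 1) ≤ g * exp (η / 4 * (m + k)) := by
    rw [div_mul_eq_mul_div, div_mul_eq_mul_div, div_le_iff₀ hg0] at hn3
    calc 4 * exp (b - r₁) * (k + 1) ≤ 4 * exp (b - r₁) * (m + k + 2) := by gcongr
      _ ≤ _ := hn3
      _ = _ := by ring
  refine le_of_mul_le_mul_left ?_ (by positivity : 0 < 4 * exp (b - r₁) * ((k : ℝ) + 1))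
  calc 4 * exp (b - r₁) * (k + 1) * exp ((x + lV - η) * (m + k))
      ≤ g * exp (η / 4 * (m + k)) * exp ((x + lV - η) * (m + k)) := by gcongr
    _ = g * exp (η / 4 * (m + k) + (x + lV - η) * (m + k)) := by rw [exp_add]; ring
    _ ≤ g * exp (k * (lV + b) + (r₁ - η / 2) * m + lV * m + (b - r₁)) := by
        have : 0 ≤ η / 2 * k := by positivity
        exact mul_le_mul_of_nonneg_left (exp_le_exp.2 (by linarith)) hg0.le
    _ = (exp (k * (lV + b)) * g) * (exp ((r₁ - η / 2) * m) * exp (lV * m)) * exp (b - r₁) := by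
        rw [exp_add, exp_add, exp_add]; ring
    _ ≤ ((k + 1) * (p ^ r * (1 - p) ^ (k - r) * k.choose r)) *
        (exp ((r₁ - η / 2) * m) * exp (lV * m)) * exp (b - r₁) := by gcongr
    _ = _ := by ring

theorem pow_hammingDist_eq_prod {n : ℕ} (a : ℝ) (x y : Fin n → ZMod 2) :
    a ^ hammingDist x y = ∏ i, if x i ≠ y i then a else 1 := by
  rw [hammingDist, ← Finset.prod_const, Finset.prod_filter]

theorem sum_pow_hammingDist_mul {n : ℕ} (a b : ℝ) (x x' : Fin n → ZMod 2) :
    ∑ y, a ^ hammingDist x y * b ^ hammingDist x' y =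
      (a + b) ^ hammingDist x' x * (1 + a * b) ^ (n - hammingDist x' x) := by
  have h1 : ∑ y : Fin n → ZMod 2, a ^ hammingDist x y * b ^ hammingDist x' y =
      ∏ i, ∑ t : ZMod 2, (if x i ≠ t then a else 1) * (if x' i ≠ t then b else 1) := by
    rw [Finset.prod_univ_sum, Fintype.piFinset_univ]
    refine Finset.sum_congr rfl fun y _ => ?_
    rw [pow_hammingDist_eq_prod, pow_hammingDist_eq_prod, ← Finset.prod_mul_distrib]
  have h2 : ∀ s t : ZMod 2, ∑ u : ZMod 2, (if s ≠ u then a else 1) * (if t ≠ u then b else 1) =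
      if t ≠ s then a + b else 1 + a * b := by
    intro s t
    have : (Finset.univ : Finset (ZMod 2)) = {0, 1} := rfl
    rw [this, Finset.sum_pair (by decide)]
    have h : ∀ u : ZMod 2, u = 0 ∨ u = 1 := by decide
    rcases h s with rfl | rfl <;> rcases h t with rfl | rfl <;> simp <;> ring
  have h3 : (Finset.univ.filter fun i => ¬ x' i ≠ x i).card = n - hammingDist x' x := by
    have := Finset.card_filter_add_card_filter_not (s := Finset.univ) fun i => x' i ≠ x i
    rw [Finset.card_univ, Fintype.card_fin] at this
    rw [hammingDist]
    omega
  rw [h1, Finset.prod_congr rfl fun i _ => h2 (x i) (x' i), Finset.prod_ite, Finset.prod_const,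
    Finset.prod_const, h3, hammingDist]

theorem sum_pow_hammingDist {n : ℕ} (a : ℝ) (x : Fin n → ZMod 2) :
    ∑ y, a ^ hammingDist x y = (1 + a) ^ n := by
  simpa using sum_pow_hammingDist_mul a 1 x x

theorem errProb_le_sum {n : ℕ} {g p : ℝ} (hg0 : 0 < g) (hg1 : g < 1)
    (hp : p = g ^ 2 / (1 + g ^ 2)) (s : Finset (Fin n → ZMod 2)) (x : Fin n → ZMod 2) :
    errProb p s id x ≤
      ∑ x' ∈ s with x' ≠ x, (2 * g / (1 + g ^ 2)) ^ hammingDist x' x := by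
  have hN : 0 < 1 + g ^ 2 := by positivity
  have hle : ∀ x' y : Fin n → ZMod 2, hammingDist x' y ≤ n := fun x' y => by
    simpa using hammingDist_le_card_fintype (x := x') (y := y)
  have hpt : ∀ y, p ^ hammingDist x y * (1 - p) ^ (n - hammingDist x y) =
      g ^ (2 * hammingDist x y) / (1 + g ^ 2) ^ n := fun y => by
    rw [hp, pow_mul_pow_div_one_add (by positivity) (hle x y), ← pow_mul]
  have hpair : ∀ x', ∑ y, g ^ hammingDist x y * g ^ hammingDist x' y / (1 + g ^ 2) ^ n =
      (2 * g / (1 + g ^ 2)) ^ hammingDist x' x := fun x' => by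
    have h1 : (1 + g ^ 2) ^ n =
        (1 + g ^ 2) ^ hammingDist x' x * (1 + g ^ 2) ^ (n - hammingDist x' x) := by
      rw [← pow_add]; congr 1; have := hle x' x; omega
    rw [← Finset.sum_div, sum_pow_hammingDist_mul, ← two_mul, ← sq, h1, div_pow]
    field_simp
  rw [errProb, Px]
  calc _ ≤ ∑ y, ∑ x' ∈ s with x' ≠ x,
        g ^ hammingDist x y * g ^ hammingDist x' y / (1 + g ^ 2) ^ n := by
        rw [Finset.sum_filter]
        refine Finset.sum_le_sum fun y _ => ?_
        split_ifs with hy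
        · obtain ⟨x', hx', hne, hd⟩ := hy
          refine le_trans ?_ (Finset.single_le_sum (fun z _ => by positivity)
            (Finset.mem_filter.2 ⟨hx', hne⟩))
          change p ^ hammingDist x y * (1 - p) ^ (n - hammingDist x y) ≤ _
          rw [hpt, two_mul, pow_add]
          have : g ^ hammingDist x y ≤ g ^ hammingDist x' y :=
            pow_le_pow_of_le_one hg0.le hg1.le hd
          gcongr
        · exact Finset.sum_nonneg fun z _ => by positivity
    _ = _ := by
        rw [Finset.sum_comm]
        exact Finset.sum_congr rfl fun x' _ => hpair x'

theorem exists_code_sum_le {n : ℕ} {γ : ℝ} (hγ : 0 < γ) (M : ℕ) (hM : 2 * M ≤ 2 ^ n) :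
    ∃ C : Finset (Fin n → ZMod 2), C.card = M ∧
      ∑ x ∈ C, ∑ x' ∈ C with x' ≠ x, γ ^ hammingDist x' x ≤ 2 * (M : ℝ) ^ 2 * ((1 + γ) / 2) ^ n := by
  induction M with
  | zero => exact ⟨∅, rfl, by simp⟩
  | succ M ih =>
    obtain ⟨C, hC, hsum⟩ := ih (by omega)
    have hcard : (2 : ℝ) ^ n / 2 ≤ (Cᶜ).card := by
      have h1 := Finset.card_add_card_compl C
      rw [Fintype.card_fun, ZMod.card, Fintype.card_fin] at h1
      have h2 : 2 ^ n ≤ 2 * (Cᶜ).card := by omega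
      have h3 : (2 : ℝ) ^ n ≤ 2 * (Cᶜ).card := by exact_mod_cast h2
      linarith
    have hne : (Cᶜ).Nonempty := by
      rw [← Finset.card_pos]
      have : (0 : ℝ) < (Cᶜ).card := lt_of_lt_of_le (by positivity) hcard
      exact_mod_cast this
    obtain ⟨y, hy, hyle⟩ : ∃ y ∈ Cᶜ, ∑ x ∈ C, γ ^ hammingDist x y ≤
        2 * M * ((1 + γ) / 2) ^ n := by
      by_contra hcon
      push Not at hcon
      have h1 := Finset.sum_lt_sum_of_nonempty hne hcon
      have h2 : ∑ y ∈ Cᶜ, ∑ x ∈ C, γ ^ hammingDist x y ≤ M * (1 + γ) ^ n := by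
        rw [Finset.sum_comm, ← hC, ← nsmul_eq_mul]
        refine Finset.sum_le_card_nsmul _ _ _ fun x _ => ?_
        rw [← sum_pow_hammingDist γ x]
        exact Finset.sum_le_sum_of_subset_of_nonneg (Finset.subset_univ _)
          fun _ _ _ => by positivity
      rw [Finset.sum_const, nsmul_eq_mul] at h1
      have h3 : 2 ^ n / 2 * (2 * M * ((1 + γ) / 2) ^ n) ≤ (Cᶜ).card * (2 * M * ((1 + γ) / 2) ^ n) := by
        gcongr
      have h4 : 2 ^ n / 2 * (2 * M * ((1 + γ) / 2) ^ n) = M * (1 + γ) ^ n := by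
        rw [div_pow]; field_simp
      linarith
    have hyC := Finset.mem_compl.1 hy
    refine ⟨insert y C, by rw [Finset.card_insert_of_notMem hyC, hC], ?_⟩
    have e1 : ∑ x' ∈ insert y C with x' ≠ y, γ ^ hammingDist x' y = ∑ x ∈ C, γ ^ hammingDist x y := by
      congr 1
      ext z
      simp only [Finset.mem_filter, Finset.mem_insert]
      constructor
      · rintro ⟨h | h, h'⟩
        · exact absurd h h'
        · exact h
      · exact fun h => ⟨Or.inr h, fun e => hyC (e ▸ h)⟩
    have e2 : ∀ x ∈ C, ∑ x' ∈ insert y C with x' ≠ x, γ ^ hammingDist x' x =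
        γ ^ hammingDist x y + ∑ x' ∈ C with x' ≠ x, γ ^ hammingDist x' x := by
      intro x hx
      rw [Finset.filter_insert, if_pos (show y ≠ x from fun e => hyC (e ▸ hx)), Finset.sum_insert
        (fun h => hyC (Finset.mem_filter.1 h).1), hammingDist_comm]
    rw [Finset.sum_insert hyC, e1, Finset.sum_congr rfl e2, Finset.sum_add_distrib]
    have hV : 0 < ((1 + γ) / 2) ^ n := by positivity
    push_cast
    nlinarith

theorem Pe_eq_sum_errProb {n : ℕ} (p : ℝ) (C : Finset (Fin n → ZMod 2)) :
    Pe p C = (C.card : ℝ)⁻¹ * ∑ x ∈ C, errProb p C id x := by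
  simp only [Pe, errProb, id]

theorem eventually_exp_le_Pe {g p x L η : ℝ} (hg0 : 0 < g) (hg1 : g < 1)
    (hc : chalf g ≤ 2.387025) (hp : p = g ^ 2 / (1 + g ^ 2))
    (hL : L = 2 * log (1 + g) - log 2 - log (1 + g ^ 2)) (hx1 : binEntropy (tauCrit g) ≤ x)
    (hx2 : x ≤ log 2 - (log (1 + g) - g / (1 + g) * log g)) (hη : 0 < η) :
    ∀ᶠ n : ℕ in atTop, ∀ C : Finset (Fin n → ZMod 2), exp (x * n) ≤ C.card →
      exp ((x + L - η) * n) ≤ Pe p C := by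
  filter_upwards [sum_errProb_ge_of_rate hg0 hg1 hc hp hη hx1 hx2] with n hn
  intro C hC
  have hC0 : (0 : ℝ) < C.card := (exp_pos _).trans_le hC
  rw [Pe_eq_sum_errProb, ← div_eq_inv_mul, le_div_iff₀ hC0, hL]
  exact hn C id hC

theorem eventually_exists_Pe_le {g p x L : ℝ} (hg0 : 0 < g) (hg1 : g < 1)
    (hp : p = g ^ 2 / (1 + g ^ 2)) (hL : L = 2 * log (1 + g) - log 2 - log (1 + g ^ 2))
    (hx0 : 0 ≤ x) (hx : x < log 2) :
    ∀ᶠ n : ℕ in atTop, ∃ C : Finset (Fin n → ZMod 2), exp (x * n) ≤ C.card ∧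
      Pe p C ≤ 4 * exp ((x + L) * n) := by
  filter_upwards [eventually_mul_pow_le_exp 4 0 (sub_pos.2 hx)] with n hn
  have h2 : (2 : ℝ) ^ n = exp (log 2 * n) := by
    rw [mul_comm, exp_nat_mul, exp_log (by norm_num)]
  have h1 : 1 ≤ exp (x * n) := one_le_exp (by positivity)
  have hceil := Nat.ceil_lt_add_one (exp_pos (x * n)).le
  set M := ⌈exp (x * n)⌉₊ with hMdef
  have hM2 : (M : ℝ) ≤ 2 * exp (x * n) := by linarith
  have hM1 : exp (x * n) ≤ M := Nat.le_ceil _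
  have hM0 : (0 : ℝ) < M := (exp_pos _).trans_le hM1
  have hM : 2 * M ≤ 2 ^ n := by
    have : 2 * (M : ℝ) ≤ 2 ^ n := by
      rw [pow_zero, mul_one] at hn
      calc 2 * (M : ℝ) ≤ 4 * exp (x * n) := by linarith
        _ ≤ exp ((log 2 - x) * n) * exp (x * n) := by gcongr
        _ = 2 ^ n := by rw [h2, ← exp_add]; congr 1; ring
    exact_mod_cast this
  obtain ⟨C, hC, hsum⟩ := exists_code_sum_le (γ := 2 * g / (1 + g ^ 2)) (by positivity) M hM
  refine ⟨C, by rw [hC]; exact hM1, ?_⟩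
  have hV : ((1 + 2 * g / (1 + g ^ 2)) / 2) ^ n = exp (L * n) := by
    have : L = log ((1 + 2 * g / (1 + g ^ 2)) / 2) := by
      have e : (1 + 2 * g / (1 + g ^ 2)) / 2 = (1 + g) ^ 2 / (2 * (1 + g ^ 2)) := by
        field_simp; ring
      rw [hL, e, log_div (by positivity) (by positivity), log_pow,
        log_mul (by norm_num) (by positivity)]
      push_cast; ring
    rw [this, mul_comm (log _), exp_nat_mul, exp_log (by positivity)]
  rw [hV] at hsum
  rw [Pe_eq_sum_errProb, ← div_eq_inv_mul, hC, div_le_iff₀ hM0]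
  calc ∑ x ∈ C, errProb p C id x
      ≤ ∑ x ∈ C, ∑ x' ∈ C with x' ≠ x, (2 * g / (1 + g ^ 2)) ^ hammingDist x' x :=
        Finset.sum_le_sum fun x _ => errProb_le_sum hg0 hg1 hp C x
    _ ≤ 2 * M ^ 2 * exp (L * n) := hsum
    _ = 2 * M * exp (L * n) * M := by ring
    _ ≤ 2 * (2 * exp (x * n)) * exp (L * n) * M := by gcongr
    _ = 4 * exp ((x + L) * n) * M := by rw [add_mul, exp_add]; ring

theorem relE_eq {g p x L R : ℝ} (hg0 : 0 < g) (hg1 : g < 1)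
    (hc : chalf g ≤ 2.387025) (hp : p = g ^ 2 / (1 + g ^ 2))
    (hL : L = 2 * log (1 + g) - log 2 - log (1 + g ^ 2)) (hxR : x = R * log 2)
    (hx1 : binEntropy (tauCrit g) ≤ x)
    (hx2 : x ≤ log 2 - (log (1 + g) - g / (1 + g) * log g)) :
    relE p R = -(x + L) / log 2 := by
  obtain ⟨-, -, hτ0, hτ1, -, -⟩ := tauCrit_spec hg0 hg1 rfl
  have hx0 : 0 < x := (binEntropy_pos hτ0 (by linarith)).trans_le hx1
  have hl2 : 0 < log 2 := log_pos (by norm_num)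
  have hlg : g / (1 + g) * log g < 0 := mul_neg_of_pos_of_neg (by positivity) (log_neg hg0 hg1)
  have hl1 : 0 < log (1 + g) := log_pos (by linarith)
  have hrate : ∀ n : ℕ, (2 : ℝ) ^ (R * n) = exp (x * n) := fun n => by
    rw [rpow_def_of_pos (by norm_num), hxR]; congr 1; ring
  have key : ∀ η > 0, ∀ᶠ n : ℕ in atTop,
      exp (-(x + L + η) * n) ≤ sSup ((fun C : Finset (Fin n → ZMod 2) => 1 / Pe p C) ''
        {C | (2 : ℝ) ^ (R * n) ≤ C.card}) ∧
      sSup ((fun C : Finset (Fin n → ZMod 2) => 1 / Pe p C) ''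
        {C | (2 : ℝ) ^ (R * n) ≤ C.card}) ≤ exp (-(x + L - η) * n) := by
    intro η hη
    filter_upwards [eventually_exp_le_Pe hg0 hg1 hc hp hL hx1 hx2 hη,
      eventually_exists_Pe_le hg0 hg1 hp hL hx0.le (by linarith),
      eventually_mul_pow_le_exp 4 0 hη] with n h1 ⟨C, hC1, hC2⟩ h3
    rw [hrate]
    have hPC := (exp_pos _).trans_le (h1 C hC1)
    constructor
    · refine le_trans ?_ (le_csSup (Set.toFinite _).bddAbove ⟨C, hC1, rfl⟩)
      change _ ≤ 1 / Pe p C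
      rw [le_div_iff₀ hPC]
      rw [pow_zero, mul_one] at h3
      calc exp (-(x + L + η) * n) * Pe p C
          ≤ exp (-(x + L + η) * n) * (exp (η * n) * exp ((x + L) * n)) := by
            gcongr; exact hC2.trans (by gcongr)
        _ = 1 := by
            rw [← exp_add, ← exp_add, ← exp_zero]; congr 1; ring
    · refine csSup_le ⟨_, C, hC1, rfl⟩ ?_
      rintro _ ⟨C', hC', rfl⟩
      have h4 := h1 C' hC'
      change 1 / Pe p C' ≤ _
      rw [div_le_iff₀ ((exp_pos _).trans_le h4)]
      calc (1 : ℝ) = exp (-(x + L - η) * n) * exp ((x + L - η) * n) := by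
            rw [← exp_add, ← exp_zero]; congr 1; ring
        _ ≤ _ := by gcongr
  refine Tendsto.limsup_eq ?_
  rw [Metric.tendsto_nhds]
  intro δ hδ
  filter_upwards [key (δ / 2 * log 2) (by positivity), eventually_gt_atTop 0] with n ⟨h1, h2⟩ hn
  have hn' : (0 : ℝ) < n := by exact_mod_cast hn
  set Z := sSup ((fun C : Finset (Fin n → ZMod 2) => 1 / Pe p C) ''
        {C | (2 : ℝ) ^ (R * n) ≤ C.card})
  have hS : 0 < Z := (exp_pos _).trans_le h1
  have l1 := (le_log_iff_exp_le hS).2 h1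
  have l2 := (log_le_iff_le_exp hS).2 h2
  have e : (n : ℝ)⁻¹ * logb 2 Z - -(x + L) / log 2 = (log Z / n + (x + L)) / log 2 := by
    rw [logb]; field_simp; ring
  rw [Real.dist_eq, e, abs_div, abs_of_pos hl2, div_lt_iff₀ hl2]
  have a1 : -(x + L + δ / 2 * log 2) ≤ log Z / n := (le_div_iff₀ hn').2 l1
  have a2 : log Z / n ≤ -(x + L - δ / 2 * log 2) := (div_le_iff₀ hn').2 l2
  have hδl : 0 < δ * log 2 := by positivity
  rw [abs_lt]
  constructor <;> linarith

theorem binEntropy_div_one_add {g : ℝ} (hg0 : 0 < g) :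
    binEntropy (g / (1 + g)) = log (1 + g) - g / (1 + g) * log g := by
  have h1 : 1 - g / (1 + g) = 1 / (1 + g) := by field_simp; ring
  rw [binEntropy, h1, inv_div, inv_div, div_one, log_div (by positivity) hg0.ne']
  field_simp
  ring

theorem Dkl_div_one_add {g p : ℝ} (hg0 : 0 < g) (hp : p = g ^ 2 / (1 + g ^ 2)) :
    Dkl (g / (1 + g)) p = (log (1 + g ^ 2) - log (1 + g) - g / (1 + g) * log g) / log 2 := by
  have h1 : 1 - g / (1 + g) = 1 / (1 + g) := by field_simp; ring
  have h2 : 1 - p = 1 / (1 + g ^ 2) := by rw [hp]; field_simp; ring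
  have h3 : g / (1 + g) / p = (1 + g ^ 2) / ((1 + g) * g) := by rw [hp]; field_simp
  have h4 : 1 / (1 + g) / (1 / (1 + g ^ 2)) = (1 + g ^ 2) / (1 + g) := by field_simp
  have hl2 : 0 < log 2 := log_pos (by norm_num)
  rw [Dkl, h1, h2, h3, h4, logb, logb, log_div (by positivity) (by positivity),
    log_div (by positivity) (by positivity), log_mul (by positivity) hg0.ne']
  field_simp
  ring

/-- Let `p` be the crossover probability of a BSC with `0.046 ≤ p < 1/2`, let
`ρ = √p/(√p+√(1−p))`, `δ₁ = 2ρ(1−ρ)`, `R_crit = 1 − h(ρ)`, and `R₁ = R̄(δ₁)`. Then for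
every rate `R₁ ≤ R ≤ R_crit`, the channel reliability equals the random coding exponent:
`E(R,p) = E₀(R,p) = D(ρ‖p) + R_crit − R`. -/
theorem reliability_equals_random_coding (p ρ δ₁ R₁ Rcrit R : ℝ)
    (hp : 0.046 ≤ p) (hp' : p < 1/2)
    (hρ : ρ = Real.sqrt p / (Real.sqrt p + Real.sqrt (1 - p)))
    (hδ₁ : δ₁ = 2 * ρ * (1 - ρ)) (hR₁ : R₁ = Rbar δ₁) (hRc : Rcrit = 1 - H ρ)
    (hlo : R₁ ≤ R) (hhi : R ≤ Rcrit) :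
    relE p R = Dkl ρ p + Rcrit - R := by
  have hp0 : 0 < p := by linarith
  have hq0 : 0 < 1 - p := by linarith
  have ha := sqrt_pos.2 hp0
  have hb := sqrt_pos.2 hq0
  have ha2 := sq_sqrt hp0.le
  have hb2 := sq_sqrt hq0.le
  have hab : √p < √(1 - p) := sqrt_lt_sqrt hp0.le (by linarith)
  set g := √p / √(1 - p) with hg
  have hg0 : 0 < g := by positivity
  have hg1 : g < 1 := (div_lt_one hb).2 hab
  have hg2 : g ^ 2 = p / (1 - p) := by rw [hg, div_pow, ha2, hb2]
  have hpg : p = g ^ 2 / (1 + g ^ 2) := by rw [hg2]; field_simp; ring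
  have hρg : ρ = g / (1 + g) := by rw [hρ, hg]; field_simp; ring
  have hδg : δ₁ = 2 * g / (1 + g) ^ 2 := by rw [hδ₁, hρg]; field_simp; ring
  have hcpos := one_lt_chalf hg0 hg1
  have hc : chalf g ≤ 2.387025 := by
    have h1 : chalf g ^ 2 * (4 * (p * (1 - p))) = 1 := by
      have : 1 - p = 1 / (1 + g ^ 2) := by rw [hpg]; field_simp; ring
      rw [this, hpg, chalf]; field_simp; norm_num
    have h2 : 0.043884 ≤ p * (1 - p) := by nlinarith
    by_contra hcon
    push Not at hcon
    nlinarith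
  have hδc : δ₁ = 1 / (1 + chalf g) := by
    rw [hδg, chalf]; field_simp; ring
  have hl2 : 0 < log 2 := log_pos (by norm_num)
  have hrate : H (tauCrit g) ≤ R := by
    rw [tauCrit_eq hg0 hg1, ← hδg]
    refine le_trans (le_Rbar ?_ ?_) (hR₁ ▸ hlo)
    · rw [hδc, le_div_iff₀ (by linarith)]; linarith
    · rw [hδc, div_le_iff₀ (by linarith)]; linarith
  rw [H_eq, div_le_iff₀ hl2] at hrate
  have hRc' : Rcrit = 1 - (log (1 + g) - g / (1 + g) * log g) / log 2 := by
    rw [hRc, H_eq, hρg, binEntropy_div_one_add hg0]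
  have hx2 : R * log 2 ≤ log 2 - (log (1 + g) - g / (1 + g) * log g) := by
    have := mul_le_mul_of_nonneg_right (hRc' ▸ hhi) hl2.le
    rwa [sub_mul, one_mul, div_mul_cancel₀ _ hl2.ne'] at this
  rw [relE_eq hg0 hg1 hc hpg rfl rfl hrate hx2, hRc', hρg, Dkl_div_one_add hg0 hpg]
  field_simp
  ring
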